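/- arXiv:2510.17743 — 5 statements merged into one kernel-verified Lean document; each statement's English description precedes it below -/
import Mathlib

section
/- For every integer d ≥ 2 and every ε > 0 there exists K₁ = K₁(ε, d) such that the following holds. For all integers n, k, t with K₁ ≤ k ≤ n^t and 1 ≤ t ≤ d−1, there exists a subset S ⊆ [n]^d with |S| ≥ (1−ε)·k·n^{d−t} such that every t-dimensional affine subspace of ℝ^d contains at most k points of S. -/
open Set

noncomputable section

/-- The grid `[n]^d = {1,…,n}^d` regarded as a subset of `ℝ^d`. -/
def gridD (n d : ℕ) : Set (Fin d → ℝ) :=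
  {x | ∀ i, ∃ a : ℤ, 1 ≤ a ∧ a ≤ (n : ℤ) ∧ x i = (a : ℝ)}

/-- A `t`-dimensional affine subspace of `ℝ^d`. -/
def IsAffineOfDim (d t : ℕ) (F : AffineSubspace ℝ (Fin d → ℝ)) : Prop :=
  Module.finrank ℝ F.direction = t

/-- An axis-aligned `t`-dimensional affine subspace of `ℝ^d`: one of the form
`{x : x i = c i for all i ∈ I}` for an index set `I` of size `d - t`. -/
def IsAxisAligned (d t : ℕ) (F : AffineSubspace ℝ (Fin d → ℝ)) : Prop :=
  ∃ (I : Finset (Fin d)) (c : Fin d → ℝ), I.card = d - t ∧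
    (F : Set (Fin d → ℝ)) = {x | ∀ i ∈ I, x i = c i}

/-- Bernoulli sampling followed by deletion. -/
lemma exists_subset_card_inter_le {α ι : Type*} [DecidableEq α] (G : Finset α) (I : Finset ι)
    (T : ι → Finset α) (hT : ∀ i ∈ I, T i ⊆ G) (u : ι → ℝ) (k : ℕ) (hk : 1 ≤ k)
    (hu : ∀ i ∈ I, 1 + 1 / (k : ℝ) ≤ u i) (q : ℝ) (hq0 : 0 ≤ q) (hq1 : q ≤ 1) :
    ∃ S ⊆ G, (∀ i ∈ I, (S ∩ T i).card ≤ k) ∧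
      q * G.card - ∑ i ∈ I, k * (Real.exp (q * (u i - 1) * (T i).card) / u i ^ k) ≤ S.card := by
  have hk0 : (0 : ℝ) < k := by exact_mod_cast hk
  have hu1 : ∀ i ∈ I, 1 ≤ u i := fun i hi => le_trans (by simp) (hu i hi)
  set w : Finset α → ℝ := fun S => (∏ _x ∈ S, q) * ∏ _x ∈ G \ S, (1 - q) with hw
  have hw0 : ∀ S, 0 ≤ w S := fun S =>
    mul_nonneg (Finset.prod_nonneg fun _ _ => hq0) (Finset.prod_nonneg fun _ _ => by linarith)
  have hw1 : ∑ S ∈ G.powerset, w S = 1 := by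
    rw [← Finset.prod_add]; simp
  have hmean : ∑ S ∈ G.powerset, w S * S.card = q * G.card := by
    have hx : ∀ x ∈ G, ∑ S ∈ G.powerset, w S * (if x ∈ S then 1 else 0) = q := by
      intro x hx
      have h := Finset.prod_add (fun _ => q) (fun y => if y = x then 0 else 1 - q) G
      have h2 : ∏ y ∈ G, (q + if y = x then 0 else 1 - q) = q := by
        rw [Finset.prod_eq_single_of_mem x hx]
        · simp
        · intro y _ hy; simp [hy]
      rw [h2] at h
      rw [h]
      refine Finset.sum_congr rfl fun S _ => ?_
      by_cases hxS : x ∈ S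
      · simp only [hw, hxS, if_true, mul_one]
        congr 1
        refine Finset.prod_congr rfl fun y hy => ?_
        rw [if_neg]
        rintro rfl
        exact (Finset.mem_sdiff.1 hy).2 hxS
      · rw [if_neg hxS, mul_zero, Finset.prod_eq_zero (Finset.mem_sdiff.2 ⟨hx, hxS⟩) (if_pos rfl :
          (if x = x then (0 : ℝ) else 1 - q) = 0), mul_zero]
    calc ∑ S ∈ G.powerset, w S * S.card
        = ∑ S ∈ G.powerset, ∑ x ∈ G, w S * (if x ∈ S then 1 else 0) := by
          refine Finset.sum_congr rfl fun S hS => ?_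
          rw [← Finset.mul_sum, Finset.sum_ite_mem,
            Finset.inter_eq_right.2 (Finset.mem_powerset.1 hS)]
          simp
      _ = q * G.card := by
          rw [Finset.sum_comm, Finset.sum_congr rfl hx]
          simp [mul_comm]
  have hexp : ∀ i ∈ I, ∑ S ∈ G.powerset, w S * u i ^ (S ∩ T i).card ≤
      Real.exp (q * (u i - 1) * (T i).card) := by
    intro i hi
    have h := Finset.prod_add (fun y => q * if y ∈ T i then u i else 1) (fun _ => 1 - q) G
    have h1 : ∑ S ∈ G.powerset, w S * u i ^ (S ∩ T i).card =
        ∏ y ∈ G, (q * (if y ∈ T i then u i else 1) + (1 - q)) := by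
      rw [h]
      refine Finset.sum_congr rfl fun S _ => ?_
      rw [Finset.prod_mul_distrib, Finset.prod_ite_mem, Finset.prod_const (u i)]
      simp only [hw]; ring
    rw [h1]
    calc ∏ y ∈ G, (q * (if y ∈ T i then u i else 1) + (1 - q))
        ≤ ∏ y ∈ G, Real.exp (if y ∈ T i then q * (u i - 1) else 0) := by
          refine Finset.prod_le_prod (fun y _ => ?_) (fun y _ => ?_)
          · have := hu1 i hi
            split_ifs <;> nlinarith
          · split_ifs
            · have := Real.add_one_le_exp (q * (u i - 1)); linarith
            · simp
      _ = Real.exp (q * (u i - 1) * (T i).card) := by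
          rw [← Real.exp_sum, Finset.sum_ite_mem, Finset.inter_eq_right.2 (hT i hi)]
          simp [mul_comm]
  set a : ℝ := q * G.card - ∑ i ∈ I, k * (Real.exp (q * (u i - 1) * (T i).card) / u i ^ k)
    with ha
  set f : Finset α → ℝ := fun S => S.card - ∑ i ∈ I, k * (u i ^ (S ∩ T i).card / u i ^ k) with hf
  have hfa : a ≤ ∑ S ∈ G.powerset, w S * f S := by
    have h1 : ∑ S ∈ G.powerset, w S * f S = q * G.card -
        ∑ i ∈ I, k * ((∑ S ∈ G.powerset, w S * u i ^ (S ∩ T i).card) / u i ^ k) := by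
      simp only [hf, mul_sub, Finset.sum_sub_distrib, hmean, Finset.mul_sum, Finset.sum_div]
      rw [Finset.sum_comm]
      congr 1
      refine Finset.sum_congr rfl fun i _ => Finset.sum_congr rfl fun S _ => ?_
      ring
    rw [h1, ha]
    gcongr with i hi
    · exact pow_nonneg (zero_le_one.trans (hu1 i hi)) _
    · exact hexp i hi
  obtain ⟨S, hS, hSle⟩ : ∃ S ∈ G.powerset, a ≤ f S := by
    by_contra! hcon
    obtain ⟨S₀, hS₀, hw₀⟩ : ∃ S ∈ G.powerset, w S ≠ 0 :=
      Finset.exists_ne_zero_of_sum_ne_zero (by rw [hw1]; exact one_ne_zero)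
    have : ∑ S ∈ G.powerset, w S * f S < ∑ S ∈ G.powerset, w S * a :=
      Finset.sum_lt_sum (fun S hS => mul_le_mul_of_nonneg_left (hcon S hS).le (hw0 S))
        ⟨S₀, hS₀, mul_lt_mul_of_pos_left (hcon S₀ hS₀) (lt_of_le_of_ne (hw0 S₀) hw₀.symm)⟩
    rw [← Finset.sum_mul, hw1, one_mul] at this
    exact absurd hfa (not_le.2 this)
  set J := I.filter fun i => k < (S ∩ T i).card with hJ
  refine ⟨S \ J.biUnion fun i => S ∩ T i, Finset.sdiff_subset.trans (Finset.mem_powerset.1 hS),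
    fun i hi => ?_, hSle.trans ?_⟩
  · by_cases hik : k < (S ∩ T i).card
    · have : (S \ J.biUnion fun i => S ∩ T i) ∩ T i = ∅ := by
        ext x
        simp only [Finset.mem_inter, Finset.mem_sdiff, Finset.mem_biUnion, Finset.notMem_empty,
          iff_false]
        rintro ⟨⟨hxS, hx⟩, hxT⟩
        exact hx ⟨i, Finset.mem_filter.2 ⟨hi, hik⟩, hxS, hxT⟩
      simp [this]
    · exact (Finset.card_le_card (Finset.inter_subset_inter_right Finset.sdiff_subset)).trans
        (not_lt.1 hik)
  · have h1 : S.card ≤ (S \ J.biUnion fun i => S ∩ T i).card + ∑ i ∈ J, (S ∩ T i).card :=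
      calc S.card ≤ (S \ J.biUnion fun i => S ∩ T i).card + (J.biUnion fun i => S ∩ T i).card :=
            Finset.card_le_card_sdiff_add_card
        _ ≤ _ := Nat.add_le_add_left Finset.card_biUnion_le _
    have h2 : ∑ i ∈ J, ((S ∩ T i).card : ℝ) ≤
        ∑ i ∈ I, k * (u i ^ (S ∩ T i).card / u i ^ k) := by
      refine (Finset.sum_le_sum fun i hi => ?_).trans
        (Finset.sum_le_sum_of_subset_of_nonneg (Finset.filter_subset _ _) fun i hi _ => ?_)
      · obtain ⟨hiI, hik⟩ := Finset.mem_filter.1 hi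
        obtain ⟨r, hr⟩ := Nat.exists_eq_add_of_lt hik
        have hu0 : 0 < u i := zero_lt_one.trans_le (hu1 i hiI)
        rw [hr, add_assoc, pow_add, mul_div_cancel_left₀ _ (pow_pos hu0 k).ne']
        have hb : 1 + ((r + 1 : ℕ) : ℝ) * (1 / k) ≤ (1 + 1 / (k : ℝ)) ^ (r + 1) :=
          one_add_mul_le_pow (by have : 0 < 1 / (k : ℝ) := by positivity
                                 linarith) _
        have hc : (1 + 1 / (k : ℝ)) ^ (r + 1) ≤ u i ^ (r + 1) :=
          pow_le_pow_left₀ (by positivity) (hu i hiI) _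
        calc ((k + (r + 1) : ℕ) : ℝ) = k * (1 + ((r + 1 : ℕ) : ℝ) * (1 / k)) := by
              push_cast; field_simp
          _ ≤ _ := by gcongr; exact hb.trans hc
      · have := zero_le_one.trans (hu1 i hi)
        positivity
    have h1' : (S.card : ℝ) ≤ (S \ J.biUnion fun i => S ∩ T i).card +
        ∑ i ∈ J, ((S ∩ T i).card : ℝ) := by exact_mod_cast h1
    simp only [hf]
    linarith

/-- A sublattice of `ℤ^t` containing `t` independent vectors of a box has finite index, and this
index controls the number of its points in the box. -/
lemma card_mul_index_le {t n : ℕ} (L : AddSubgroup (Fin t → ℤ)) (U : Matrix (Fin t) (Fin t) ℤ)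
    (hU : U.det ≠ 0) (hUL : ∀ l, U l ∈ L) (hb : ∀ l i, |U l i| ≤ n)
    (Q : Finset (Fin t → ℤ)) (hQ : ∀ z ∈ Q, z ∈ L ∧ ∀ i, |z i| ≤ n) :
    0 < L.index ∧ Q.card * L.index ≤ (2 * ((t + 1) * n) + 1) ^ t := by
  have hred : ∀ z : Fin t → ℤ, ∃ z' : Fin t → ℤ,
      (z : (Fin t → ℤ) ⧸ L) = z' ∧ ∀ i, |z' i| ≤ t * n := by
    intro z
    set c : Fin t → ℝ := fun l => ((Matrix.vecMul z U.adjugate l : ℤ) : ℝ) / U.det with hc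
    have hcz : ∀ i, ∑ l, c l * U l i = z i := by
      intro i
      have h : Matrix.vecMul (Matrix.vecMul z U.adjugate) U = U.det • z := by
        rw [Matrix.vecMul_vecMul, Matrix.adjugate_mul, Matrix.vecMul_smul, Matrix.vecMul_one]
      have h2 := congrFun h i
      simp only [Matrix.vecMul, dotProduct, Pi.smul_apply, smul_eq_mul] at h2
      have h3 : (U.det : ℝ) ≠ 0 := by exact_mod_cast hU
      simp only [hc, div_mul_eq_mul_div, ← Finset.sum_div]
      rw [div_eq_iff h3, mul_comm]
      simp only [Matrix.vecMul, dotProduct]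
      exact_mod_cast h2
    refine ⟨z - ∑ l, ⌊c l⌋ • U l, ?_, fun i => ?_⟩
    · rw [QuotientAddGroup.eq]
      have : -z + (z - ∑ l, ⌊c l⌋ • U l) = -∑ l, ⌊c l⌋ • U l := by abel
      rw [this]
      exact L.neg_mem (L.sum_mem fun l _ => L.zsmul_mem (hUL l) _)
    · have h : (((z - ∑ l, ⌊c l⌋ • U l) i : ℤ) : ℝ) = ∑ l, Int.fract (c l) * U l i := by
        simp only [Pi.sub_apply, Finset.sum_apply, Pi.smul_apply, smul_eq_mul]
        push_cast
        rw [← hcz i, ← Finset.sum_sub_distrib]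
        refine Finset.sum_congr rfl fun l _ => ?_
        rw [Int.fract]; ring
      have h2 : |(((z - ∑ l, ⌊c l⌋ • U l) i : ℤ) : ℝ)| ≤ t * n := by
        rw [h]
        refine (Finset.abs_sum_le_sum_abs _ _).trans ?_
        calc ∑ l, |Int.fract (c l) * U l i| ≤ ∑ _l : Fin t, (n : ℝ) := by
              refine Finset.sum_le_sum fun l _ => ?_
              rw [abs_mul, abs_of_nonneg (Int.fract_nonneg _)]
              have h3 : |(U l i : ℝ)| ≤ n := by exact_mod_cast hb l i
              calc Int.fract (c l) * |(U l i : ℝ)| ≤ 1 * n := by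
                    gcongr; exact (Int.fract_lt_one _).le
                _ = n := one_mul _
          _ = t * n := by simp
      exact_mod_cast h2
  set box : ℕ → Finset (Fin t → ℤ) := fun R =>
    Fintype.piFinset fun _ => Finset.Icc (-(R : ℤ)) R with hbox
  have mem_box : ∀ R z, z ∈ box R ↔ ∀ i, |z i| ≤ R := fun R z => by
    simp [hbox, Fintype.mem_piFinset, abs_le]
  have hrep : ∀ a : (Fin t → ℤ) ⧸ L, ∃ z : Fin t → ℤ, (z : (Fin t → ℤ) ⧸ L) = a ∧
      z ∈ box (t * n) := by
    intro a
    obtain ⟨z, rfl⟩ := QuotientAddGroup.mk_surjective a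
    obtain ⟨z', h1, h2⟩ := hred z
    exact ⟨z', h1.symm, (mem_box _ _).2 (by exact_mod_cast h2)⟩
  choose rep hrep1 hrep2 using hrep
  have hfin : Finite ((Fin t → ℤ) ⧸ L) :=
    Finite.of_injective (fun a => (⟨rep a, hrep2 a⟩ : box (t * n))) fun a b hab => by
      rw [← hrep1 a, ← hrep1 b, show rep a = rep b from congrArg Subtype.val hab]
  have := Fintype.ofFinite ((Fin t → ℤ) ⧸ L)
  refine ⟨Nat.pos_of_ne_zero AddSubgroup.index_ne_zero_of_finite, ?_⟩
  rw [AddSubgroup.index_eq_card, Nat.card_eq_fintype_card, ← Finset.card_univ,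
    ← Finset.card_product]
  have hcard : (box ((t + 1) * n)).card = (2 * ((t + 1) * n) + 1) ^ t := by
    simp only [hbox, Fintype.card_piFinset, Int.card_Icc, Finset.prod_const, Finset.card_univ,
      Fintype.card_fin]
    congr 1; omega
  rw [← hcard]
  refine Finset.card_le_card_of_injOn (fun p => p.1 + rep p.2) (fun p hp => ?_) ?_
  · rw [Finset.mem_coe, mem_box]
    intro i
    have h1 := (hQ p.1 (Finset.mem_product.1 hp).1).2 i
    have h2 := (mem_box _ _).1 (hrep2 p.2) i
    refine (abs_add_le _ _).trans ?_
    push_cast at h2 ⊢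
    linarith
  · rintro ⟨z, a⟩ hp ⟨y, b⟩ hq h
    have hz := (hQ z (Finset.mem_product.1 hp).1).1
    have hy := (hQ y (Finset.mem_product.1 hq).1).1
    have h' : z + rep a = y + rep b := h
    have hab : a = b := by
      have := congrArg (QuotientAddGroup.mk : _ → (Fin t → ℤ) ⧸ L) h'
      rwa [QuotientAddGroup.mk_add, QuotientAddGroup.mk_add,
        (QuotientAddGroup.eq_zero_iff z).2 hz, (QuotientAddGroup.eq_zero_iff y).2 hy, zero_add,
        zero_add, hrep1, hrep1] at this
    subst hab
    rw [add_left_injective _ h']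

/-- A full-rank integer matrix has a column selection of maximal nonzero minor; all columns are
combinations of the selected ones with coefficients in `[-1, 1]`. -/
lemma exists_max_minor {t d : ℕ} (V : Fin t → Fin d → ℤ)
    (hV : LinearIndependent ℝ fun l j => (V l j : ℝ)) :
    ∃ σ : Fin t → Fin d, (Matrix.of fun l i => V l (σ i)).det ≠ 0 ∧ ∃ B : Fin d → Fin t → ℝ,
      (∀ j i, |B j i| ≤ 1) ∧ (∀ l j, (V l j : ℝ) = ∑ i, B j i * V l (σ i)) ∧
      ∀ i i', B (σ i) i' = if i = i' then 1 else 0 := by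
  set R : (Fin t → Fin d) → Matrix (Fin t) (Fin t) ℝ := fun σ => .of fun i l => (V l (σ i) : ℝ)
    with hR
  have hex : ∃ σ, (R σ).det ≠ 0 := by
    set A : Matrix (Fin t) (Fin d) ℝ := .of fun l j => (V l j : ℝ) with hA
    have hrank : A.rank = t := by
      rw [LinearIndependent.rank_matrix (M := A) hV, Fintype.card_fin]
    obtain ⟨κ, a, ha, hspan, hli⟩ := exists_linearIndependent' ℝ A.col
    have : Finite κ := Finite.of_injective a ha
    have := Fintype.ofFinite κ
    have hκ : Fintype.card κ = t := by
      rw [← finrank_span_eq_card hli, hspan, ← Matrix.rank_eq_finrank_span_cols, hrank]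
    let e : Fin t ≃ κ := (Fintype.equivFinOfCardEq hκ).symm
    refine ⟨a ∘ e, ?_⟩
    have h : LinearIndependent ℝ (R (a ∘ e)).row := hli.comp e e.injective
    exact ((Matrix.isUnit_iff_isUnit_det _).1
      (Matrix.linearIndependent_rows_iff_isUnit.1 h)).ne_zero
  have : Nonempty (Fin t → Fin d) := ⟨hex.choose⟩
  obtain ⟨σ, hσ⟩ := Finite.exists_max fun σ => |(R σ).det|
  have hσ0 : (R σ).det ≠ 0 := by
    obtain ⟨τ, hτ⟩ := hex
    exact abs_pos.1 ((abs_pos.2 hτ).trans_le (hσ τ))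
  have hdet : ((Matrix.of fun l i => V l (σ i)).det : ℝ) = (R σ).det := by
    rw [← Matrix.det_transpose (R σ), Int.cast_det]
    rfl
  refine ⟨σ, fun h => hσ0 (by rw [← hdet, h, Int.cast_zero]), ?_⟩
  set B : Fin d → Fin t → ℝ := fun j => Matrix.vecMul (fun l => (V l j : ℝ)) (R σ)⁻¹ with hB
  have hunit : IsUnit (R σ).det := isUnit_iff_ne_zero.2 hσ0
  have hBR : ∀ j, Matrix.vecMul (B j) (R σ) = fun l => (V l j : ℝ) := fun j => by
    rw [hB, Matrix.vecMul_vecMul, Matrix.nonsing_inv_mul _ hunit, Matrix.vecMul_one]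
  have hsum : ∀ j, ∑ i, B j i • R σ i = fun l => (V l j : ℝ) := fun j => by
    rw [← hBR j]; ext l; simp [Matrix.vecMul, dotProduct]
  have hBdet : ∀ j i, B j i * (R σ).det = (R (Function.update σ i j)).det := by
    intro j i
    rw [← smul_eq_mul, ← Matrix.det_updateRow_sum, hsum]
    congr 1
    ext i' l
    by_cases h : i' = i
    · subst h; simp [hR]
    · simp [hR, h]
  refine ⟨B, fun j i => ?_, fun l j => ?_, fun i i' => ?_⟩
  · have h := hσ (Function.update σ i j)
    simp only [← hBdet, abs_mul] at h
    exact le_of_mul_le_mul_right (by simpa using h) (abs_pos.2 hσ0)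
  · have := congrFun (hsum j) l
    simp only [Finset.sum_apply, Pi.smul_apply, smul_eq_mul] at this
    rw [← this]; rfl
  · have h : Matrix.vecMul (B (σ i)) (R σ) = Matrix.vecMul (Pi.single i 1) (R σ) := by
      rw [hBR, Matrix.single_one_vecMul]; rfl
    have h2 := congrArg (fun v => Matrix.vecMul v (R σ)⁻¹) h
    simp only [Matrix.vecMul_vecMul, Matrix.mul_nonsing_inv _ hunit, Matrix.vecMul_one] at h2
    rw [h2, Pi.single_apply]
    simp [eq_comm]

/-- The coordinatewise embedding of `ℤ^d` into `ℝ^d`. -/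
def intVec {d : ℕ} (z : Fin d → ℤ) : Fin d → ℝ := fun j => (z j : ℝ)

lemma exists_box_basis {d t n : ℕ} (ht : t ≤ d) (hn : 1 ≤ n) (W : Submodule ℝ (Fin d → ℝ))
    (hW : Module.finrank ℝ W = t) (A : Set (Fin d → ℤ)) (hAW : ∀ z ∈ A, intVec z ∈ W)
    (hA : ∀ z ∈ A, ∀ j, |z j| ≤ n) :
    ∃ V : Fin t → Fin d → ℤ, (LinearIndependent ℝ fun l => intVec (V l)) ∧
      (∀ l j, |V l j| ≤ n) ∧
      ∀ z ∈ A, intVec z ∈ Submodule.span ℝ (range fun l => intVec (V l)) := by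
  set E : Set (Fin d → ℤ) := range fun i => Pi.single i 1 with hE
  obtain ⟨b, hbA, -, hAb, hb⟩ := exists_linearIndepOn_extension (K := ℝ) (v := intVec (d := d))
    (linearIndepOn_empty ℝ _) (empty_subset A)
  obtain ⟨b', hb'A, hbb', hAb', hb'⟩ := exists_linearIndepOn_extension hb
    (hbA.trans (subset_union_left (t := E)))
  have hb'fin : b'.Finite := Set.finite_coe_iff.1 (LinearIndependent.finite hb')
  have hbt : b.ncard ≤ t := by
    have := (hb'fin.subset hbb').fintype
    have h1 := finrank_span_eq_card hb
    rw [← Nat.card_eq_fintype_card, Nat.card_coe_set_eq] at h1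
    rw [← h1, ← hW]
    refine Submodule.finrank_mono (Submodule.span_le.2 ?_)
    rintro _ ⟨z, rfl⟩
    exact hAW _ (hbA z.2)
  have htop : Submodule.span ℝ (intVec '' b') = ⊤ := by
    rw [eq_top_iff, ← (Pi.basisFun ℝ (Fin d)).span_eq, Submodule.span_le]
    rintro _ ⟨i, rfl⟩
    refine hAb' ⟨Pi.single i 1, Or.inr ⟨i, rfl⟩, ?_⟩
    ext j
    simp only [intVec, Pi.basisFun_apply, Pi.single_apply]
    split_ifs <;> simp
  have htb' : t ≤ b'.ncard := by
    have := hb'fin.fintype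
    have h1 := finrank_span_eq_card hb'
    have h2 : range (fun x : b' => intVec (x : Fin d → ℤ)) = intVec '' b' := by
      rw [image_eq_range]
    rw [h2, htop, finrank_top, Module.finrank_fin_fun, ← Nat.card_eq_fintype_card,
      Nat.card_coe_set_eq] at h1
    exact h1 ▸ ht
  obtain ⟨c, hbc, hcb', hct⟩ := Set.exists_subsuperset_card_eq hbb' hbt htb'
  have hcfin := hb'fin.subset hcb'
  have := hcfin.fintype
  have hcard : Fintype.card c = t := by
    rw [← hct, ← Nat.card_eq_fintype_card, Nat.card_coe_set_eq]
  let e : Fin t ≃ c := (Fintype.equivFinOfCardEq hcard).symm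
  refine ⟨fun l => e l, (hb'.mono hcb').comp e e.injective, fun l j => ?_, fun z hz => ?_⟩
  · rcases hb'A (hcb' (e l).2) with h | ⟨i, hi⟩
    · exact hA _ h j
    · simp only [← hi, Pi.single_apply]
      split_ifs
      · simpa using hn
      · simp
  · refine Submodule.span_mono ?_ (hAb ⟨z, hz, rfl⟩)
    rintro _ ⟨y, hy, rfl⟩
    exact ⟨e.symm ⟨y, hbc hy⟩, by simp⟩

/-- The grid `[n]^d` as a finset of integer vectors. -/
def intGrid (n d : ℕ) : Finset (Fin d → ℤ) := Fintype.piFinset fun _ => Finset.Icc 1 (n : ℤ)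

lemma mem_intGrid {n d : ℕ} {x : Fin d → ℤ} : x ∈ intGrid n d ↔ ∀ j, 1 ≤ x j ∧ x j ≤ n := by
  simp [intGrid, Fintype.mem_piFinset]

lemma card_intGrid (n d : ℕ) : (intGrid n d).card = n ^ d := by
  simp [intGrid]

/-- The points of the grid on the flat that expresses all coordinates through those selected by
`σ`, with coefficients `M / D` and offset `m / D`. -/
def gridFlat (n : ℕ) {d t : ℕ} (σ : Fin t → Fin d) (D : ℕ) (M : Fin d → Fin t → ℤ)
    (m : Fin d → ℤ) : Finset (Fin d → ℤ) :=
  (intGrid n d).filter fun x => ∀ j, (D : ℤ) * x j = ∑ i, M j i * x (σ i) + m j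

lemma gridFlat_injOn {n d t : ℕ} {σ : Fin t → Fin d} {D : ℕ} (hD : 0 < D)
    {M : Fin d → Fin t → ℤ} {m : Fin d → ℤ} {x y : Fin d → ℤ} (hx : x ∈ gridFlat n σ D M m)
    (hy : y ∈ gridFlat n σ D M m) (h : ∀ i, x (σ i) = y (σ i)) : x = y := by
  ext j
  have h1 := (Finset.mem_filter.1 hx).2 j
  have h2 := (Finset.mem_filter.1 hy).2 j
  simp only [h] at h1
  rw [← h2] at h1
  exact mul_left_cancel₀ (by exact_mod_cast hD.ne') h1

lemma card_gridFlat_le {n d t : ℕ} (σ : Fin t → Fin d) {D : ℕ} (hD : 0 < D)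
    (M : Fin d → Fin t → ℤ) (m : Fin d → ℤ) : (gridFlat n σ D M m).card ≤ n ^ t := by
  rw [← card_intGrid n t]
  refine Finset.card_le_card_of_injOn (fun x i => x (σ i)) (fun x hx => ?_) fun x hx y hy h =>
    gridFlat_injOn hD hx hy (congrFun h)
  have := mem_intGrid.1 (Finset.mem_filter.1 hx).1
  exact mem_intGrid.2 fun i => this (σ i)

lemma exists_gridFlat {d t n : ℕ} (ht : t ≤ d) (hn : 1 ≤ n)
    (F : AffineSubspace ℝ (Fin d → ℝ)) (hF : Module.finrank ℝ F.direction = t)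
    (x₀ : Fin d → ℤ) (hx₀ : x₀ ∈ intGrid n d) (hx₀F : intVec x₀ ∈ F) :
    ∃ (σ : Fin t → Fin d) (D : ℕ) (M : Fin d → Fin t → ℤ) (m : Fin d → ℤ),
      0 < D ∧ Function.Injective σ ∧ (∀ j i, |M j i| ≤ D) ∧
      (∀ j, |m j| ≤ D * ((t + 1) * n)) ∧ (∀ i, m (σ i) = 0) ∧
      (∀ x ∈ intGrid n d, intVec x ∈ F → x ∈ gridFlat n σ D M m) ∧
      (gridFlat n σ D M m).card * D ≤ (2 * ((t + 1) * n) + 1) ^ t := by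
  have hgrid : ∀ x ∈ intGrid n d, ∀ y ∈ intGrid n d, ∀ j, |x j - y j| ≤ n := by
    intro x hx y hy j
    have h1 := mem_intGrid.1 hx j
    have h2 := mem_intGrid.1 hy j
    rw [abs_le]; constructor <;> linarith
  obtain ⟨V, hV, hVn, hVA⟩ := exists_box_basis ht hn F.direction hF
    {z | ∃ x ∈ intGrid n d, intVec x ∈ F ∧ z = x - x₀}
    (by
      rintro _ ⟨x, hx, hxF, rfl⟩
      have : intVec (x - x₀) = intVec x -ᵥ intVec x₀ := by ext j; simp [intVec]
      rw [this]
      exact AffineSubspace.vsub_mem_direction hxF hx₀F)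
    (by
      rintro _ ⟨x, hx, hxF, rfl⟩ j
      exact hgrid x hx x₀ hx₀ j)
  obtain ⟨σ, hdet, B, hB1, hBV, hBσ⟩ := exists_max_minor V hV
  have hspan : ∀ w ∈ Submodule.span ℝ (range fun l => intVec (V l)),
      ∀ j, w j = ∑ i, B j i * w (σ i) := by
    intro w hw
    induction hw using Submodule.span_induction with
    | mem w hw => obtain ⟨l, rfl⟩ := hw; exact hBV l
    | zero => simp
    | add u v _ _ hu hv =>
      intro j
      rw [Pi.add_apply, hu j, hv j, ← Finset.sum_add_distrib]
      simp [mul_add]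
    | smul a u _ hu =>
      intro j
      rw [Pi.smul_apply, hu j, Finset.smul_sum]
      refine Finset.sum_congr rfl fun i _ => ?_
      simp only [Pi.smul_apply, smul_eq_mul]; ring
  let L : AddSubgroup (Fin t → ℤ) :=
    { carrier := {z | ∀ j, ∃ w : ℤ, ∑ i, B j i * z i = w}
      zero_mem' := fun j => ⟨0, by simp⟩
      add_mem' := fun {a b} ha hb j => by
        obtain ⟨u, hu⟩ := ha j
        obtain ⟨v, hv⟩ := hb j
        exact ⟨u + v, by simp [mul_add, Finset.sum_add_distrib, hu, hv]⟩
      neg_mem' := fun {a} ha j => by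
        obtain ⟨u, hu⟩ := ha j
        exact ⟨-u, by simp [hu]⟩ }
  have hcount := card_mul_index_le (n := n) L (.of fun l i => V l (σ i)) hdet
    (fun l j => ⟨V l j, (hBV l j).symm⟩) fun l i => hVn l (σ i)
  set D := L.index with hD
  have hDpos : 0 < D := (hcount ∅ (by simp)).1
  have hM : ∀ j i, ∃ a : ℤ, (D : ℝ) * B j i = a := by
    intro j i
    obtain ⟨a, ha⟩ := L.nsmul_index_mem (Pi.single i 1) j
    refine ⟨a, ?_⟩
    rw [← ha, Finset.sum_eq_single i]
    · simp [mul_comm, hD]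
    · intro i' _ h; simp [h]
    · simp
  choose M hM using hM
  set m : Fin d → ℤ := fun j => D * x₀ j - ∑ i, M j i * x₀ (σ i) with hm
  have hmem : ∀ x ∈ intGrid n d, intVec x ∈ F → x ∈ gridFlat n σ D M m := by
    intro x hx hxF
    refine Finset.mem_filter.2 ⟨hx, fun j => ?_⟩
    have h := hspan _ (hVA _ ⟨x, hx, hxF, rfl⟩) j
    have h2 : ((D : ℤ) * (x j - x₀ j) : ℤ) = ∑ i, M j i * (x (σ i) - x₀ (σ i)) := by
      have h3 : (D : ℝ) * intVec (x - x₀) j = ∑ i, M j i * intVec (x - x₀) (σ i) := by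
        rw [h, Finset.mul_sum]
        refine Finset.sum_congr rfl fun i _ => ?_
        rw [← hM, mul_assoc]
      simp only [intVec, Pi.sub_apply] at h3
      exact_mod_cast h3
    simp only [mul_sub, Finset.sum_sub_distrib] at h2
    simp only [hm]
    linarith
  have hσinj : Function.Injective σ := by
    intro i i' h
    by_contra hne
    have h1 := hBσ i i
    have h2 := hBσ i' i
    rw [← h, h1, if_pos rfl, if_neg (Ne.symm hne)] at h2
    exact one_ne_zero h2
  have hMb : ∀ j i, |M j i| ≤ D := by
    intro j i
    have : |(M j i : ℝ)| ≤ D := by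
      rw [← hM, abs_mul, Nat.abs_cast]
      exact mul_le_of_le_one_right (Nat.cast_nonneg _) (hB1 j i)
    exact_mod_cast this
  have hx₀b : ∀ j, |x₀ j| ≤ n := by
    intro j
    have := mem_intGrid.1 hx₀ j
    rw [abs_le]; constructor <;> linarith
  refine ⟨σ, D, M, m, hDpos, hσinj, hMb, fun j => ?_, fun i => ?_, hmem, ?_⟩
  · have h1 : |∑ i, M j i * x₀ (σ i)| ≤ ∑ _i : Fin t, (D : ℤ) * n := by
      refine (Finset.abs_sum_le_sum_abs _ _).trans (Finset.sum_le_sum fun i _ => ?_)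
      rw [abs_mul]
      exact mul_le_mul (hMb j i) (hx₀b _) (abs_nonneg _) (Nat.cast_nonneg _)
    have h2 : |(D : ℤ) * x₀ j| ≤ D * n := by
      rw [abs_mul, Nat.abs_cast]
      exact mul_le_mul_of_nonneg_left (hx₀b j) (Nat.cast_nonneg _)
    simp only [Finset.sum_const, Finset.card_univ, Fintype.card_fin, nsmul_eq_mul] at h1
    refine (abs_sub _ _).trans ?_
    linarith
  · have h1 : ∀ i', M (σ i) i' = if i = i' then (D : ℤ) else 0 := by
      intro i'
      have := hM (σ i) i'
      rw [hBσ] at this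
      split_ifs at this ⊢
      · exact_mod_cast (by simpa using this.symm : (M (σ i) i' : ℝ) = D)
      · exact_mod_cast (by simpa using this.symm : (M (σ i) i' : ℝ) = 0)
    simp [hm, h1]
  · have hinj : Set.InjOn (fun (x : Fin d → ℤ) i => x (σ i) - x₀ (σ i))
        (gridFlat n σ D M m : Set (Fin d → ℤ)) := fun x hx y hy h =>
      gridFlat_injOn hDpos hx hy fun i => by simpa using congrFun h i
    rw [← Finset.card_image_of_injOn hinj]
    refine (hcount _ fun z hz => ?_).2
    obtain ⟨x, hx, rfl⟩ := Finset.mem_image.1 hz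
    obtain ⟨hxg, hxe⟩ := Finset.mem_filter.1 hx
    refine ⟨fun j => ⟨x j - x₀ j, ?_⟩, fun i => hgrid x hxg x₀ hx₀ (σ i)⟩
    have hD0 : (D : ℝ) ≠ 0 := by exact_mod_cast hDpos.ne'
    apply mul_left_cancel₀ hD0
    have h1 := hxe j
    have h2 : (D : ℤ) * (x j - x₀ j) = ∑ i, M j i * (x (σ i) - x₀ (σ i)) := by
      simp only [mul_sub, Finset.sum_sub_distrib]
      simp only [hm] at h1
      linarith
    rw [Finset.mul_sum]
    simp only [← mul_assoc, hM]
    exact_mod_cast h2.symm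

/-- The traces of grid flats with denominator `D` that obey the density bound. -/
def flatFamily (n d t D : ℕ) : Finset (Finset (Fin d → ℤ)) :=
  ((Finset.univ.filter fun σ : Fin t → Fin d => Function.Injective σ).biUnion fun σ =>
    ((Fintype.piFinset fun _ => Fintype.piFinset fun _ => Finset.Icc (-(D : ℤ)) D) ×ˢ
      Fintype.piFinset fun j => if j ∈ Finset.univ.image σ then {0} else
        Finset.Icc (-(D * ((t + 1) * n) : ℤ)) (D * ((t + 1) * n))).image
      fun p => gridFlat n σ D p.1 p.2).filter
    fun T => T ⊆ intGrid n d ∧ T.card ≤ n ^ t ∧ T.card * D ≤ (2 * ((t + 1) * n) + 1) ^ t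

lemma card_flatFamily_le (n d t D : ℕ) :
    (flatFamily n d t D).card ≤
      d ^ t * (((2 * D + 1) ^ t) ^ d * (2 * (D * ((t + 1) * n)) + 1) ^ (d - t)) := by
  refine (Finset.card_filter_le _ _).trans ?_
  refine (Finset.card_biUnion_le_card_mul _ _
    (((2 * D + 1) ^ t) ^ d * (2 * (D * ((t + 1) * n)) + 1) ^ (d - t)) fun σ hσ => ?_).trans ?_
  · refine Finset.card_image_le.trans (le_of_eq ?_)
    have hσ' : Function.Injective σ := (Finset.mem_filter.1 hσ).2
    have h1 : (Finset.Icc (-(D : ℤ)) D).card = 2 * D + 1 := by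
      rw [Int.card_Icc]; omega
    have h2 : (Finset.Icc (-(D * ((t + 1) * n) : ℤ)) (D * ((t + 1) * n))).card =
        2 * (D * ((t + 1) * n)) + 1 := by
      have : ((D * ((t + 1) * n) : ℕ) : ℤ) = D * ((t + 1) * n) := by push_cast; ring
      rw [← this, Int.card_Icc]; omega
    rw [Finset.card_product]
    congr 1
    · simp only [Fintype.card_piFinset, h1, Finset.prod_const, Finset.card_univ, Fintype.card_fin]
    · rw [Fintype.card_piFinset]
      simp only [apply_ite Finset.card, h2, Finset.card_singleton]
      rw [Finset.prod_ite, Finset.prod_const_one, one_mul, Finset.prod_const]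
      congr 1
      have : (Finset.univ.filter fun j => j ∉ Finset.univ.image σ) =
          (Finset.univ.image σ)ᶜ := by ext; simp
      rw [this, Finset.card_compl, Finset.card_image_of_injective _ hσ']
      simp
  · gcongr
    refine (Finset.card_le_univ _).trans (le_of_eq ?_)
    simp

lemma card_flatFamily_le_pow {n d t D : ℕ} (hn : 1 ≤ n) (hD : 1 ≤ D) :
    (flatFamily n d t D).card ≤
      (d ^ t * (3 ^ t) ^ d * (2 * t + 3) ^ (d - t)) * D ^ (t * d + (d - t)) * n ^ (d - t) := by
  have h1 : 2 * D + 1 ≤ 3 * D := by omega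
  have h2 : 2 * (D * ((t + 1) * n)) + 1 ≤ (2 * t + 3) * D * n := by
    have : 1 ≤ D * n := Nat.mul_pos hD hn
    nlinarith
  calc (flatFamily n d t D).card
      ≤ d ^ t * (((2 * D + 1) ^ t) ^ d * (2 * (D * ((t + 1) * n)) + 1) ^ (d - t)) :=
        card_flatFamily_le n d t D
    _ ≤ d ^ t * (((3 * D) ^ t) ^ d * ((2 * t + 3) * D * n) ^ (d - t)) := by gcongr
    _ = _ := by simp only [mul_pow, pow_add, pow_mul]; ring

lemma exists_mem_flatFamily {d t n : ℕ} (ht : t ≤ d) (hn : 1 ≤ n)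
    (F : AffineSubspace ℝ (Fin d → ℝ)) (hF : Module.finrank ℝ F.direction = t)
    (x₀ : Fin d → ℤ) (hx₀ : x₀ ∈ intGrid n d) (hx₀F : intVec x₀ ∈ F) :
    ∃ D ∈ Finset.Icc 1 ((2 * ((t + 1) * n) + 1) ^ t), ∃ T ∈ flatFamily n d t D,
      ∀ x ∈ intGrid n d, intVec x ∈ F → x ∈ T := by
  obtain ⟨σ, D, M, m, hD, hσ, hM, hm, hmσ, hmem, hcard⟩ := exists_gridFlat ht hn F hF x₀ hx₀ hx₀F
  refine ⟨D, Finset.mem_Icc.2 ⟨hD, ?_⟩, gridFlat n σ D M m, ?_, hmem⟩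
  · exact (Nat.le_mul_of_pos_left D (Finset.card_pos.2 ⟨x₀, hmem x₀ hx₀ hx₀F⟩)).trans hcard
  · refine Finset.mem_filter.2 ⟨Finset.mem_biUnion.2 ⟨σ, by simpa using hσ,
      Finset.mem_image.2 ⟨(M, m), Finset.mem_product.2 ⟨?_, ?_⟩, rfl⟩⟩,
      Finset.filter_subset _ _, card_gridFlat_le σ hD M m, hcard⟩
    · simpa [Fintype.mem_piFinset, ← abs_le] using hM
    · refine Fintype.mem_piFinset.2 fun j => ?_
      split_ifs with h
      · obtain ⟨i, -, rfl⟩ := Finset.mem_image.1 h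
        simpa using hmσ i
      · exact Finset.mem_Icc.2 (abs_le.1 (hm j))

/-- Chernoff bounds, in a form summable over denominators `D`. -/
lemma exists_exp_bound {δ C : ℝ} (hδ0 : 0 < δ) (hδ1 : δ < 1) (hC : 0 < C) (m : ℕ) :
    ∃ ρ : ℝ, 0 < ρ ∧ ρ < 1 ∧ ∀ (k D N : ℕ) (P : ℝ), m ≤ k → 1 / δ ≤ k → C ≤ k → 1 ≤ D →
      0 < P → N ≤ P → N * D ≤ C * P → ∃ u : ℝ, 1 + 1 / (k : ℝ) ≤ u ∧
        Real.exp ((1 - δ) * k / P * (u - 1) * N) / u ^ k ≤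
          ρ ^ (k - m) * (Real.exp 1 * C / D) ^ m := by
  have hρ : Real.exp (δ * (1 - δ)) < 1 + δ := by
    have h1 := Real.add_one_le_exp (-(δ * (1 - δ)))
    rw [Real.exp_neg] at h1
    have hpos := Real.exp_pos (δ * (1 - δ))
    have h2 : (-(δ * (1 - δ)) + 1) * Real.exp (δ * (1 - δ)) ≤ 1 := by
      calc _ ≤ (Real.exp (δ * (1 - δ)))⁻¹ * Real.exp (δ * (1 - δ)) := by gcongr
        _ = 1 := inv_mul_cancel₀ hpos.ne'
    have h3 : 0 < δ ^ 3 := by positivity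
    have h4 : 0 < -(δ * (1 - δ)) + 1 := by nlinarith
    by_contra! hcon
    nlinarith [mul_le_mul_of_nonneg_left hcon h4.le]
  refine ⟨Real.exp (δ * (1 - δ)) / (1 + δ), by positivity, (div_lt_one (by positivity)).2 hρ, ?_⟩
  set ρ := Real.exp (δ * (1 - δ)) / (1 + δ) with hρdef
  intro k D N P hmk hδk hCk hD hP hNP hND
  have hk0 : (0 : ℝ) < k := hC.trans_le hCk
  have hD1 : (1 : ℝ) ≤ D := by exact_mod_cast hD
  have hD0 : (0 : ℝ) < D := by linarith
  have hρ0 : 0 < ρ := by positivity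
  have hy0 : 0 < Real.exp 1 * C / D := by positivity
  rcases le_total ρ (Real.exp 1 * C / D) with h | h
  · refine ⟨1 + δ, by gcongr; rw [one_div_le hk0 hδ0]; exact hδk, ?_⟩
    calc Real.exp ((1 - δ) * k / P * (1 + δ - 1) * N) / (1 + δ) ^ k
        ≤ Real.exp (k * (δ * (1 - δ))) / (1 + δ) ^ k := by
          refine div_le_div_of_nonneg_right (Real.exp_le_exp.2 ?_) (by positivity)
          have h1 : (N : ℝ) / P ≤ 1 := (div_le_one hP).2 hNP
          have h2 : 0 ≤ k * (δ * (1 - δ)) := by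
            have : 0 < 1 - δ := by linarith
            positivity
          calc (1 - δ) * k / P * (1 + δ - 1) * N = k * (δ * (1 - δ)) * (N / P) := by ring
            _ ≤ k * (δ * (1 - δ)) * 1 := by gcongr
            _ = _ := mul_one _
      _ = ρ ^ k := by rw [Real.exp_nat_mul, hρdef, div_pow]
      _ = ρ ^ (k - m) * ρ ^ m := by rw [← pow_add, Nat.sub_add_cancel hmk]
      _ ≤ _ := by gcongr
  · refine ⟨1 + D / C, ?_, ?_⟩
    · gcongr
    calc Real.exp ((1 - δ) * k / P * (1 + D / C - 1) * N) / (1 + D / C) ^ k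
        ≤ Real.exp (k * 1) / (D / C) ^ k := by
          refine div_le_div₀ (Real.exp_pos _).le (Real.exp_le_exp.2 ?_) (by positivity)
            (by gcongr; linarith)
          have h1 : N * D / (C * P) ≤ 1 := (div_le_one (by positivity)).2 hND
          have h0 : 0 ≤ N * D / (C * P) := by positivity
          calc (1 - δ) * k / P * (1 + D / C - 1) * N = k * ((1 - δ) * (N * D / (C * P))) := by
                field_simp; ring
            _ ≤ k * (1 * 1) := by gcongr; linarith
            _ = _ := by ring
      _ = (Real.exp 1 * C / D) ^ k := by
          rw [Real.exp_nat_mul, ← div_pow]; congr 1; field_simp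
      _ = (Real.exp 1 * C / D) ^ (k - m) * (Real.exp 1 * C / D) ^ m := by
          rw [← pow_add, Nat.sub_add_cancel hmk]
      _ ≤ _ := by gcongr

lemma exists_intGrid_subset {d t : ℕ} (ht1 : 1 ≤ t) (ht : t ≤ d) {δ : ℝ} (hδ0 : 0 < δ)
    (hδ1 : δ < 1) :
    ∃ K : ℕ, ∀ n k : ℕ, K ≤ k → k ≤ n ^ t → ∃ S ⊆ intGrid n d,
      (1 - 2 * δ) * k * (n : ℝ) ^ (d - t) ≤ S.card ∧
      ∀ F : AffineSubspace ℝ (Fin d → ℝ), Module.finrank ℝ F.direction = t →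
        ∀ T ⊆ S, (∀ x ∈ T, intVec x ∈ F) → T.card ≤ k := by
  set C : ℝ := (2 * t + 3) ^ t with hCdef
  have hC : 0 < C := by positivity
  set a := t * d + (d - t) with ha
  set C₁ : ℝ := d ^ t * (3 ^ t) ^ d * (2 * t + 3) ^ (d - t) with hC₁
  have hC₁0 : 0 ≤ C₁ := by positivity
  set Z : ℝ := ∑' D : ℕ, 1 / (D : ℝ) ^ 2 with hZ
  obtain ⟨ρ, hρ0, hρ1, hbound⟩ := exists_exp_bound hδ0 hδ1 hC (a + 2)
  have htend : Filter.Tendsto (fun j : ℕ => C₁ * (Real.exp 1 * C) ^ (a + 2) * Z * ρ ^ j)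
      Filter.atTop (nhds 0) := by
    simpa using (tendsto_pow_atTop_nhds_zero_of_lt_one hρ0.le hρ1).const_mul
      (C₁ * (Real.exp 1 * C) ^ (a + 2) * Z)
  obtain ⟨K₀, hK₀⟩ := Filter.eventually_atTop.1 (htend.eventually_le_const hδ0)
  refine ⟨K₀ + (a + 2) + ⌈1 / δ⌉₊ + ⌈C⌉₊, fun n k hk hkn => ?_⟩
  have hk1 : 1 ≤ k := by omega
  have hn : 1 ≤ n := by
    by_contra! h
    rw [Nat.lt_one_iff.1 h, zero_pow (by omega)] at hkn
    omega
  have hn0 : (0 : ℝ) < n := by exact_mod_cast hn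
  have hδk : 1 / δ ≤ k := (Nat.le_ceil _).trans (by exact_mod_cast (by omega))
  have hCk : C ≤ k := (Nat.le_ceil _).trans (by exact_mod_cast (by omega))
  have hkδ := hK₀ (k - (a + 2)) (by omega)
  set P : ℝ := (n : ℝ) ^ t with hP
  have hP0 : 0 < P := by positivity
  have hbox : (2 * ((t + 1) * n) + 1) ^ t ≤ (2 * t + 3) ^ t * n ^ t := by
    rw [← mul_pow]
    gcongr
    nlinarith
  set I := (Finset.Icc 1 ((2 * ((t + 1) * n) + 1) ^ t)).sigma fun D => flatFamily n d t D with hI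
  have hu : ∀ i : (_ : ℕ) × Finset (Fin d → ℤ), ∃ u : ℝ, i ∈ I → 1 + 1 / (k : ℝ) ≤ u ∧
      Real.exp ((1 - δ) * k / P * (u - 1) * i.2.card) / u ^ k ≤
          ρ ^ (k - (a + 2)) * (Real.exp 1 * C / i.1) ^ (a + 2) := by
    rintro ⟨D, T⟩
    by_cases hi : (⟨D, T⟩ : (_ : ℕ) × Finset (Fin d → ℤ)) ∈ I
    · obtain ⟨hD, hT⟩ := Finset.mem_sigma.1 hi
      obtain ⟨-, -, hT1, hT2⟩ := Finset.mem_filter.1 hT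
      obtain ⟨u, hu⟩ := hbound k D T.card P (by omega) hδk hCk (Finset.mem_Icc.1 hD).1 hP0
        (by rw [hP]; exact_mod_cast hT1)
        (by rw [hP, hCdef]; exact_mod_cast hT2.trans hbox)
      exact ⟨u, fun _ => hu⟩
    · exact ⟨0, fun h => absurd h hi⟩
  choose u hu using hu
  have hkP : (k : ℝ) ≤ P := by rw [hP]; exact_mod_cast hkn
  obtain ⟨S, hS, hSk, hScard⟩ := exists_subset_card_inter_le (intGrid n d) I (fun i => i.2)
    (fun i hi => (Finset.mem_filter.1 (Finset.mem_sigma.1 hi).2).2.1) u k hk1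
    (fun i hi => (hu i hi).1) ((1 - δ) * k / P)
    (div_nonneg (mul_nonneg (by linarith) (Nat.cast_nonneg _)) hP0.le)
    (by rw [div_le_one hP0]; nlinarith)
  refine ⟨S, hS, le_trans ?_ hScard, fun F hF T hTS hTF => ?_⟩
  · have hmean : (1 - δ) * k / P * (intGrid n d).card = (1 - δ) * k * (n : ℝ) ^ (d - t) := by
      rw [card_intGrid, Nat.cast_pow, ← Nat.sub_add_cancel ht, pow_add, Nat.add_sub_cancel, ← hP]
      field_simp
    have hloss : ∑ i ∈ I, k * (Real.exp ((1 - δ) * k / P * (u i - 1) * i.2.card) / u i ^ k) ≤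
        δ * k * (n : ℝ) ^ (d - t) := by
      calc _ ≤ ∑ i ∈ I, k * (ρ ^ (k - (a + 2)) * (Real.exp 1 * C / i.1) ^ (a + 2)) :=
            Finset.sum_le_sum fun i hi => mul_le_mul_of_nonneg_left (hu i hi).2 (Nat.cast_nonneg _)
        _ = ∑ D ∈ Finset.Icc 1 ((2 * ((t + 1) * n) + 1) ^ t), (flatFamily n d t D).card *
              (k * (ρ ^ (k - (a + 2)) * (Real.exp 1 * C / D) ^ (a + 2))) := by
            rw [hI, Finset.sum_sigma]
            simp
        _ ≤ ∑ D ∈ Finset.Icc 1 ((2 * ((t + 1) * n) + 1) ^ t),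
              k * (n : ℝ) ^ (d - t) * (C₁ * (Real.exp 1 * C) ^ (a + 2) * ρ ^ (k - (a + 2))) *
                (1 / (D : ℝ) ^ 2) := by
            refine Finset.sum_le_sum fun D hD => ?_
            have hD1 := (Finset.mem_Icc.1 hD).1
            have hD0 : (0 : ℝ) < D := by exact_mod_cast hD1
            have hcard : ((flatFamily n d t D).card : ℝ) ≤ C₁ * D ^ a * n ^ (d - t) := by
              rw [hC₁, ha]
              exact_mod_cast card_flatFamily_le_pow hn hD1
            calc _ ≤ C₁ * D ^ a * n ^ (d - t) *
                  (k * (ρ ^ (k - (a + 2)) * (Real.exp 1 * C / D) ^ (a + 2))) := by gcongr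
              _ = _ := by
                  rw [div_pow, pow_add (D : ℝ) a 2]
                  field_simp
        _ ≤ k * (n : ℝ) ^ (d - t) * (C₁ * (Real.exp 1 * C) ^ (a + 2) * ρ ^ (k - (a + 2))) * Z := by
            rw [← Finset.mul_sum]
            gcongr
            exact (Real.summable_one_div_nat_pow.2 one_lt_two).sum_le_tsum _
              fun D _ => by positivity
        _ = (C₁ * (Real.exp 1 * C) ^ (a + 2) * Z * ρ ^ (k - (a + 2))) *
              (k * (n : ℝ) ^ (d - t)) := by ring
        _ ≤ δ * (k * (n : ℝ) ^ (d - t)) := by gcongr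
        _ = _ := by ring
    rw [hmean]
    linarith
  · rcases T.eq_empty_or_nonempty with rfl | ⟨x₀, hx₀⟩
    · simp
    · obtain ⟨D, hD, T', hT', hcover⟩ := exists_mem_flatFamily ht hn F hF x₀ (hS (hTS hx₀))
        (hTF x₀ hx₀)
      refine (Finset.card_le_card fun x hx => ?_).trans
        (hSk ⟨D, T'⟩ (Finset.mem_sigma.2 ⟨hD, hT'⟩))
      exact Finset.mem_inter.2 ⟨hTS hx, hcover x (hS (hTS hx)) (hTF x hx)⟩

/-- For every `d ≥ 2` and `ε > 0` there is `K₁ = K₁(ε,d)` such that for all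
integers `n, k, t` with `K₁ ≤ k ≤ n^t` and `1 ≤ t ≤ d-1`, there is `S ⊆ [n]^d` with
`|S| ≥ (1-ε) k n^{d-t}` such that every `t`-dimensional affine subspace of `ℝ^d` contains at
most `k` points of `S`. -/
theorem higher_dimensions_lower_bound (d : ℕ) (hd : 2 ≤ d) (ε : ℝ) (hε : 0 < ε) :
    ∃ K₁ : ℕ, ∀ n k t : ℕ, K₁ ≤ k → k ≤ n ^ t → 1 ≤ t → t ≤ d - 1 →
      ∃ S : Set (Fin d → ℝ), S ⊆ gridD n d ∧
        (1 - ε) * k * (n : ℝ) ^ (d - t) ≤ (S.ncard : ℝ) ∧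
        (∀ F : AffineSubspace ℝ (Fin d → ℝ), IsAffineOfDim d t F →
          (S ∩ (F : Set (Fin d → ℝ))).ncard ≤ k) := by
  set δ := min (ε / 2) (1 / 2) with hδ
  have hδ0 : 0 < δ := by positivity
  have hδ1 : δ < 1 := (min_le_right _ _).trans_lt (by norm_num)
  have hδε : 2 * δ ≤ ε := by linarith [min_le_left (ε / 2) (1 / 2)]
  have hK : ∀ t : ℕ, ∃ K : ℕ, 1 ≤ t → t ≤ d → ∀ n k : ℕ, K ≤ k → k ≤ n ^ t →
      ∃ S ⊆ intGrid n d, (1 - 2 * δ) * k * (n : ℝ) ^ (d - t) ≤ S.card ∧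
      ∀ F : AffineSubspace ℝ (Fin d → ℝ), Module.finrank ℝ F.direction = t →
        ∀ T ⊆ S, (∀ x ∈ T, intVec x ∈ F) → T.card ≤ k := by
    intro t
    by_cases h : 1 ≤ t ∧ t ≤ d
    · obtain ⟨K, hK⟩ := exists_intGrid_subset h.1 h.2 hδ0 hδ1
      exact ⟨K, fun _ _ => hK⟩
    · exact ⟨0, fun h1 h2 => absurd ⟨h1, h2⟩ h⟩
  choose K hK using hK
  refine ⟨(Finset.range d).sup K, fun n k t hk hkn ht1 htd => ?_⟩
  obtain ⟨S, hS, hcard, hF⟩ := hK t ht1 (by omega) n k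
    ((Finset.le_sup (Finset.mem_range.2 (by omega))).trans hk) hkn
  have hinj : Function.Injective (intVec (d := d)) := fun x y h => by
    ext j; exact Int.cast_injective (congrFun h j)
  refine ⟨intVec '' S, ?_, ?_, fun F hFt => ?_⟩
  · rintro _ ⟨x, hx, rfl⟩ i
    have := mem_intGrid.1 (hS hx) i
    exact ⟨x i, this.1, this.2, rfl⟩
  · rw [Set.ncard_image_of_injective _ hinj, Set.ncard_coe_finset]
    exact le_trans (by gcongr) hcard
  · classical
    have h : intVec '' (S : Set (Fin d → ℤ)) ∩ F =
        intVec '' (S.filter fun x => intVec x ∈ F : Finset (Fin d → ℤ)) := by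
      ext y
      constructor
      · rintro ⟨⟨x, hx, rfl⟩, hy⟩
        exact ⟨x, Finset.mem_coe.2 (Finset.mem_filter.2 ⟨hx, hy⟩), rfl⟩
      · rintro ⟨x, hx, rfl⟩
        have := Finset.mem_filter.1 (Finset.mem_coe.1 hx)
        exact ⟨⟨x, this.1, rfl⟩, this.2⟩
    rw [h, Set.ncard_image_of_injective _ hinj, Set.ncard_coe_finset]
    exact hF F hFt _ (Finset.filter_subset _ _) fun x hx => (Finset.mem_filter.1 hx).2
end
end

section
/- Let n be a positive integer and let 𝓛 be the set of lines in ℝ² intersecting the grid [n]² in at least two points. Then for every point (x₁, x₂) ∈ [n]² and every α ∈ (0, 1], the number of lines L ∈ 𝓛 with (x₁, x₂) ∈ L and |[n]² ∩ L| ≥ α·n is at most 18·α^{−2}. -/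
open Set

noncomputable section

/-- The grid `[n]² = {1,…,n}²` regarded as a subset of `ℝ²`. -/
def grid2 (n : ℕ) : Set (ℝ × ℝ) :=
  {p | ∃ a b : ℤ, 1 ≤ a ∧ a ≤ (n : ℤ) ∧ 1 ≤ b ∧ b ≤ (n : ℤ) ∧ p = ((a : ℝ), (b : ℝ))}

/-- An (affine) line in `ℝ²`: a one-dimensional affine subspace of `ℝ²`. -/
def IsLine (L : AffineSubspace ℝ (ℝ × ℝ)) : Prop :=
  Module.finrank ℝ L.direction = 1

/-- Membership in `𝓛`: lines intersecting the grid `[n]²` in at least two points. -/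
def InLines (n : ℕ) (L : AffineSubspace ℝ (ℝ × ℝ)) : Prop :=
  IsLine L ∧ 2 ≤ (grid2 n ∩ (L : Set (ℝ × ℝ))).ncard

/-- The weight `w(L) = |[n]² ∩ L| / n` of a line `L`. -/
def lineWeight (n : ℕ) (L : AffineSubspace ℝ (ℝ × ℝ)) : ℝ :=
  ((grid2 n ∩ (L : Set (ℝ × ℝ))).ncard : ℝ) / n

/-- If an arithmetic progression of difference `p` takes values in `[1, n]` at every `t ∈ S`,
then `(#S - 1) |p| ≤ n - 1`. -/
theorem card_sub_one_mul_abs_le (S : Finset ℤ) (hS : S.Nonempty) (a p n : ℤ)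
    (h : ∀ t ∈ S, 1 ≤ a + t * p ∧ a + t * p ≤ n) : ((S.card : ℤ) - 1) * |p| ≤ n - 1 := by
  have h1 := h _ (S.min'_mem hS)
  have h2 := h _ (S.max'_mem hS)
  have hle := S.min'_le_max' hS
  have hsub : S ⊆ Finset.Icc (S.min' hS) (S.max' hS) := fun t ht =>
    Finset.mem_Icc.2 ⟨S.min'_le t ht, S.le_max' t ht⟩
  have hcard := Finset.card_le_card hsub
  rw [Int.card_Icc] at hcard
  have hc : (S.card : ℤ) - 1 ≤ S.max' hS - S.min' hS := by omega
  calc ((S.card : ℤ) - 1) * |p| ≤ (S.max' hS - S.min' hS) * |p| := by gcongr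
    _ = |(S.max' hS - S.min' hS) * p| := by rw [abs_mul, abs_of_nonneg (sub_nonneg.2 hle)]
    _ ≤ n - 1 := by rw [abs_le]; constructor <;> linarith

theorem grid2_finite (n : ℕ) : (grid2 n).Finite := by
  refine ((Set.finite_Icc (1 : ℤ) n).prod (Set.finite_Icc (1 : ℤ) n)).image
    (fun p => ((p.1 : ℝ), (p.2 : ℝ))) |>.subset ?_
  rintro _ ⟨a, b, ha, ha', hb, hb', rfl⟩
  exact ⟨(a, b), ⟨⟨ha, ha'⟩, hb, hb'⟩, rfl⟩

/-- Two nonzero integers can be divided by their greatest common divisor, with a sign making the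
second one nonnegative. -/
theorem exists_primitive_of_ne_zero (c e : ℤ) (h : c ≠ 0 ∨ e ≠ 0) :
    ∃ g p q : ℤ, g ≠ 0 ∧ 0 ≤ q ∧ IsCoprime p q ∧ c = g * p ∧ e = g * q := by
  have hg : 0 < Int.gcd c e := Int.gcd_pos_iff.2 h
  obtain ⟨p, q, hpq, hc, he⟩ := Int.exists_gcd_one hg
  have hcop : IsCoprime p q := Int.isCoprime_iff_gcd_eq_one.2 hpq
  have hg' : ((Int.gcd c e : ℕ) : ℤ) ≠ 0 := by exact_mod_cast hg.ne'
  rcases le_total 0 q with hq | hq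
  · exact ⟨Int.gcd c e, p, q, hg', hq, hcop, by linarith, by linarith⟩
  · exact ⟨-Int.gcd c e, -p, -q, neg_ne_zero.2 hg', by linarith, hcop.neg_neg,
      by linarith, by linarith⟩

/-- A line of `𝓛` through a grid point has a primitive integer direction `(p, q)`, and the grid
points on it lie within an arithmetic progression of difference `(p, q)`. -/
theorem exists_primitive_direction {n : ℕ} {x : ℝ × ℝ} (hx : x ∈ grid2 n)
    {L : AffineSubspace ℝ (ℝ × ℝ)} (hL : InLines n L) (hxL : x ∈ L) :
    ∃ p q : ℤ, 0 ≤ q ∧ L = AffineSubspace.mk' x (Submodule.span ℝ {((p : ℝ), (q : ℝ))}) ∧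
      (((grid2 n ∩ (L : Set (ℝ × ℝ))).ncard : ℤ) - 1) * |p| ≤ (n : ℤ) - 1 ∧
      (((grid2 n ∩ (L : Set (ℝ × ℝ))).ncard : ℤ) - 1) * |q| ≤ (n : ℤ) - 1 := by
  obtain ⟨hline, hcard⟩ := hL
  have hfin : (grid2 n ∩ (L : Set (ℝ × ℝ))).Finite := (grid2_finite n).inter_of_left _
  obtain ⟨y, ⟨hy, hyL⟩, hyx⟩ := Set.exists_ne_of_one_lt_ncard (Nat.lt_of_succ_le hcard) x
  obtain ⟨a, b, -, -, -, -, rfl⟩ := hx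
  obtain ⟨c, e, -, -, -, -, rfl⟩ := hy
  have hne : c - a ≠ 0 ∨ e - b ≠ 0 := by
    by_contra! hce
    exact hyx (by rw [sub_eq_zero.1 hce.1, sub_eq_zero.1 hce.2])
  obtain ⟨g, p, q, hg, hq, hcop, hc, he⟩ := exists_primitive_of_ne_zero _ _ hne
  have hgR : (g : ℝ) ≠ 0 := by exact_mod_cast hg
  have hcR : (c : ℝ) - a = g * p := by exact_mod_cast hc
  have heR : (e : ℝ) - b = g * q := by exact_mod_cast he
  have hdir : ((p : ℝ), (q : ℝ)) ∈ L.direction := by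
    have hmem := L.direction.smul_mem (g : ℝ)⁻¹ (AffineSubspace.vsub_mem_direction hyL hxL)
    convert hmem using 1
    ext
    · simp [hcR, hgR]
    · simp [heR, hgR]
  have hpq : ((p : ℝ), (q : ℝ)) ≠ 0 := by
    intro h0
    have h1 : p = 0 := by simpa using congrArg Prod.fst h0
    have h2 : q = 0 := by simpa using congrArg Prod.snd h0
    rw [h1, h2] at hcop
    exact not_isCoprime_zero_zero hcop
  have hspan : Submodule.span ℝ {((p : ℝ), (q : ℝ))} = L.direction := by
    refine Submodule.eq_of_le_of_finrank_eq ((Submodule.span_singleton_le_iff_mem _ _).2 hdir) ?_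
    rw [finrank_span_singleton hpq, hline]
  have hprog : ∀ z ∈ grid2 n ∩ (L : Set (ℝ × ℝ)), ∃ t : ℤ,
      z = (((a + t * p : ℤ) : ℝ), ((b + t * q : ℤ) : ℝ)) ∧
      (1 ≤ a + t * p ∧ a + t * p ≤ n) ∧ (1 ≤ b + t * q ∧ b + t * q ≤ n) := by
    rintro _ ⟨⟨u, v, hu, hu', hv, hv', rfl⟩, hzL⟩
    have hmem := AffineSubspace.vsub_mem_direction hzL hxL
    rw [← hspan, Submodule.mem_span_singleton] at hmem
    obtain ⟨s, hs⟩ := hmem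
    have hs1 : s * p = u - a := by simpa using congrArg Prod.fst hs
    have hs2 : s * q = v - b := by simpa using congrArg Prod.snd hs
    have hcross : p * (v - b) = q * (u - a) := by
      have : (p : ℝ) * (v - b) = q * (u - a) := by rw [← hs1, ← hs2]; ring
      exact_mod_cast this
    obtain ⟨k, l, hkl⟩ := hcop
    have h1 : a + (k * (u - a) + l * (v - b)) * p = u := by
      linear_combination l * hcross + (u - a) * hkl
    have h2 : b + (k * (u - a) + l * (v - b)) * q = v := by
      linear_combination -k * hcross + (v - b) * hkl
    refine ⟨k * (u - a) + l * (v - b), ?_⟩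
    rw [h1, h2]
    exact ⟨rfl, ⟨hu, hu'⟩, hv, hv'⟩
  choose! t ht hta htb using hprog
  have hinj : Set.InjOn t (grid2 n ∩ (L : Set (ℝ × ℝ))) := by
    intro z hz w hw hzw
    rw [ht z hz, ht w hw, hzw]
  have hcardS : (hfin.image t).toFinset.card = (grid2 n ∩ (L : Set (ℝ × ℝ))).ncard := by
    rw [← Set.ncard_eq_toFinset_card _ (hfin.image t), hinj.ncard_image]
  have hS : (hfin.image t).toFinset.Nonempty := by
    rw [← Finset.card_pos]
    omega
  refine ⟨p, q, hq, ?_, ?_, ?_⟩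
  · rw [hspan, AffineSubspace.mk'_eq hxL]
  · rw [← hcardS]
    refine card_sub_one_mul_abs_le _ hS a p n fun s hs => ?_
    obtain ⟨z, hz, rfl⟩ := (hfin.image t).mem_toFinset.1 hs
    exact hta z hz
  · rw [← hcardS]
    refine card_sub_one_mul_abs_le _ hS b q n fun s hs => ?_
    obtain ⟨z, hz, rfl⟩ := (hfin.image t).mem_toFinset.1 hs
    exact htb z hz

theorem abs_le_floor_two_div {n k : ℕ} (hn : 1 ≤ n) (hk : 2 ≤ k) {α : ℝ} (hα : 0 < α)
    (hkα : α * n ≤ k) {p : ℤ} (hp : ((k : ℤ) - 1) * |p| ≤ (n : ℤ) - 1) :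
    |p| ≤ ⌊2 / α⌋ := by
  have hpR : ((k : ℝ) - 1) * |(p : ℝ)| ≤ (n : ℝ) - 1 := by exact_mod_cast hp
  have hkR : (2 : ℝ) ≤ k := by exact_mod_cast hk
  have hnR : (0 : ℝ) < n := by exact_mod_cast hn
  have h1 : α * n * |(p : ℝ)| ≤ 2 * (((k : ℝ) - 1) * |(p : ℝ)|) := by
    rw [← mul_assoc]
    exact mul_le_mul_of_nonneg_right (by linarith) (abs_nonneg _)
  rw [Int.le_floor, le_div_iff₀ hα, Int.cast_abs]
  refine le_of_mul_le_mul_right ?_ hnR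
  linarith

/-- For every point of the grid `[n]²` and every `α ∈ (0, 1]`, the number of
lines `L ∈ 𝓛` through that point with `|[n]² ∩ L| ≥ α n` is at most `18 α⁻²`. -/
theorem polynomial_tails_lines (n : ℕ) (hn : 1 ≤ n) (x : ℝ × ℝ) (hx : x ∈ grid2 n)
    (α : ℝ) (hα0 : 0 < α) (hα1 : α ≤ 1) :
    (({L : AffineSubspace ℝ (ℝ × ℝ) | InLines n L ∧ x ∈ L ∧
        α * n ≤ ((grid2 n ∩ (L : Set (ℝ × ℝ))).ncard : ℝ)}).ncard : ℝ) ≤ 18 * α⁻¹ ^ 2 := by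
  set M : ℤ := ⌊2 / α⌋
  have hM0 : 0 ≤ M := Int.floor_nonneg.2 (by positivity)
  let B : Finset (ℤ × ℤ) := Finset.Icc (-M) M ×ˢ Finset.Icc 0 M
  let f : ℤ × ℤ → AffineSubspace ℝ (ℝ × ℝ) := fun v =>
    AffineSubspace.mk' x (Submodule.span ℝ {((v.1 : ℝ), (v.2 : ℝ))})
  have hsub : {L : AffineSubspace ℝ (ℝ × ℝ) | InLines n L ∧ x ∈ L ∧
      α * n ≤ ((grid2 n ∩ (L : Set (ℝ × ℝ))).ncard : ℝ)} ⊆ f '' (B : Set (ℤ × ℤ)) := by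
    rintro L ⟨hL, hxL, hw⟩
    obtain ⟨p, q, hq, hLpq, hp', hq'⟩ := exists_primitive_direction hx hL hxL
    have hpM := abs_le.1 (abs_le_floor_two_div hn hL.2 hα0 hw hp')
    have hqM := abs_le.1 (abs_le_floor_two_div hn hL.2 hα0 hw hq')
    refine ⟨(p, q), ?_, hLpq.symm⟩
    exact Finset.mem_coe.2 (Finset.mem_product.2
      ⟨Finset.mem_Icc.2 hpM, Finset.mem_Icc.2 ⟨hq, hqM.2⟩⟩)
  have hcard : {L : AffineSubspace ℝ (ℝ × ℝ) | InLines n L ∧ x ∈ L ∧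
      α * n ≤ ((grid2 n ∩ (L : Set (ℝ × ℝ))).ncard : ℝ)}.ncard ≤ B.card := by
    refine (Set.ncard_le_ncard hsub (B.finite_toSet.image f)).trans ?_
    exact (Set.ncard_image_le B.finite_toSet).trans (Set.ncard_coe_finset B).le
  have hB : (B.card : ℤ) = (2 * M + 1) * (M + 1) := by
    rw [Finset.card_product, Int.card_Icc, Int.card_Icc, Nat.cast_mul,
      Int.toNat_of_nonneg (by omega), Int.toNat_of_nonneg (by omega)]
    ring
  have hBR : (B.card : ℝ) = (2 * M + 1) * (M + 1) := by exact_mod_cast hB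
  have hMR : (M : ℝ) ≤ 2 * α⁻¹ := by
    rw [← div_eq_mul_inv]
    exact Int.floor_le _
  have hM0R : (0 : ℝ) ≤ M := by exact_mod_cast hM0
  have hα : 1 ≤ α⁻¹ := (one_le_inv₀ hα0).2 hα1
  calc _ ≤ (B.card : ℝ) := by exact_mod_cast hcard
    _ = (2 * M + 1) * (M + 1) := hBR
    _ ≤ (5 * α⁻¹) * (3 * α⁻¹) := by
      gcongr <;> linarith
    _ ≤ 18 * α⁻¹ ^ 2 := by nlinarith [sq_nonneg α⁻¹]
end
end

section
/- For every integer d ≥ 2 there exists a constant C = C(d) such that the following holds for all integers n ≥ 1 and t with 1 ≤ t ≤ d−1. For every point x ∈ [n]^d and every α ∈ (0, 1], the number of sets F ⊆ [n]^d such that x ∈ F, |F| ≥ α·n^t, and F = F' ∩ [n]^d for some t-dimensional affine subspace F' of ℝ^d, is at most C·α^{−d}. -/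
open Set

noncomputable section

/-- The lattice `ℤ^d` inside `ℝ^d`. -/
def intLattice (d : ℕ) : AddSubgroup (Fin d → ℝ) :=
  ((Int.castAddHom ℝ).compLeft (Fin d)).range

lemma mem_intLattice {d : ℕ} {v : Fin d → ℝ} :
    v ∈ intLattice d ↔ ∃ a : Fin d → ℤ, ∀ i, v i = a i := by
  constructor
  · rintro ⟨a, rfl⟩
    exact ⟨a, fun i => rfl⟩
  · rintro ⟨a, ha⟩
    exact ⟨a, funext fun i => (ha i).symm⟩

/-- The lattice points of sup norm at most `R` in the subspace `W`. -/
def latticeBall {d : ℕ} (W : Submodule ℝ (Fin d → ℝ)) (R : ℝ) : Set (Fin d → ℝ) :=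
  {v | v ∈ W ∧ v ∈ intLattice d ∧ ‖v‖ ≤ R}

lemma latticeBall_finite_and_ncard_le {d : ℕ} (W : Submodule ℝ (Fin d → ℝ)) {R : ℝ}
    (hR : 1 ≤ R) : (latticeBall W R).Finite ∧ ((latticeBall W R).ncard : ℝ) ≤ (3 * R) ^ d := by
  classical
  have hsub : latticeBall W R ⊆ (fun (a : Fin d → ℤ) i => (a i : ℝ)) ''
      (Fintype.piFinset fun _ : Fin d => Finset.Icc (-⌊R⌋) ⌊R⌋ : Finset (Fin d → ℤ)) := by
    rintro v ⟨-, hv, hn⟩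
    obtain ⟨a, ha⟩ := mem_intLattice.1 hv
    refine ⟨a, ?_, funext fun i => (ha i).symm⟩
    simp only [Finset.mem_coe, Fintype.mem_piFinset, Finset.mem_Icc]
    intro i
    have h := (norm_le_pi_norm v i).trans hn
    rw [ha, Real.norm_eq_abs, abs_le] at h
    constructor
    · rw [neg_le, Int.le_floor]
      push_cast
      linarith
    · exact Int.le_floor.2 h.2
  have hfin := (Finset.finite_toSet
    (Fintype.piFinset fun _ : Fin d => Finset.Icc (-⌊R⌋) ⌊R⌋)).image
      (fun (a : Fin d → ℤ) i => (a i : ℝ))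
  refine ⟨hfin.subset hsub, ?_⟩
  have h0 : (0 : ℤ) ≤ ⌊R⌋ := Int.floor_nonneg.2 (by linarith)
  have h1 := (ncard_le_ncard hsub hfin).trans (ncard_image_le (Finset.finite_toSet _))
  rw [ncard_coe_finset, Fintype.card_piFinset] at h1
  simp only [Int.card_Icc, Finset.prod_const, Finset.card_univ, Fintype.card_fin] at h1
  have h2 : ((latticeBall W R).ncard : ℝ) ≤ ((⌊R⌋ + 1 - -⌊R⌋).toNat : ℝ) ^ d := by
    exact_mod_cast h1
  refine h2.trans (pow_le_pow_left₀ (by positivity) ?_ d)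
  have h3 : ((⌊R⌋ + 1 - -⌊R⌋).toNat : ℝ) = ((⌊R⌋ + 1 - -⌊R⌋ : ℤ) : ℝ) := by
    exact_mod_cast Int.toNat_of_nonneg (by omega)
  rw [h3]
  push_cast
  linarith [Int.floor_le R]

lemma latticeBall_finite {d : ℕ} (W : Submodule ℝ (Fin d → ℝ)) (R : ℝ) :
    (latticeBall W R).Finite :=
  (latticeBall_finite_and_ncard_le W (le_max_right R 1)).1.subset
    fun _ hv => ⟨hv.1, hv.2.1, hv.2.2.trans (le_max_left R 1)⟩

lemma norm_le_natCast_of_lt_succ {d : ℕ} {v : Fin d → ℝ} (hv : v ∈ intLattice d) {k : ℕ}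
    (h : ‖v‖ < (k + 1 : ℕ)) : ‖v‖ ≤ k := by
  obtain ⟨a, ha⟩ := mem_intLattice.1 hv
  refine (pi_norm_le_iff_of_nonneg (Nat.cast_nonneg k)).2 fun i => ?_
  have h1 := (norm_le_pi_norm v i).trans_lt h
  rw [ha, Real.norm_eq_abs] at h1 ⊢
  have h2 : |a i| < (k + 1 : ℕ) := by exact_mod_cast h1
  have h3 : |a i| ≤ k := by push_cast at h2; omega
  exact_mod_cast h3

section Packing

open MeasureTheory Metric

variable {E : Type*} [NormedAddCommGroup E] [NormedSpace ℝ E] [FiniteDimensional ℝ E]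

lemma card_le_of_separated_of_norm_le {R r : ℝ} (hr : 0 < r) (hrR : r ≤ R) (s : Finset E)
    (hs : ∀ c ∈ s, ‖c‖ ≤ R) (h : ∀ c ∈ s, ∀ e ∈ s, c ≠ e → r ≤ ‖c - e‖) :
    (s.card : ℝ) ≤ (3 * R / r) ^ Module.finrank ℝ E := by
  borelize E
  let μ : Measure E := Measure.addHaar
  have hδ : 0 < r / 2 := by positivity
  have hρ : 0 < R + r / 2 := by linarith
  have D : Set.Pairwise (s : Set E) (Function.onFun Disjoint fun c => ball (c : E) (r / 2)) := by
    rintro c hc e he hce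
    apply ball_disjoint_ball
    rw [dist_eq_norm]
    linarith [h c hc e he hce]
  have hsub : (⋃ c ∈ s, ball (c : E) (r / 2)) ⊆ ball (0 : E) (R + r / 2) := by
    refine iUnion₂_subset fun x hx => ball_subset_ball' ?_
    rw [dist_zero_right]
    linarith [hs x hx]
  have I : (s.card : ENNReal) * ENNReal.ofReal ((r / 2) ^ Module.finrank ℝ E) * μ (ball 0 1) ≤
      ENNReal.ofReal ((R + r / 2) ^ Module.finrank ℝ E) * μ (ball 0 1) := by
    have := measure_mono (μ := μ) hsub
    rw [measure_biUnion_finset D fun c _ => measurableSet_ball] at this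
    simpa only [μ.addHaar_ball_of_pos _ hδ, μ.addHaar_ball_of_pos _ hρ, Finset.sum_const,
      nsmul_eq_mul, mul_assoc] using this
  have J : (s.card : ENNReal) * ENNReal.ofReal ((r / 2) ^ Module.finrank ℝ E) ≤
      ENNReal.ofReal ((R + r / 2) ^ Module.finrank ℝ E) :=
    (ENNReal.mul_le_mul_iff_left (measure_ball_pos _ _ zero_lt_one).ne'
      measure_ball_lt_top.ne).1 I
  have K := ENNReal.toReal_le_of_le_ofReal (pow_nonneg hρ.le _) J
  rw [ENNReal.toReal_mul, ENNReal.toReal_natCast, ENNReal.toReal_ofReal (by positivity),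
    ← le_div_iff₀ (by positivity), ← div_pow] at K
  refine K.trans (pow_le_pow_left₀ (by positivity) ?_ _)
  rw [div_le_div_iff₀ hδ hr]
  nlinarith

lemma exists_finite_net {R r : ℝ} (hr : 0 < r) (hrR : r ≤ R) {S : Set E} (hS : S.Finite)
    (hSR : ∀ c ∈ S, ‖c‖ ≤ R) :
    ∃ A : Finset E, ↑A ⊆ S ∧ (∀ x ∈ S, ∃ a ∈ A, ‖x - a‖ < r) ∧
      (A.card : ℝ) ≤ (3 * R / r) ^ Module.finrank ℝ E := by
  classical
  obtain ⟨A, hA, hmax⟩ := Finset.exists_max_image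
    (hS.toFinset.powerset.filter fun A => ∀ c ∈ A, ∀ e ∈ A, c ≠ e → r ≤ ‖c - e‖) Finset.card
    ⟨∅, by simp⟩
  simp only [Finset.mem_filter, Finset.mem_powerset] at hA hmax
  have hAS : (A : Set E) ⊆ S := fun x hx => hS.mem_toFinset.1 (hA.1 hx)
  refine ⟨A, hAS, ?_, card_le_of_separated_of_norm_le hr hrR A (fun c hc => hSR c (hAS hc)) hA.2⟩
  intro x hx
  by_contra! hcon
  have hxA : x ∉ A := fun hxA => by
    have := hcon x hxA
    simp at this
    linarith
  have := hmax (insert x A) ⟨Finset.insert_subset (hS.mem_toFinset.2 hx) hA.1, ?_⟩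
  · rw [Finset.card_insert_of_notMem hxA] at this
    omega
  · intro c hc e he hce
    rcases Finset.mem_insert.1 hc with rfl | hc' <;> rcases Finset.mem_insert.1 he with rfl | he'
    · exact absurd rfl hce
    · exact hcon e he'
    · rw [norm_sub_rev]
      exact hcon c hc'
    · exact hA.2 c hc' e he' hce

end Packing

/-- If all lattice points of `W` shorter than `r` lie in `W'`, then a ball of radius `R` contains
at most `(3R/r)^(dim W)` times as many lattice points of `W` as a ball of radius `r`
contains lattice points of `W'`. -/
lemma ncard_latticeBall_le {d : ℕ} {W W' : Submodule ℝ (Fin d → ℝ)} {R r : ℝ} (hr : 0 < r)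
    (hrR : r ≤ R) (h : ∀ v ∈ W, v ∈ intLattice d → ‖v‖ < r → v ∈ W') :
    ((latticeBall W R).ncard : ℝ) ≤
      (3 * R / r) ^ Module.finrank ℝ W * (latticeBall W' r).ncard := by
  classical
  have hS : ((fun w : W => (w : Fin d → ℝ)) ⁻¹' latticeBall W R).Finite :=
    (latticeBall_finite W R).preimage Subtype.val_injective.injOn
  obtain ⟨A, hAS, hnet, hcard⟩ := exists_finite_net hr hrR hS fun c hc => hc.2.2
  have hsub : latticeBall W R ⊆
      ⋃ a ∈ A, (fun w => (a : Fin d → ℝ) + w) '' latticeBall W' r := by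
    intro x hx
    obtain ⟨a, haA, ha⟩ := hnet ⟨x, hx.1⟩ hx
    have hmem := hAS haA
    have ha' : ‖x - (a : Fin d → ℝ)‖ < r := ha
    have hl := sub_mem hx.2.1 hmem.2.1
    exact mem_biUnion haA
      ⟨x - a, ⟨h _ (W.sub_mem hx.1 a.2) hl ha', hl, ha'.le⟩, add_sub_cancel _ _⟩
  have h1 : (latticeBall W R).ncard ≤ A.card * (latticeBall W' r).ncard := by
    refine (ncard_le_ncard hsub (A.finite_toSet.biUnion fun a _ =>
      (latticeBall_finite W' r).image _)).trans ((Finset.set_ncard_biUnion_le _ _).trans ?_)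
    refine (Finset.sum_le_card_nsmul _ _ _ fun a _ =>
      ncard_image_le (latticeBall_finite W' r)).trans (by simp)
  calc ((latticeBall W R).ncard : ℝ) ≤ A.card * (latticeBall W' r).ncard := by exact_mod_cast h1
    _ ≤ _ := by gcongr

/-- `LatticeFlag d s W h r`: the `s`-dimensional subspace `W` of `ℝ^d` is spanned by lattice
vectors of nondecreasing norms, the largest being `r`, whose product is `h`. -/
inductive LatticeFlag (d : ℕ) : ℕ → Submodule ℝ (Fin d → ℝ) → ℝ → ℝ → Prop
  | bot : LatticeFlag d 0 ⊥ 1 1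
  | sup_span {s : ℕ} {W : Submodule ℝ (Fin d → ℝ)} {h r : ℝ} (v : Fin d → ℝ) :
      LatticeFlag d s W h r → v ∈ intLattice d → v ∉ W → r ≤ ‖v‖ →
      LatticeFlag d (s + 1) (W ⊔ Submodule.span ℝ {v}) (h * ‖v‖) ‖v‖

lemma LatticeFlag.bounds {d s : ℕ} {W : Submodule ℝ (Fin d → ℝ)} {h r : ℝ}
    (hW : LatticeFlag d s W h r) : 1 ≤ r ∧ 1 ≤ h ∧ h ≤ r ^ s := by
  induction hW with
  | bot => simp
  | @sup_span s W h r v _ _ _ hrv ih =>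
    obtain ⟨h1, h2, h3⟩ := ih
    have hv : 1 ≤ ‖v‖ := h1.trans hrv
    refine ⟨hv, one_le_mul_of_one_le_of_one_le h2 hv, ?_⟩
    rw [pow_succ]
    gcongr
    exact h3.trans (by gcongr)

/-- A nonzero subspace spanned by short lattice vectors has a hyperplane containing all lattice
vectors shorter than its last successive minimum `k`, and a complementary vector of norm `k`. -/
lemma exists_last_minimum {d s n : ℕ} {W : Submodule ℝ (Fin d → ℝ)}
    (hdim : Module.finrank ℝ W = s + 1) (hspan : Submodule.span ℝ (latticeBall W n) = W) :
    ∃ (k : ℕ) (W' : Submodule ℝ (Fin d → ℝ)) (v : Fin d → ℝ), 1 ≤ k ∧ k ≤ n ∧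
      Module.finrank ℝ W' = s ∧ Submodule.span ℝ (latticeBall W' k) = W' ∧
      v ∈ intLattice d ∧ v ∉ W' ∧ ‖v‖ = k ∧ W = W' ⊔ Submodule.span ℝ {v} ∧
      ∀ u ∈ W, u ∈ intLattice d → ‖u‖ < k → u ∈ W' := by
  classical
  have hex : ∃ k : ℕ, Submodule.span ℝ (latticeBall W k) = W := ⟨n, hspan⟩
  obtain ⟨k, hk, hmin⟩ : ∃ k : ℕ, Submodule.span ℝ (latticeBall W k) = W ∧
      ∀ j < k, Submodule.span ℝ (latticeBall W j) ≠ W :=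
    ⟨Nat.find hex, Nat.find_spec hex, fun j hj => Nat.find_min hex hj⟩
  have hkn : k ≤ n := by
    by_contra! hlt
    exact hmin n hlt hspan
  obtain _ | j := k
  · exfalso
    have : Submodule.span ℝ (latticeBall W ((0 : ℕ) : ℝ)) = ⊥ := by
      rw [Submodule.span_eq_bot]
      intro x hx
      simpa using hx.2.2
    rw [← hk, this, finrank_bot] at hdim
    omega
  have hmono : latticeBall W (j : ℕ) ⊆ latticeBall W ((j + 1 : ℕ) : ℝ) := fun v hv =>
    ⟨hv.1, hv.2.1, hv.2.2.trans (by exact_mod_cast Nat.le_succ j)⟩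
  obtain ⟨b₀, hb₀, hb₀span, hb₀li⟩ := exists_linearIndependent ℝ (latticeBall W (j : ℕ))
  obtain ⟨b, hb, hbb, hbspan, hbli⟩ :=
    exists_linearIndepOn_id_extension (K := ℝ) (s := b₀) hb₀li (hb₀.trans hmono)
  have hbW : Submodule.span ℝ b = W :=
    le_antisymm (Submodule.span_le.2 fun x hx => (hb hx).1)
      (hk.symm.le.trans (Submodule.span_le.2 hbspan))
  have hne : ¬ b ⊆ b₀ := fun hsub => hmin j (Nat.lt_succ_self j) <| by
    rw [← hb₀span, ← hbW, Subset.antisymm hsub hbb]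
  obtain ⟨v, hvb, hvb₀⟩ := not_subset.1 hne
  have hshort : ∀ u ∈ W, u ∈ intLattice d → ‖u‖ < (j + 1 : ℕ) →
      u ∈ Submodule.span ℝ (b \ {v}) := fun u hu hul hun => by
    have h1 : u ∈ Submodule.span ℝ b₀ := by
      rw [hb₀span]
      exact Submodule.subset_span ⟨hu, hul, norm_le_natCast_of_lt_succ hul hun⟩
    refine Submodule.span_mono (show b₀ ⊆ b \ {v} from fun x hx => ⟨hbb hx, ?_⟩) h1
    rintro rfl
    exact hvb₀ hx
  have hv : v ∉ Submodule.span ℝ (b \ {v}) := by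
    simpa using LinearIndepOn.notMem_span hbli hvb
  have hsup : W = Submodule.span ℝ (b \ {v}) ⊔ Submodule.span ℝ {v} := by
    rw [← Submodule.span_union, sdiff_union_self, union_eq_left.2 (singleton_subset_iff.2 hvb), hbW]
  refine ⟨j + 1, Submodule.span ℝ (b \ {v}), v, by omega, hkn, ?_, ?_, (hb hvb).2.1, hv, ?_, hsup,
    hshort⟩
  · have h1 := Submodule.finrank_sup_span_singleton hv
    rw [← hsup, hdim] at h1
    omega
  · refine le_antisymm (Submodule.span_le.2 fun x hx => hx.1) (Submodule.span_le.2 fun x hx => ?_)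
    exact Submodule.subset_span
      ⟨Submodule.subset_span hx, (hb hx.1).2.1, (hb hx.1).2.2⟩
  · refine le_antisymm (hb hvb).2.2 ?_
    by_contra! hlt
    exact hv (hshort v (hb hvb).1 (hb hvb).2.1 hlt)

/-- The upper bound in Minkowski's second theorem, for a flag of successive minima. -/
lemma exists_latticeFlag {d n : ℕ} (s : ℕ) (hn : 1 ≤ n) (W : Submodule ℝ (Fin d → ℝ))
    (hdim : Module.finrank ℝ W = s) (hspan : Submodule.span ℝ (latticeBall W n) = W) :
    ∃ h r : ℝ, LatticeFlag d s W h r ∧ r ≤ n ∧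
      (latticeBall W n).ncard * h ≤ 3 ^ (s * s) * (n : ℝ) ^ s := by
  induction s generalizing n W with
  | zero =>
    obtain rfl : W = ⊥ := Submodule.finrank_eq_zero.1 hdim
    refine ⟨1, 1, .bot, by exact_mod_cast hn, ?_⟩
    have : (latticeBall (⊥ : Submodule ℝ (Fin d → ℝ)) n).ncard ≤ 1 :=
      (ncard_le_ncard (t := {0}) (fun x hx => hx.1)).trans (ncard_singleton _).le
    simpa using this
  | succ s ih =>
    obtain ⟨k, W', v, hk1, hkn, hdim', hspan', hvl, hv, hvk, hsup, hshort⟩ :=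
      exists_last_minimum hdim hspan
    obtain ⟨h, r, hflag, hrk, hle⟩ := ih hk1 W' hdim' hspan'
    have hk0 : (0 : ℝ) < k := by exact_mod_cast hk1
    have h0 : 0 < h := zero_lt_one.trans_le hflag.bounds.2.1
    have hflag' := LatticeFlag.sup_span v hflag hvl hv (hvk ▸ hrk)
    rw [← hsup, hvk] at hflag'
    refine ⟨h * k, k, hflag', by exact_mod_cast hkn, ?_⟩
    have hcount := ncard_latticeBall_le hk0 (by exact_mod_cast hkn : (k : ℝ) ≤ n) hshort
    rw [hdim] at hcount
    calc ((latticeBall W n).ncard : ℝ) * (h * k)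
        ≤ ((3 * n / k) ^ (s + 1) * (latticeBall W' k).ncard) * (h * k) := by gcongr
      _ = (3 * n / k) ^ (s + 1) * k * ((latticeBall W' k).ncard * h) := by ring
      _ ≤ (3 * n / k) ^ (s + 1) * k * (3 ^ (s * s) * (k : ℝ) ^ s) := by gcongr
      _ = 3 ^ (s * s + s + 1) * (n : ℝ) ^ (s + 1) := by
        rw [div_pow]
        field_simp
        ring
      _ ≤ 3 ^ ((s + 1) * (s + 1)) * (n : ℝ) ^ (s + 1) := by
        gcongr
        · norm_num
        · nlinarith

/-- A subspace with a lattice flag of size `h` has many lattice points. -/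
lemma LatticeFlag.pow_le_ncard_mul {d s : ℕ} {W : Submodule ℝ (Fin d → ℝ)} {h r : ℝ}
    (hW : LatticeFlag d s W h r) {R : ℝ} (hR : 0 ≤ R) :
    R ^ s ≤ (latticeBall W (s * R)).ncard * h := by
  induction hW with
  | bot =>
    have h1 : 0 < (latticeBall (⊥ : Submodule ℝ (Fin d → ℝ)) ((0 : ℕ) * R)).ncard :=
      (ncard_pos (latticeBall_finite _ _)).2 ⟨0, Submodule.zero_mem _, zero_mem _, by simp⟩
    have h2 : (1 : ℝ) ≤ (latticeBall (⊥ : Submodule ℝ (Fin d → ℝ)) ((0 : ℕ) * R)).ncard := by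
      exact_mod_cast h1
    simpa using h2
  | @sup_span s W h r v hflag hvl hv hrv ih =>
    have hv1 : 1 ≤ ‖v‖ := hflag.bounds.1.trans hrv
    have hv0 : 0 < ‖v‖ := by linarith
    have hh0 : 0 < h := zero_lt_one.trans_le hflag.bounds.2.1
    set m := ⌊R / ‖v‖⌋₊ + 1 with hm
    have hmR : R ≤ m * ‖v‖ := by
      rw [← div_le_iff₀ hv0, hm]
      push_cast
      exact (Nat.lt_floor_add_one _).le
    have hinj : InjOn (fun p : ℕ × (Fin d → ℝ) => (p.1 : ℝ) • v + p.2)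
        (Iio m ×ˢ latticeBall W (s * R)) := by
      rintro ⟨a, w⟩ ⟨-, hw⟩ ⟨b, u⟩ ⟨-, hu⟩ heq
      have h1 : ((a : ℝ) - b) • v = u - w := by
        rw [sub_smul, sub_eq_sub_iff_add_eq_add, add_comm u]
        exact heq
      have hab : (a : ℝ) = b := by
        by_contra hne
        refine hv ((W.smul_mem_iff (sub_ne_zero.2 hne)).1 ?_)
        rw [h1]
        exact W.sub_mem hu.1 hw.1
      rw [hab, sub_self, zero_smul] at h1
      exact Prod.ext (by exact_mod_cast hab) (sub_eq_zero.1 h1.symm).symm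
    have hsub : (fun p : ℕ × (Fin d → ℝ) => (p.1 : ℝ) • v + p.2) ''
        (Iio m ×ˢ latticeBall W (s * R)) ⊆
        latticeBall (W ⊔ Submodule.span ℝ {v}) ((s + 1 : ℕ) * R) := by
      rintro _ ⟨⟨a, w⟩, ⟨ha, hw⟩, rfl⟩
      refine ⟨?_, ?_, ?_⟩
      · exact add_mem (Submodule.mem_sup_right
          (Submodule.smul_mem _ _ (Submodule.mem_span_singleton_self v)))
          (Submodule.mem_sup_left hw.1)
      · simp only [Nat.cast_smul_eq_nsmul]
        exact add_mem (nsmul_mem hvl a) hw.2.1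
      · refine (norm_add_le _ _).trans ?_
        have ha' : (a : ℝ) ≤ R / ‖v‖ := by
          have h1 : a ≤ ⌊R / ‖v‖⌋₊ := Nat.lt_succ_iff.1 ha
          exact (Nat.cast_le.2 h1).trans (Nat.floor_le (by positivity))
        rw [le_div_iff₀ hv0] at ha'
        rw [norm_smul, Real.norm_natCast]
        push_cast
        linarith [hw.2.2]
    have hcard := ncard_le_ncard hsub (latticeBall_finite _ _)
    rw [hinj.ncard_image, ncard_prod, ← Finset.coe_Iio, ncard_coe_finset,
      Nat.card_Iio] at hcard
    have hcard' : (m : ℝ) * (latticeBall W (s * R)).ncard ≤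
        (latticeBall (W ⊔ Submodule.span ℝ {v}) ((s + 1 : ℕ) * R)).ncard := by
      exact_mod_cast hcard
    calc R ^ (s + 1) = R ^ s * R := pow_succ R s
      _ ≤ ((latticeBall W (s * R)).ncard * h) * (m * ‖v‖) := by gcongr
      _ = (m * (latticeBall W (s * R)).ncard) * (h * ‖v‖) := by ring
      _ ≤ _ := by gcongr

/-- The subspaces obtained from `W` by adjoining a lattice vector of norm at most `R`. -/
def latticeExtensions {d : ℕ} (W : Submodule ℝ (Fin d → ℝ)) (R : ℝ) :
    Set (Submodule ℝ (Fin d → ℝ)) :=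
  {U | ∃ v ∈ intLattice d, v ∉ W ∧ ‖v‖ ≤ R ∧ U = W ⊔ Submodule.span ℝ {v}}

lemma LatticeFlag.latticeExtensions_finite_and_ncard_le {d s : ℕ}
    {W : Submodule ℝ (Fin d → ℝ)} {h r : ℝ} (hW : LatticeFlag d s W h r) {R : ℝ} (hR : 1 ≤ R) :
    (latticeExtensions W R).Finite ∧
      ((latticeExtensions W R).ncard : ℝ) ≤ (3 * (s + 1)) ^ d * R ^ d * h / R ^ s := by
  classical
  have hR0 : 0 < R := by linarith
  have hh0 : 0 < h := zero_lt_one.trans_le hW.bounds.2.1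
  set g : (Fin d → ℝ) → Submodule ℝ (Fin d → ℝ) := fun u => W ⊔ Submodule.span ℝ {u} with hg
  have hsR : 1 ≤ (s + 1 : ℝ) * R :=
    one_le_mul_of_one_le_of_one_le (by linarith [(Nat.cast_nonneg s : (0 : ℝ) ≤ s)]) hR
  obtain ⟨hT, hTcard⟩ :=
    latticeBall_finite_and_ncard_le (⊤ : Submodule ℝ (Fin d → ℝ)) hsR
  set T := latticeBall (⊤ : Submodule ℝ (Fin d → ℝ)) ((s + 1 : ℝ) * R) with hTdef
  have hfin : (latticeExtensions W R).Finite := by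
    refine (hT.image g).subset ?_
    rintro U ⟨v, hvl, -, hvR, rfl⟩
    refine ⟨v, ⟨trivial, hvl, hvR.trans ?_⟩, rfl⟩
    nlinarith [(Nat.cast_nonneg s : (0 : ℝ) ≤ s)]
  refine ⟨hfin, ?_⟩
  set N := (latticeBall W (s * R)).ncard with hN
  have hfib : ∀ U ∈ hfin.toFinset, N ≤ (hT.toFinset.filter fun u => g u = U).card := by
    intro U hU
    obtain ⟨v, hvl, hv, hvR, rfl⟩ := hfin.mem_toFinset.1 hU
    rw [hN, ← ncard_image_of_injective _ (add_right_injective v), ← ncard_coe_finset]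
    refine ncard_le_ncard ?_ (Finset.finite_toSet _)
    rintro _ ⟨w, hw, rfl⟩
    simp only [Finset.coe_filter, Finite.mem_toFinset, mem_ofPred_eq]
    refine ⟨⟨trivial, add_mem hvl hw.2.1, (norm_add_le _ _).trans (by linarith [hw.2.2])⟩, ?_⟩
    apply le_antisymm <;> refine sup_le le_sup_left ?_ <;>
      rw [Submodule.span_singleton_le_iff_mem]
    · exact add_mem (Submodule.mem_sup_right (Submodule.mem_span_singleton_self v))
        (Submodule.mem_sup_left hw.1)
    · have := sub_mem (Submodule.mem_sup_right (Submodule.mem_span_singleton_self (v + w)))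
        (Submodule.mem_sup_left hw.1 : w ∈ W ⊔ Submodule.span ℝ {v + w})
      simpa using this
  have hcount : (latticeExtensions W R).ncard * N ≤ T.ncard := by
    rw [ncard_eq_toFinset_card _ hfin, ncard_eq_toFinset_card _ hT, ← smul_eq_mul]
    refine (Finset.card_nsmul_le_sum _ _ _ hfib).trans ?_
    rw [Finset.sum_card_fiberwise_eq_card_filter]
    exact Finset.card_filter_le _ _
  have hcount' : ((latticeExtensions W R).ncard : ℝ) * N ≤ T.ncard := by exact_mod_cast hcount
  have hpow := hW.pow_le_ncard_mul hR0.le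
  rw [le_div_iff₀ (by positivity)]
  calc ((latticeExtensions W R).ncard : ℝ) * R ^ s
      ≤ (latticeExtensions W R).ncard * (N * h) := by gcongr
    _ = ((latticeExtensions W R).ncard * N) * h := by ring
    _ ≤ (3 * ((s + 1 : ℝ) * R)) ^ d * h := by gcongr; exact hcount'.trans hTcard
    _ = _ := by rw [← mul_assoc, mul_pow]

/-- The `s`-dimensional subspaces having a lattice flag of size at most `H`. -/
def flagSpaces (d s : ℕ) (H : ℝ) : Set (Submodule ℝ (Fin d → ℝ)) :=
  {W | ∃ h r, LatticeFlag d s W h r ∧ h ≤ H}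

lemma biUnion_latticeExtensions_finite_and_ncard_le {d s : ℕ} {C R Y : ℝ} (hR : 1 ≤ R)
    (hY : 0 < Y)
    (hC : (flagSpaces d s Y).Finite ∧ ((flagSpaces d s Y).ncard : ℝ) ≤ C * Y ^ d) :
    (⋃ W ∈ flagSpaces d s Y, latticeExtensions W R).Finite ∧
      ((⋃ W ∈ flagSpaces d s Y, latticeExtensions W R).ncard : ℝ) ≤
        C * (3 * (s + 1)) ^ d * (R ^ d * Y ^ (d + 1) / R ^ s) := by
  obtain ⟨hfin, hcard⟩ := hC
  have hR0 : 0 < R := by linarith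
  have hext : ∀ W ∈ flagSpaces d s Y, (latticeExtensions W R).Finite ∧
      ((latticeExtensions W R).ncard : ℝ) ≤ (3 * (s + 1)) ^ d * R ^ d * Y / R ^ s := by
    rintro W ⟨h, r, hW, hh⟩
    obtain ⟨h1, h2⟩ := hW.latticeExtensions_finite_and_ncard_le hR
    exact ⟨h1, h2.trans (by gcongr)⟩
  refine ⟨hfin.biUnion fun W hW => (hext W hW).1, ?_⟩
  have h1 := Finset.set_ncard_biUnion_le hfin.toFinset fun W => latticeExtensions W R
  simp only [Finite.mem_toFinset] at h1
  calc ((⋃ W ∈ flagSpaces d s Y, latticeExtensions W R).ncard : ℝ)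
      ≤ ∑ W ∈ hfin.toFinset, ((latticeExtensions W R).ncard : ℝ) := by exact_mod_cast h1
    _ ≤ hfin.toFinset.card • ((3 * (s + 1)) ^ d * R ^ d * Y / R ^ s) :=
        Finset.sum_le_card_nsmul _ _ _ fun W hW => (hext W (hfin.mem_toFinset.1 hW)).2
    _ = (flagSpaces d s Y).ncard * ((3 * (s + 1)) ^ d * R ^ d * Y / R ^ s) := by
        rw [nsmul_eq_mul, ncard_eq_toFinset_card _ hfin]
    _ ≤ (C * Y ^ d) * ((3 * (s + 1)) ^ d * R ^ d * Y / R ^ s) := by gcongr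
    _ = _ := by ring

/-- Schmidt's upper bound for the number of rational subspaces of bounded height. -/
theorem exists_flagSpaces_ncard_le (d s : ℕ) :
    ∃ C : ℝ, 0 ≤ C ∧ ∀ H : ℝ, 0 < H →
      (flagSpaces d s H).Finite ∧ ((flagSpaces d s H).ncard : ℝ) ≤ C * H ^ d := by
  have hempty : ∀ s, ∀ H : ℝ, H < 1 → flagSpaces d s H = ∅ := by
    intro s H hH
    refine eq_empty_of_forall_notMem ?_
    rintro W ⟨h, r, hW, hh⟩
    linarith [hW.bounds.2.1]
  induction s with
  | zero =>
    refine ⟨1, zero_le_one, fun H hH => ?_⟩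
    rcases lt_or_ge H 1 with hH1 | hH1
    · rw [hempty 0 H hH1]
      exact ⟨finite_empty, by simp; positivity⟩
    · have hsub : flagSpaces d 0 H ⊆ {⊥} := by
        rintro W ⟨h, r, hW, -⟩
        cases hW
        rfl
      refine ⟨(finite_singleton _).subset hsub, ?_⟩
      have h1 := ncard_le_ncard hsub
      rw [ncard_singleton] at h1
      have h2 : ((flagSpaces d 0 H).ncard : ℝ) ≤ 1 := by exact_mod_cast h1
      linarith [one_le_pow₀ hH1 (n := d)]
  | succ s ih =>
    obtain ⟨C, hC0, hC⟩ := ih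
    set c : ℝ := C * (3 * (s + 1)) ^ d with hc
    have hc0 : 0 ≤ c := by positivity
    refine ⟨c * (1 + 2 ^ d * 2), by positivity, fun H hH => ?_⟩
    rcases lt_or_ge H 1 with hH1 | hH1
    · rw [hempty _ H hH1]
      exact ⟨finite_empty, by simp; positivity⟩
    obtain ⟨L, hL1, hLH⟩ : ∃ L : ℝ, 1 ≤ L ∧ L ^ (s + 1) = H :=
      ⟨H ^ (((s + 1 : ℕ) : ℝ)⁻¹), Real.one_le_rpow hH1 (by positivity),
        Real.rpow_inv_natCast_pow hH.le (by omega)⟩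
    have hL0 : 0 < L := by linarith
    obtain ⟨K, hK⟩ := pow_unbounded_of_one_lt H (one_lt_two (α := ℝ))
    have hsub : flagSpaces d (s + 1) H ⊆
        (⋃ W ∈ flagSpaces d s (L ^ s), latticeExtensions W L) ∪
        ⋃ k ∈ Finset.range K, ⋃ W ∈ flagSpaces d s (H / (L * 2 ^ k)),
          latticeExtensions W (2 * (L * 2 ^ k)) := by
      rintro U ⟨h, r, hU, hh⟩
      cases hU with
      | @sup_span _ W h r v hflag hvl hv hrv =>
      obtain ⟨hr1, hh1, hhr⟩ := hflag.bounds
      have hv1 : 1 ≤ ‖v‖ := hr1.trans hrv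
      rcases le_or_gt ‖v‖ L with hvL | hvL
      · left
        refine mem_biUnion (x := W) ⟨h, r, hflag, hhr.trans ?_⟩ ⟨v, hvl, hv, hvL, rfl⟩
        exact pow_le_pow_left₀ (by linarith) (hrv.trans hvL) s
      · right
        obtain ⟨k, hk1, hk2⟩ := exists_nat_pow_near ((one_le_div hL0).2 hvL.le)
          (one_lt_two (α := ℝ))
        rw [le_div_iff₀ hL0, mul_comm] at hk1
        rw [div_lt_iff₀ hL0] at hk2
        have hP : 0 < L * 2 ^ k := by positivity
        have hkK : k < K := by
          rw [← pow_lt_pow_iff_right₀ (one_lt_two (α := ℝ))]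
          refine lt_of_le_of_lt ?_ hK
          have : (0 : ℝ) < 2 ^ k := by positivity
          nlinarith
        refine mem_biUnion (x := k) (Finset.mem_coe.2 (Finset.mem_range.2 hkK))
          (mem_biUnion (x := W) ⟨h, r, hflag, ?_⟩ ⟨v, hvl, hv, ?_, rfl⟩)
        · rw [le_div_iff₀ hP]
          exact (mul_le_mul_of_nonneg_left hk1 (by linarith)).trans hh
        · rw [pow_succ] at hk2
          linarith
    have hA := biUnion_latticeExtensions_finite_and_ncard_le hL1 (pow_pos hL0 s)
      (hC _ (pow_pos hL0 s))
    have hB : ∀ k : ℕ, _ := fun k =>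
      have hP1 : 1 ≤ L * 2 ^ k :=
        one_le_mul_of_one_le_of_one_le hL1 (one_le_pow₀ one_le_two)
      biUnion_latticeExtensions_finite_and_ncard_le (R := 2 * (L * 2 ^ k)) (by linarith)
        (Y := H / (L * 2 ^ k)) (by positivity) (hC _ (by positivity))
    have hfin := hA.1.union ((Finset.finite_toSet (Finset.range K)).biUnion fun k _ => (hB k).1)
    refine ⟨hfin.subset hsub, ?_⟩
    have hAle : c * (L ^ d * (L ^ s) ^ (d + 1) / L ^ s) = c * H ^ d := by
      rw [← hLH]
      congr 1
      rw [div_eq_iff (by positivity)]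
      ring
    have hBle : ∀ k : ℕ, c * ((2 * (L * 2 ^ k)) ^ d * (H / (L * 2 ^ k)) ^ (d + 1) /
        (2 * (L * 2 ^ k)) ^ s) ≤ c * (2 ^ d * H ^ d) * (1 / 2) ^ k := by
      intro k
      have hP : 0 < L * 2 ^ k := by positivity
      have hPs : H * 2 ^ k ≤ (L * 2 ^ k) ^ (s + 1) := by
        rw [mul_pow, hLH]
        gcongr
        exact le_self_pow₀ (one_le_pow₀ one_le_two) (by omega)
      have h2P : (L * 2 ^ k) ^ s ≤ (2 * (L * 2 ^ k)) ^ s := by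
        exact pow_le_pow_left₀ hP.le (by linarith) s
      rw [mul_assoc c]
      gcongr
      calc (2 * (L * 2 ^ k)) ^ d * (H / (L * 2 ^ k)) ^ (d + 1) / (2 * (L * 2 ^ k)) ^ s
          ≤ (2 * (L * 2 ^ k)) ^ d * (H / (L * 2 ^ k)) ^ (d + 1) / (L * 2 ^ k) ^ s := by gcongr
        _ = 2 ^ d * H ^ (d + 1) / (L * 2 ^ k) ^ (s + 1) := by
          generalize L * 2 ^ k = P at hP
          rw [div_pow, mul_pow]
          field_simp
          ring
        _ ≤ 2 ^ d * H ^ (d + 1) / (H * 2 ^ k) := by gcongr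
        _ = 2 ^ d * H ^ d * (1 / 2) ^ k := by
          rw [one_div, inv_pow]
          field_simp
          ring
    have h1 := (ncard_le_ncard hsub hfin).trans ((ncard_union_le _ _).trans
      (Nat.add_le_add_left (Finset.set_ncard_biUnion_le _ _) _))
    calc ((flagSpaces d (s + 1) H).ncard : ℝ)
        ≤ ((⋃ W ∈ flagSpaces d s (L ^ s), latticeExtensions W L).ncard : ℝ) +
          ∑ k ∈ Finset.range K, ((⋃ W ∈ flagSpaces d s (H / (L * 2 ^ k)),
            latticeExtensions W (2 * (L * 2 ^ k))).ncard : ℝ) := by exact_mod_cast h1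
      _ ≤ c * H ^ d + ∑ k ∈ Finset.range K, c * (2 ^ d * H ^ d) * (1 / 2) ^ k :=
        add_le_add (hA.2.trans hAle.le)
          (Finset.sum_le_sum fun k _ => (hB k).2.trans (hBle k))
      _ ≤ c * H ^ d + c * (2 ^ d * H ^ d) * 2 := by
        rw [← Finset.mul_sum]
        gcongr
        exact sum_geometric_two_le K
      _ = _ := by ring

/-- A grid section through `x` consists of the grid points lying in its affine span. -/
lemma mem_iff_sub_mem_span {n d : ℕ} {F : Set (Fin d → ℝ)}
    {F' : AffineSubspace ℝ (Fin d → ℝ)} (hF : F = (F' : Set (Fin d → ℝ)) ∩ gridD n d)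
    {x : Fin d → ℝ} (hx : x ∈ F) :
    Submodule.span ℝ ((fun y => y - x) '' F) ≤ F'.direction ∧
      ∀ y, y ∈ F ↔ y ∈ gridD n d ∧ y - x ∈ Submodule.span ℝ ((fun y => y - x) '' F) := by
  have hle : Submodule.span ℝ ((fun y => y - x) '' F) ≤ F'.direction := by
    rw [Submodule.span_le]
    rintro _ ⟨y, hy, rfl⟩
    rw [hF] at hx hy
    exact AffineSubspace.vsub_mem_direction hy.1 hx.1
  refine ⟨hle, fun y => ⟨fun hy => ⟨?_, Submodule.subset_span ⟨y, hy, rfl⟩⟩, fun hy => ?_⟩⟩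
  · rw [hF] at hy
    exact hy.2
  · rw [hF] at hx ⊢
    refine ⟨?_, hy.1⟩
    have := AffineSubspace.vadd_mem_of_mem_direction (hle hy.2) hx.1
    simpa using this

lemma sub_mem_latticeBall {n d : ℕ} {x y : Fin d → ℝ} (hx : x ∈ gridD n d) (hy : y ∈ gridD n d)
    {W : Submodule ℝ (Fin d → ℝ)} (hW : y - x ∈ W) : y - x ∈ latticeBall W n := by
  refine ⟨hW, ?_, ?_⟩
  · choose a _ _ ha using hx
    choose b _ _ hb using hy
    exact mem_intLattice.2 ⟨fun i => b i - a i, fun i => by simp [ha, hb]⟩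
  · refine (pi_norm_le_iff_of_nonneg (Nat.cast_nonneg n)).2 fun i => ?_
    obtain ⟨a, ha1, han, ha⟩ := hx i
    obtain ⟨b, hb1, hbn, hb⟩ := hy i
    rw [Pi.sub_apply, ha, hb, Real.norm_eq_abs]
    have : |b - a| ≤ (n : ℤ) := abs_le.2 ⟨by omega, by omega⟩
    exact_mod_cast this

/-- For every `d ≥ 2` there is `C = C(d)` such that for all `n ≥ 1`,
`1 ≤ t ≤ d-1`, every `x ∈ [n]^d` and `α ∈ (0,1]`, the number of sets `F ⊆ [n]^d` with `x ∈ F`,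
`|F| ≥ α n^t`, and `F = F' ∩ [n]^d` for some `t`-dimensional affine subspace `F'`, is at most
`C α^{-d}`. -/
theorem polynomial_tails_subspaces (d : ℕ) (hd : 2 ≤ d) :
    ∃ C : ℝ, ∀ n t : ℕ, 1 ≤ n → 1 ≤ t → t ≤ d - 1 →
      ∀ x ∈ gridD n d, ∀ α : ℝ, 0 < α → α ≤ 1 →
        (({F : Set (Fin d → ℝ) | x ∈ F ∧ α * (n : ℝ) ^ t ≤ (F.ncard : ℝ) ∧
            ∃ F' : AffineSubspace ℝ (Fin d → ℝ), IsAffineOfDim d t F' ∧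
              F = (F' : Set (Fin d → ℝ)) ∩ gridD n d}).ncard : ℝ) ≤ C * α⁻¹ ^ d := by
  choose C hC0 hC using exists_flagSpaces_ncard_le d
  refine ⟨∑ s ∈ Finset.range (d + 1), C s * (3 ^ (d * d)) ^ d, ?_⟩
  intro n t hn _ _ x hx α hα _
  have hn1 : (1 : ℝ) ≤ n := by exact_mod_cast hn
  have hH : (0 : ℝ) < 3 ^ (d * d) * α⁻¹ := by positivity
  set S := {F : Set (Fin d → ℝ) | x ∈ F ∧ α * (n : ℝ) ^ t ≤ (F.ncard : ℝ) ∧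
    ∃ F' : AffineSubspace ℝ (Fin d → ℝ), IsAffineOfDim d t F' ∧
      F = (F' : Set (Fin d → ℝ)) ∩ gridD n d} with hS
  set Φ : Set (Fin d → ℝ) → Submodule ℝ (Fin d → ℝ) :=
    fun F => Submodule.span ℝ ((fun y => y - x) '' F) with hΦ
  have hmaps : ∀ F ∈ S, Φ F ∈
      ⋃ s ∈ Finset.range (d + 1), flagSpaces d s (3 ^ (d * d) * α⁻¹) := by
    rintro F ⟨hxF, hcard, F', hdim, hF⟩
    obtain ⟨hle, hmem⟩ := mem_iff_sub_mem_span hF hxF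
    have hsub : (fun y => y - x) '' F ⊆ latticeBall (Φ F) n := by
      rintro _ ⟨y, hy, rfl⟩
      exact sub_mem_latticeBall hx ((hmem y).1 hy).1 ((hmem y).1 hy).2
    have hspan : Submodule.span ℝ (latticeBall (Φ F) n) = Φ F :=
      le_antisymm (Submodule.span_le.2 fun v hv => hv.1) (Submodule.span_mono hsub)
    obtain ⟨h, r, hflag, -, hh⟩ := exists_latticeFlag _ hn (Φ F) rfl hspan
    set s := Module.finrank ℝ (Φ F) with hs
    have hst : s ≤ t := by
      rw [← show Module.finrank ℝ F'.direction = t from hdim]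
      exact Submodule.finrank_mono hle
    have hsd : s ≤ d := by
      simpa using Submodule.finrank_le (Φ F)
    have hFcard : (F.ncard : ℝ) ≤ (latticeBall (Φ F) n).ncard := by
      rw [← ncard_image_of_injective F (sub_left_injective (b := x))]
      exact_mod_cast ncard_le_ncard hsub (latticeBall_finite _ _)
    have h0 : 0 < h := zero_lt_one.trans_le hflag.bounds.2.1
    refine mem_biUnion (x := s) (Finset.mem_coe.2 (Finset.mem_range.2 (by omega)))
      ⟨h, r, hflag, ?_⟩
    rw [← div_eq_mul_inv, le_div_iff₀ hα]
    refine le_of_mul_le_mul_right ?_ (pow_pos (zero_lt_one.trans_le hn1) s)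
    calc h * α * (n : ℝ) ^ s = α * (n : ℝ) ^ s * h := by ring
      _ ≤ α * (n : ℝ) ^ t * h := by gcongr
      _ ≤ (latticeBall (Φ F) n).ncard * h := by gcongr; exact hcard.trans hFcard
      _ ≤ 3 ^ (s * s) * (n : ℝ) ^ s := hh
      _ ≤ 3 ^ (d * d) * (n : ℝ) ^ s := by gcongr; norm_num
  have hinj : InjOn Φ S := by
    rintro F ⟨hxF, -, F', -, hF⟩ G ⟨hxG, -, G', -, hG⟩ hFG
    ext y
    rw [(mem_iff_sub_mem_span hF hxF).2, (mem_iff_sub_mem_span hG hxG).2]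
    exact and_congr_right fun _ => by rw [show Submodule.span ℝ _ = Submodule.span ℝ _ from hFG]
  have hfin : (⋃ s ∈ Finset.range (d + 1), flagSpaces d s (3 ^ (d * d) * α⁻¹)).Finite :=
    (Finset.finite_toSet (Finset.range (d + 1))).biUnion fun s _ => (hC s _ hH).1
  have h1 := (ncard_le_ncard_of_injOn Φ hmaps hinj hfin).trans (Finset.set_ncard_biUnion_le _ _)
  calc (S.ncard : ℝ)
      ≤ ∑ s ∈ Finset.range (d + 1), ((flagSpaces d s (3 ^ (d * d) * α⁻¹)).ncard : ℝ) := by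
        exact_mod_cast h1
    _ ≤ ∑ s ∈ Finset.range (d + 1), C s * (3 ^ (d * d) * α⁻¹) ^ d :=
        Finset.sum_le_sum fun s _ => (hC s _ hH).2
    _ = _ := by
        rw [Finset.sum_mul]
        exact Finset.sum_congr rfl fun s _ => by rw [mul_pow, mul_assoc]
end
end

section
/- For every C ∈ ℕ there exists K = K(C) such that the following holds. Let 𝓗 be a hypergraph on a finite vertex set V having polynomial tails with parameters N and C. Then for every real m with K ≤ m ≤ N, there exists an m-good subset of V. -/
open Set

noncomputable section

/-- A hypergraph on vertex set `V` (a collection of edges, each a finite subset of `V`) has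
polynomial tails with parameters `N, C ∈ ℕ` if every edge has at most `N` vertices and, for
every vertex `v` and `α ∈ (0,1]`, the number of edges `F` with `v ∈ F` and weight
`w(F) = |F|/N ≥ α` is at most `C α^{-C}`. -/
def HasPolyTails {V : Type*} (H : Set (Finset V)) (N C : ℕ) : Prop :=
  (∀ F ∈ H, F.card ≤ N) ∧
  ∀ (v : V) (α : ℝ), 0 < α → α ≤ 1 →
    (({F | F ∈ H ∧ v ∈ F ∧ α ≤ (F.card : ℝ) / N}).ncard : ℝ) ≤ (C : ℝ) * α⁻¹ ^ C

/-- A set `S ⊆ V` is `m`-good for the hypergraph `H` with parameters `N, C`. -/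
def IsGoodSet {V : Type*} (H : Set (Finset V)) (N C : ℕ) (m : ℝ) (S : Set V) : Prop :=
  -- (1) concentration for heavy edges
  (∀ F ∈ H, m ^ (-(2 : ℝ)/3) < (F.card : ℝ) / N → (F.card : ℝ) / N ≤ 1 →
    (1 - m ^ (-(1 : ℝ)/12)) * m * ((F.card : ℝ) / N) ≤ ((S ∩ ↑F).ncard : ℝ) ∧
    ((S ∩ ↑F).ncard : ℝ) ≤ (1 + m ^ (-(1 : ℝ)/12)) * m * ((F.card : ℝ) / N)) ∧
  -- (2) upper bound for medium edges
  (∀ F ∈ H, m ^ (-(2 : ℝ)) < (F.card : ℝ) / N → (F.card : ℝ) / N ≤ m ^ (-(2 : ℝ)/3) →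
    ((S ∩ ↑F).ncard : ℝ) ≤ (1 + m ^ (-(1 : ℝ)/12)) * m ^ ((1 : ℝ)/3)) ∧
  -- (3) very few vertices in light edges
  (∀ F ∈ H, (F.card : ℝ) / N ≤ m ^ (-(2 : ℝ)) →
    (S ∩ ↑F).ncard ≤ 6 * C + 3)

open MeasureTheory ProbabilityTheory

/-- One-sided conditional bound at the heart of the symmetric Lovász local lemma. -/
theorem measureReal_inter_biInter_compl_le {Ω ι : Type*} [MeasurableSpace Ω] [DecidableEq ι]
    (μ : Measure Ω) [IsProbabilityMeasure μ] (A : ι → Set Ω)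
    (I : Finset ι) (adj : ι → ι → Prop) [DecidableRel adj] {p d : ℝ} (hp : 0 ≤ p)
    (hprob : ∀ i ∈ I, μ.real (A i) ≤ p)
    (hdeg : ∀ i ∈ I, ((I.filter (adj i)).card : ℝ) ≤ d)
    (hind : ∀ i ∈ I, ∀ J ⊆ I, (∀ j ∈ J, ¬ adj i j) →
      μ.real (A i ∩ ⋂ j ∈ J, (A j)ᶜ) = μ.real (A i) * μ.real (⋂ j ∈ J, (A j)ᶜ))
    (hpd : 4 * p * d ≤ 1) :
    ∀ (n : ℕ) (J : Finset ι), J.card = n → J ⊆ I → ∀ i ∈ I,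
      μ.real (A i ∩ ⋂ j ∈ J, (A j)ᶜ) ≤ 2 * p * μ.real (⋂ j ∈ J, (A j)ᶜ) := by
  intro n
  induction n using Nat.strong_induction_on with
  | _ n ih =>
    intro J hJn hJ i hi
    set J₂ := J.filter (fun j => ¬ adj i j) with hJ₂
    set J₁ := J.filter (adj i) with hJ₁
    have hsub : J₂ ⊆ J := Finset.filter_subset _ _
    have h1 : μ.real (A i ∩ ⋂ j ∈ J, (A j)ᶜ) ≤ p * μ.real (⋂ j ∈ J₂, (A j)ᶜ) := by
      calc μ.real (A i ∩ ⋂ j ∈ J, (A j)ᶜ) ≤ μ.real (A i ∩ ⋂ j ∈ J₂, (A j)ᶜ) := by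
            exact measureReal_mono
              (inter_subset_inter_right _ (biInter_mono hsub fun _ _ => le_rfl)) (measure_ne_top _ _)
        _ = μ.real (A i) * μ.real (⋂ j ∈ J₂, (A j)ᶜ) :=
            hind i hi J₂ (hsub.trans hJ) fun j hj => (Finset.mem_filter.1 hj).2
        _ ≤ _ := by gcongr; exact hprob i hi
    have h2 : μ.real (⋂ j ∈ J₂, (A j)ᶜ) ≤
        μ.real (⋂ j ∈ J, (A j)ᶜ) + ∑ j ∈ J₁, μ.real (A j ∩ ⋂ j ∈ J₂, (A j)ᶜ) := by
      calc _ ≤ μ.real ((⋂ j ∈ J, (A j)ᶜ) ∪ ⋃ j ∈ J₁, (A j ∩ ⋂ j ∈ J₂, (A j)ᶜ)) := by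
            refine measureReal_mono ?_ (measure_ne_top _ _)
            intro ω hω
            by_cases h : ∃ j ∈ J₁, ω ∈ A j
            · obtain ⟨j, hj, hjω⟩ := h
              exact Or.inr (mem_biUnion hj ⟨hjω, hω⟩)
            · left
              push Not at h
              simp only [mem_iInter, mem_compl_iff] at hω ⊢
              intro j hj
              by_cases ha : adj i j
              · exact h j (Finset.mem_filter.2 ⟨hj, ha⟩)
              · exact hω j (Finset.mem_filter.2 ⟨hj, ha⟩)
        _ ≤ _ := (measureReal_union_le _ _).trans
            (by gcongr; exact measureReal_biUnion_finset_le _ _)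
    have h3 : ∑ j ∈ J₁, μ.real (A j ∩ ⋂ j ∈ J₂, (A j)ᶜ) ≤
        J₁.card * (2 * p * μ.real (⋂ j ∈ J₂, (A j)ᶜ)) := by
      rw [← nsmul_eq_mul]
      refine Finset.sum_le_card_nsmul _ _ _ fun j hj => ?_
      refine ih J₂.card ?_ J₂ rfl (hsub.trans hJ) j (hJ (Finset.mem_filter.1 hj).1)
      rw [← hJn]
      refine Finset.card_lt_card (Finset.ssubset_iff_subset_ne.2 ⟨hsub, fun h => ?_⟩)
      have := (Finset.mem_filter.1 hj).1
      rw [← h] at this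
      exact (Finset.mem_filter.1 this).2 (Finset.mem_filter.1 hj).2
    have h4 : (J₁.card : ℝ) ≤ d :=
      le_trans (by exact_mod_cast Finset.card_le_card (Finset.filter_subset_filter _ hJ))
        (hdeg i hi)
    have h5 : (0 : ℝ) ≤ μ.real (⋂ j ∈ J₂, (A j)ᶜ) := measureReal_nonneg
    have h6 : J₁.card * (2 * p * μ.real (⋂ j ∈ J₂, (A j)ᶜ)) ≤
        1 / 2 * μ.real (⋂ j ∈ J₂, (A j)ᶜ) := by
      have : (J₁.card : ℝ) * p ≤ d * p := by gcongr
      nlinarith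
    nlinarith

/-- The symmetric Lovász local lemma: events of probability at most `p`, each independent of all
but at most `d` of the others, can be avoided simultaneously when `4 * p * d ≤ 1`. -/
theorem exists_forall_notMem_of_local {Ω ι : Type*} [MeasurableSpace Ω] [DecidableEq ι]
    (μ : Measure Ω) [IsProbabilityMeasure μ] (A : ι → Set Ω)
    (I : Finset ι) (adj : ι → ι → Prop) [DecidableRel adj] {p d : ℝ} (hp : 0 ≤ p) (hd : 1 ≤ d)
    (hprob : ∀ i ∈ I, μ.real (A i) ≤ p)
    (hdeg : ∀ i ∈ I, ((I.filter (adj i)).card : ℝ) ≤ d)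
    (hind : ∀ i ∈ I, ∀ J ⊆ I, (∀ j ∈ J, ¬ adj i j) →
      μ.real (A i ∩ ⋂ j ∈ J, (A j)ᶜ) = μ.real (A i) * μ.real (⋂ j ∈ J, (A j)ᶜ))
    (hpd : 4 * p * d ≤ 1) : ∃ ω, ∀ i ∈ I, ω ∉ A i := by
  have key := measureReal_inter_biInter_compl_le μ A I adj hp hprob hdeg hind hpd
  have pos : ∀ J ⊆ I, 0 < μ.real (⋂ j ∈ J, (A j)ᶜ) := by
    intro J
    induction J using Finset.induction_on with
    | empty => intro _; simp
    | insert i J hi ih =>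
      intro hJ
      have hJI : J ⊆ I := (Finset.subset_insert _ _).trans hJ
      have h1 := ih hJI
      have h2 := key _ J rfl hJI i (hJ (Finset.mem_insert_self _ _))
      have h3 : μ.real (⋂ j ∈ J, (A j)ᶜ) ≤
          μ.real (⋂ j ∈ insert i J, (A j)ᶜ) + μ.real (A i ∩ ⋂ j ∈ J, (A j)ᶜ) := by
        refine le_trans (measureReal_mono ?_) (measureReal_union_le _ _)
        intro ω hω
        by_cases h : ω ∈ A i
        · exact Or.inr ⟨h, hω⟩
        · left
          rw [Finset.set_biInter_insert]
          exact ⟨h, hω⟩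
      have h4 : 4 * p ≤ 1 := by nlinarith
      nlinarith
  obtain ⟨ω, hω⟩ := nonempty_of_measureReal_ne_zero (pos I subset_rfl).ne'
  exact ⟨ω, fun i hi => by simpa using mem_iInter₂.1 hω i hi⟩

/-- The law of a random subset of `V` (as an indicator) containing each element independently
with probability `q`. -/
def randomSubset (V : Type*) [Fintype V] (q : unitInterval) : Measure (V → Bool) :=
  Measure.pi fun _ => bernoulliMeasure true false q

instance (V : Type*) [Fintype V] (q : unitInterval) : IsProbabilityMeasure (randomSubset V q) := by
  unfold randomSubset; infer_instance

theorem iIndepFun_randomSubset {V : Type*} [Fintype V] (q : unitInterval) {β : Type*}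
    [MeasurableSpace β] (f : Bool → β) :
    iIndepFun (fun (v : V) (ω : V → Bool) => f (ω v)) (randomSubset V q) :=
  iIndepFun_pi (X := fun _ => f) (μ := fun _ => bernoulliMeasure true false q)
    fun _ => (measurable_of_finite f).aemeasurable

/-- Events determined by disjoint sets of coordinates are independent. -/
theorem randomSubset_real_inter {V : Type*} [Fintype V] [DecidableEq V] (q : unitInterval)
    (B : Finset V) (E E' : Set (V → Bool))
    (hE : ∀ ω ω' : V → Bool, (∀ v ∈ B, ω v = ω' v) → ω ∈ E → ω' ∈ E)
    (hE' : ∀ ω ω' : V → Bool, (∀ v ∉ B, ω v = ω' v) → ω ∈ E' → ω' ∈ E') :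
    (randomSubset V q).real (E ∩ E') =
      (randomSubset V q).real E * (randomSubset V q).real E' := by
  have h := (iIndepFun_randomSubset (V := V) q id).indepFun_finset B Bᶜ disjoint_compl_right
    fun v => measurable_of_finite _
  have e : ∀ (D : Finset V) (X : Set (V → Bool)),
      (∀ ω ω' : V → Bool, (∀ v ∈ D, ω v = ω' v) → ω ∈ X → ω' ∈ X) →
      X = (fun (a : V → Bool) (i : D) => id (a i)) ⁻¹'
        ((fun (a : V → Bool) (i : D) => id (a i)) '' X) := by
    intro D X hX
    refine (subset_preimage_image _ _).antisymm ?_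
    rintro ω ⟨ω', h', hω⟩
    exact hX ω' ω (fun v hv => congrFun hω ⟨v, hv⟩) h'
  rw [e B E hE, e Bᶜ E' fun ω ω' h => hE' ω ω' fun v hv => h v (Finset.mem_compl.2 hv)]
  simp only [measureReal_def]
  rw [h.measure_inter_preimage_eq_mul _ _ (Set.toFinite _).measurableSet
    (Set.toFinite _).measurableSet, ENNReal.toReal_mul]

theorem mgf_card_filter_randomSubset_le {V : Type*} [Fintype V] (q : unitInterval)
    (B : Finset V) (s : ℝ) :
    mgf (fun ω : V → Bool => ((B.filter fun v => ω v = true).card : ℝ)) (randomSubset V q) s ≤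
      Real.exp (q * B.card * (Real.exp s - 1)) := by
  have e : (fun ω : V → Bool => ((B.filter fun v => ω v = true).card : ℝ)) =
      ∑ v ∈ B, fun ω : V → Bool => if ω v = true then (1 : ℝ) else 0 := by
    ext ω; simp [Finset.sum_apply]
  have one : ∀ v : V, mgf (fun ω : V → Bool => if ω v = true then (1 : ℝ) else 0)
      (randomSubset V q) s ≤ Real.exp (q * (Real.exp s - 1)) := by
    intro v
    have h1 : mgf (fun ω : V → Bool => if ω v = true then (1 : ℝ) else 0)
        (randomSubset V q) s =
        ∫ b, Real.exp (s * if b = true then (1 : ℝ) else 0) ∂(bernoulliMeasure true false q) := by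
      have mp := measurePreserving_eval (fun _ : V => bernoulliMeasure true false q) v
      rw [← mp.map_eq, integral_map (measurable_pi_apply v).aemeasurable
        (measurable_of_finite _).aestronglyMeasurable]
      rfl
    rw [h1, integral_bernoulliMeasure]
    have := Real.add_one_le_exp ((q : ℝ) * (Real.exp s - 1))
    simp
    linarith
  rw [e, (iIndepFun_randomSubset q fun b => if b = true then (1 : ℝ) else 0).mgf_sum
    (fun v => measurable_of_finite _)]
  refine (Finset.prod_le_prod (fun v _ => mgf_nonneg) fun v _ => one v).trans ?_
  rw [Finset.prod_const, ← Real.exp_nat_mul]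
  apply le_of_eq; congr 1; ring

/-- Upper Chernoff bound in exponential-moment form. -/
theorem randomSubset_real_card_ge_le {V : Type*} [Fintype V] (q : unitInterval)
    (B : Finset V) {s ν : ℝ} (a : ℝ) (hs : 0 ≤ s) (hν : (q : ℝ) * B.card ≤ ν) :
    (randomSubset V q).real {ω | a ≤ ((B.filter fun v => ω v = true).card : ℝ)} ≤
      Real.exp (-s * a + ν * (Real.exp s - 1)) := by
  refine (measure_ge_le_exp_mul_mgf a hs (.of_finite)).trans ?_
  rw [Real.exp_add]
  have := Real.one_le_exp hs
  refine mul_le_mul_of_nonneg_left ((mgf_card_filter_randomSubset_le q B s).trans ?_)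
    (Real.exp_pos _).le
  exact Real.exp_le_exp.2 (mul_le_mul_of_nonneg_right hν (by linarith))

/-- Lower Chernoff bound in exponential-moment form. -/
theorem randomSubset_real_card_le_le {V : Type*} [Fintype V] (q : unitInterval)
    (B : Finset V) {s ν : ℝ} (a : ℝ) (hs : 0 ≤ s) (hν : ν ≤ q * B.card) :
    (randomSubset V q).real {ω | ((B.filter fun v => ω v = true).card : ℝ) ≤ a} ≤
      Real.exp (s * a + ν * (Real.exp (-s) - 1)) := by
  refine (measure_le_le_exp_mul_mgf (t := -s) a (by linarith) (.of_finite)).trans ?_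
  rw [neg_neg, Real.exp_add]
  have : Real.exp (-s) ≤ 1 := Real.exp_le_one_iff.2 (by linarith)
  refine mul_le_mul_of_nonneg_left ((mgf_card_filter_randomSubset_le q B (-s)).trans ?_)
    (Real.exp_pos _).le
  exact Real.exp_le_exp.2 (mul_le_mul_of_nonpos_right hν (by linarith))

/-- Upper tail with relative error `x`, when the mean exceeds `L` by a factor at most `1 + x ^ 3`. -/
theorem randomSubset_real_upper_tail {V : Type*} [Fintype V] (q : unitInterval)
    (B : Finset V) {x L : ℝ} (hx : 0 < x) (hx3 : x ≤ 1 / 3) (hL : 0 ≤ L)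
    (hB : (q : ℝ) * B.card ≤ (1 + x ^ 3) * L) :
    (randomSubset V q).real {ω | (1 + x) * L ≤ ((B.filter fun v => ω v = true).card : ℝ)} ≤
      Real.exp (-(L * x ^ 2 / 8)) := by
  refine (randomSubset_real_card_ge_le q B (s := x / 2) _ (by linarith) hB).trans ?_
  have h1 : Real.exp (x / 2) - 1 ≤ x / 2 + (x / 2) ^ 2 := by
    have := (abs_le.1 (Real.abs_exp_sub_one_sub_id_le (x := x / 2)
      (by rw [abs_of_pos] <;> linarith))).2
    linarith
  apply Real.exp_le_exp.2
  have h2 : (1 + x ^ 3) * L * (Real.exp (x / 2) - 1) ≤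
      (1 + x ^ 3) * L * (x / 2 + (x / 2) ^ 2) :=
    mul_le_mul_of_nonneg_left h1 (by positivity)
  have h3 : -(x / 2) * (1 + x) + (1 + x ^ 3) * (x / 2 + (x / 2) ^ 2) ≤ -(x ^ 2 / 8) := by
    have : x ^ 3 * (x / 2 + (x / 2) ^ 2) ≤ x ^ 2 / 8 := by
      have e1 : x ^ 3 * (x / 2 + (x / 2) ^ 2) = x ^ 2 * (x ^ 2 / 2 + x ^ 2 * x / 4) := by ring
      have e2 : x ^ 2 ≤ 1 / 9 := by nlinarith
      have e3 : x ^ 2 * x ≤ 1 / 9 * (1 / 3) := mul_le_mul e2 hx3 hx.le (by norm_num)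
      rw [e1, div_eq_mul_one_div (x ^ 2) 8]
      exact mul_le_mul_of_nonneg_left (by linarith) (sq_nonneg x)
    nlinarith
  have h4 := mul_le_mul_of_nonneg_left h3 hL
  linarith

/-- Lower tail with relative error `x`, when the mean falls short of `L` by a factor at least
`1 - x ^ 3`. -/
theorem randomSubset_real_lower_tail {V : Type*} [Fintype V] (q : unitInterval)
    (B : Finset V) {x L : ℝ} (hx : 0 < x) (hx3 : x ≤ 1 / 3) (hL : 0 ≤ L)
    (hB : (1 - x ^ 3) * L ≤ q * B.card) :
    (randomSubset V q).real {ω | ((B.filter fun v => ω v = true).card : ℝ) ≤ (1 - x) * L} ≤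
      Real.exp (-(L * x ^ 2 / 8)) := by
  refine (randomSubset_real_card_le_le q B (s := x / 2) _ (by linarith) hB).trans ?_
  have h1 : Real.exp (-(x / 2)) - 1 ≤ -(x / 2) + (x / 2) ^ 2 := by
    have := (abs_le.1 (Real.abs_exp_sub_one_sub_id_le (x := -(x / 2))
      (by rw [abs_neg, abs_of_pos] <;> linarith))).2
    linarith [neg_sq (x / 2)]
  apply Real.exp_le_exp.2
  have e2 : x ^ 2 ≤ 1 / 9 := by nlinarith
  have hx1 : x ^ 3 ≤ 1 := pow_le_one₀ hx.le (by linarith)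
  have h2 : (1 - x ^ 3) * L * (Real.exp (-(x / 2)) - 1) ≤
      (1 - x ^ 3) * L * (-(x / 2) + (x / 2) ^ 2) :=
    mul_le_mul_of_nonneg_left h1 (mul_nonneg (by linarith) hL)
  have h3 : (x / 2) * (1 - x) + (1 - x ^ 3) * (-(x / 2) + (x / 2) ^ 2) ≤ -(x ^ 2 / 8) := by
    have : x ^ 3 * (x / 2 - (x / 2) ^ 2) ≤ x ^ 2 / 8 := by
      have e1 : x ^ 3 * (x / 2 - (x / 2) ^ 2) = x ^ 2 * (x ^ 2 / 2 - x ^ 2 * x / 4) := by ring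
      rw [e1]; nlinarith [sq_nonneg x, mul_nonneg (sq_nonneg x) hx.le]
    nlinarith
  have h4 := mul_le_mul_of_nonneg_left h3 hL
  linarith

/-- If the mean is at most `2 / z`, then `k` points are hit with probability `O(z⁻ᵏ)`. -/
theorem randomSubset_real_card_ge_le_pow {V : Type*} [Fintype V] (q : unitInterval)
    (B : Finset V) {z : ℝ} (k : ℕ) (hz : 2 ≤ z) (hB : (q : ℝ) * B.card ≤ 2 / z) :
    (randomSubset V q).real {ω | (k : ℝ) ≤ ((B.filter fun v => ω v = true).card : ℝ)} ≤
      3 * (2 / z) ^ k := by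
  have hz0 : 0 < z := by linarith
  refine (randomSubset_real_card_ge_le q B (s := Real.log (z / 2)) _
    (Real.log_nonneg (by linarith)) hB).trans ?_
  rw [Real.exp_log (by positivity)]
  have h1 : -Real.log (z / 2) * k + 2 / z * (z / 2 - 1) ≤ Real.log ((2 / z) ^ k) + 1 := by
    rw [Real.log_pow, show 2 / z = (z / 2)⁻¹ by rw [inv_div], Real.log_inv]
    have : (z / 2)⁻¹ * (z / 2) = 1 := inv_mul_cancel₀ (by positivity)
    have : 0 < (z / 2)⁻¹ := by positivity
    linarith
  refine (Real.exp_le_exp.2 h1).trans ?_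
  rw [Real.exp_add, Real.exp_log (by positivity), mul_comm]
  exact mul_le_mul_of_nonneg_right (by linarith [Real.exp_one_lt_d9]) (by positivity)

/-- Goodness at scale `m = y ^ 12`, with integer exponents and a finite witness. -/
structure IsGoodAtPow {V : Type*} [DecidableEq V] (H : Set (Finset V)) (N C : ℕ) (y : ℝ)
    (S : Finset V) : Prop where
  heavy_lower : ∀ F ∈ H, (y ^ 8)⁻¹ < (F.card : ℝ) / N →
    (1 - y⁻¹) * (y ^ 12 * ((F.card : ℝ) / N)) ≤ (S ∩ F).card
  heavy_upper : ∀ F ∈ H, (y ^ 8)⁻¹ < (F.card : ℝ) / N →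
    ((S ∩ F).card : ℝ) ≤ (1 + y⁻¹) * (y ^ 12 * ((F.card : ℝ) / N))
  medium : ∀ F ∈ H, (y ^ 24)⁻¹ < (F.card : ℝ) / N → (F.card : ℝ) / N ≤ (y ^ 8)⁻¹ →
    ((S ∩ F).card : ℝ) ≤ (1 + y⁻¹) * y ^ 4
  light : ∀ F ∈ H, (F.card : ℝ) / N ≤ (y ^ 24)⁻¹ → (S ∩ F).card ≤ 6 * C + 3

theorem IsGoodAtPow.isGoodSet {V : Type*} [DecidableEq V] {H : Set (Finset V)} {N C : ℕ} {y : ℝ}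
    {S : Finset V} (hy : 0 < y) (h : IsGoodAtPow H N C y S) :
    IsGoodSet H N C (y ^ 12) (S : Set V) := by
  have e : ∀ r : ℝ, (y ^ 12) ^ r = y ^ (12 * r) := fun r => by
    rw [← Real.rpow_natCast, ← Real.rpow_mul hy.le]; norm_num
  have e1 : (y ^ 12) ^ (-(2 : ℝ) / 3) = (y ^ 8)⁻¹ := by
    rw [e, ← Real.rpow_natCast, ← Real.rpow_neg hy.le]; norm_num
  have e2 : (y ^ 12) ^ (-(1 : ℝ) / 12) = y⁻¹ := by
    rw [e, ← Real.rpow_neg_one]; norm_num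
  have e3 : (y ^ 12) ^ (-(2 : ℝ)) = (y ^ 24)⁻¹ := by
    rw [e, ← Real.rpow_natCast, ← Real.rpow_neg hy.le]; norm_num
  have e4 : (y ^ 12) ^ ((1 : ℝ) / 3) = y ^ 4 := by
    rw [e, ← Real.rpow_natCast]; norm_num
  have c : ∀ F : Finset V, ((S : Set V) ∩ ↑F).ncard = (S ∩ F).card := fun F => by
    rw [← Finset.coe_inter, Set.ncard_coe_finset]
  unfold IsGoodSet
  simp only [e1, e2, e3, e4, c, mul_assoc]
  exact ⟨fun F hF hw _ => ⟨h.heavy_lower F hF hw, h.heavy_upper F hF hw⟩, h.medium, h.light⟩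

/-- At scale `y`, the bound on the failure probabilities in terms of `6 * C + 4` is valid. -/
structure IsLargeScale (C : ℕ) (y : ℝ) : Prop where
  three_le : 3 ≤ y
  exp_le : 2 * Real.exp (-(y ^ 2 / 8)) ≤ 3 * (2 / y ^ 12) ^ (6 * C + 4)
  local_le : 4 * (3 * (2 / y ^ 12) ^ (6 * C + 4)) *
    (2 * y ^ 36 * ((C + 1) * (y ^ 72) ^ C)) ≤ 1

theorem exists_isLargeScale (C : ℕ) : ∃ Y : ℝ, 3 ≤ Y ∧ ∀ y, Y ≤ y → IsLargeScale C y := by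
  obtain ⟨k, hk⟩ : ∃ k, k = 6 * C + 4 := ⟨_, rfl⟩
  obtain ⟨n, hn⟩ : ∃ n, n = 6 * k + 1 := ⟨_, rfl⟩
  refine ⟨3 + 8 ^ n * n.factorial + 24 * 2 ^ k * (C + 1), ?_, fun y hy => ?_⟩
  · have : (0 : ℝ) ≤ 8 ^ n * n.factorial + 24 * 2 ^ k * (C + 1) := by positivity
    linarith
  have p1 : (0 : ℝ) ≤ 8 ^ n * n.factorial := by positivity
  have p2 : (0 : ℝ) ≤ 24 * 2 ^ k * (C + 1) := by positivity
  have y3 : 3 ≤ y := by linarith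
  have y0 : 0 < y := by linarith
  refine ⟨y3, ?_, ?_⟩
  · have h1 : (y ^ 2 / 8) ^ n / n.factorial ≤ Real.exp (y ^ 2 / 8) :=
      Real.pow_div_factorial_le_exp _ (by positivity) n
    have h2 : y ^ (12 * k) ≤ Real.exp (y ^ 2 / 8) := by
      refine le_trans ?_ h1
      rw [div_pow, div_div, le_div_iff₀ (by positivity), ← pow_mul,
        show 2 * n = 12 * k + 2 by omega, pow_add]
      exact mul_le_mul_of_nonneg_left (by nlinarith) (by positivity)
    rw [← hk, Real.exp_neg, div_pow, ← pow_mul]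
    have h3 : (Real.exp (y ^ 2 / 8))⁻¹ ≤ (y ^ (12 * k))⁻¹ := inv_anti₀ (by positivity) h2
    have h4 : (1 : ℝ) ≤ 2 ^ k := one_le_pow₀ (by norm_num)
    have h5 : 0 < (y ^ (12 * k))⁻¹ := by positivity
    rw [div_eq_mul_inv (2 ^ k)]
    nlinarith
  · have e : 4 * (3 * (2 / y ^ 12) ^ k) * (2 * y ^ 36 * ((C + 1) * (y ^ 72) ^ C)) =
        24 * 2 ^ k * (C + 1) / y ^ 12 := by
      rw [div_pow, ← pow_mul, ← pow_mul, hk]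
      field_simp
      ring
    rw [← hk, e, div_le_one (by positivity)]
    have : y ≤ y ^ 12 := le_self_pow₀ (by linarith) (by norm_num)
    linarith

/-- Only boundedly many edges that are not too light meet a given set. -/
theorem HasPolyTails.card_filter_inter_nonempty_le {V : Type*} [DecidableEq V]
    {H : Set (Finset V)} {N C : ℕ} (hH : HasPolyTails H N C) {α : ℝ} (hα : 0 < α) (hα1 : α ≤ 1)
    (I : Finset (Finset V)) (hI : ∀ F ∈ I, F ∈ H ∧ α ≤ (F.card : ℝ) / N) (hfin : H.Finite)
    (B : Finset V) :
    ((I.filter fun F => (B ∩ F).Nonempty).card : ℝ) ≤ B.card * (C * α⁻¹ ^ C) := by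
  have h1 : I.filter (fun F => (B ∩ F).Nonempty) ⊆ B.biUnion fun v => I.filter (v ∈ ·) := by
    intro F hF
    obtain ⟨hFI, v, hv⟩ := Finset.mem_filter.1 hF
    rw [Finset.mem_inter] at hv
    exact Finset.mem_biUnion.2 ⟨v, hv.1, Finset.mem_filter.2 ⟨hFI, hv.2⟩⟩
  have h2 : ∀ v ∈ B, ((I.filter (v ∈ ·)).card : ℝ) ≤ C * α⁻¹ ^ C := by
    intro v _
    refine le_trans ?_ (hH.2 v α hα hα1)
    rw [← Set.ncard_coe_finset]
    refine Nat.cast_le.2 (Set.ncard_le_ncard (fun F hF => ?_) (hfin.subset fun F hF => hF.1))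
    obtain ⟨hFI, hv⟩ := Finset.mem_filter.1 (Finset.mem_coe.1 hF)
    exact ⟨(hI F hFI).1, hv, (hI F hFI).2⟩
  calc _ ≤ ((B.biUnion fun v => I.filter (v ∈ ·)).card : ℝ) := by
        exact_mod_cast Finset.card_le_card h1
    _ ≤ ∑ v ∈ B, ((I.filter (v ∈ ·)).card : ℝ) := by exact_mod_cast Finset.card_biUnion_le
    _ ≤ _ := by
        rw [← nsmul_eq_mul]
        exact Finset.sum_le_card_nsmul _ _ _ h2

/-- Sparsification step: a set `T` that is evenly spread at scale `M` contains a subset that is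
good at the smaller scale `y ^ 12 = q * M`. -/
theorem exists_isGoodAtPow_of_spread {V : Type*} [Fintype V] [DecidableEq V] {H : Set (Finset V)}
    {N C : ℕ} {y M : ℝ} (hH : HasPolyTails H N C) (hN : 0 < N) (hy : IsLargeScale C y)
    (q : unitInterval) (hqM : (q : ℝ) * M = y ^ 12) (hM : M ≤ y ^ 36) (T : Finset V)
    (hlower : ∀ F ∈ H, (y ^ 24)⁻¹ < (F.card : ℝ) / N →
      (1 - y⁻¹ ^ 3) * (M * ((F.card : ℝ) / N)) ≤ (T ∩ F).card)
    (hupper : ∀ F ∈ H, (y ^ 24)⁻¹ < (F.card : ℝ) / N →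
      ((T ∩ F).card : ℝ) ≤ (1 + y⁻¹ ^ 3) * (M * ((F.card : ℝ) / N)))
    (hmedium : ∀ F ∈ H, (y ^ 72)⁻¹ < (F.card : ℝ) / N → (F.card : ℝ) / N ≤ (y ^ 24)⁻¹ →
      ((T ∩ F).card : ℝ) ≤ 2 * y ^ 12 ∧ (q : ℝ) * (T ∩ F).card ≤ 2 / y ^ 12)
    (hlight : ∀ F ∈ H, (F.card : ℝ) / N ≤ (y ^ 72)⁻¹ → (T ∩ F).card ≤ 6 * C + 3) :
    ∃ S : Finset V, IsGoodAtPow H N C y S := by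
  classical
  have y3 := hy.three_le
  have y0 : 0 < y := by linarith
  have q0 : (0 : ℝ) ≤ q := q.2.1
  have x0 : 0 < y⁻¹ := by positivity
  have x3 : y⁻¹ ≤ 1 / 3 := by rw [one_div]; exact inv_anti₀ (by norm_num) y3
  set w : Finset V → ℝ := fun F => (F.card : ℝ) / N with hw
  have w0 : ∀ F, 0 ≤ w F := fun F => by positivity
  have w1 : ∀ F ∈ H, w F ≤ 1 := fun F hF =>
    div_le_one_of_le₀ (by exact_mod_cast hH.1 F hF) (by positivity)
  have hHfin : H.Finite := Set.toFinite H
  set I : Finset (Finset V) := hHfin.toFinset.filter fun F => (y ^ 72)⁻¹ < w F with hI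
  have memI : ∀ F, F ∈ I ↔ F ∈ H ∧ (y ^ 72)⁻¹ < w F := by simp [hI]
  let cnt : Finset V → (V → Bool) → ℝ := fun F ω => (((T ∩ F).filter fun v => ω v = true).card : ℝ)
  let A : Finset V → Set (V → Bool) := fun F =>
    if (y ^ 8)⁻¹ < w F then
      {ω | (1 + y⁻¹) * (y ^ 12 * w F) ≤ cnt F ω} ∪ {ω | cnt F ω ≤ (1 - y⁻¹) * (y ^ 12 * w F)}
    else if (y ^ 24)⁻¹ < w F then {ω | (1 + y⁻¹) * y ^ 4 ≤ cnt F ω}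
    else {ω | ((6 * C + 4 : ℕ) : ℝ) ≤ cnt F ω}
  have hAdep : ∀ F (ω ω' : V → Bool), (∀ v ∈ T ∩ F, ω v = ω' v) → (ω ∈ A F ↔ ω' ∈ A F) := by
    intro F ω ω' h
    have : cnt F ω = cnt F ω' := by
      simp only [cnt]
      rw [Finset.filter_congr fun v hv => by rw [h v hv]]
    simp only [A]
    split_ifs <;> simp [this]
  have y8 : (y ^ 24)⁻¹ ≤ (y ^ 8)⁻¹ :=
    inv_anti₀ (by positivity) (pow_le_pow_right₀ (by linarith) (by norm_num))
  have small : ∀ L : ℝ, y ^ 4 ≤ L →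
      Real.exp (-(L * y⁻¹ ^ 2 / 8)) ≤ Real.exp (-(y ^ 2 / 8)) := by
    intro L hL
    apply Real.exp_le_exp.2
    have : y ^ 2 ≤ L * y⁻¹ ^ 2 := by
      rw [inv_pow, ← div_eq_mul_inv, le_div_iff₀ (by positivity)]
      linarith [show y ^ 2 * y ^ 2 = y ^ 4 by ring]
    linarith
  have exp0 := Real.exp_pos (-(y ^ 2 / 8))
  have hqu : ∀ F ∈ H, (y ^ 24)⁻¹ < w F →
      (q : ℝ) * (T ∩ F).card ≤ (1 + y⁻¹ ^ 3) * (y ^ 12 * w F) := fun F hF h => by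
    have := mul_le_mul_of_nonneg_left (hupper F hF h) q0
    rw [← hqM]; linarith
  have hql : ∀ F ∈ H, (y ^ 24)⁻¹ < w F →
      (1 - y⁻¹ ^ 3) * (y ^ 12 * w F) ≤ (q : ℝ) * (T ∩ F).card := fun F hF h => by
    have := mul_le_mul_of_nonneg_left (hlower F hF h) q0
    rw [← hqM]; linarith
  have hprob : ∀ F ∈ I, (randomSubset V q).real (A F) ≤ 3 * (2 / y ^ 12) ^ (6 * C + 4) := by
    intro F hF
    obtain ⟨hFH, hF72⟩ := (memI F).1 hF
    simp only [A]
    split_ifs with h8 h24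
    · have h24 := y8.trans_lt h8
      have hL : y ^ 4 ≤ y ^ 12 * w F := by
        have := mul_le_mul_of_nonneg_left h8.le (show 0 ≤ y ^ 12 by positivity)
        rwa [show y ^ 12 = y ^ 4 * y ^ 8 by ring, mul_inv_cancel_right₀ (by positivity),
          ← show y ^ 12 = y ^ 4 * y ^ 8 by ring] at this
      have hL0 : 0 ≤ y ^ 12 * w F := le_trans (by positivity) hL
      refine (measureReal_union_le _ _).trans (le_trans ?_ hy.exp_le)
      have a := randomSubset_real_upper_tail q (T ∩ F) x0 x3 hL0 (hqu F hFH h24)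
      have b := randomSubset_real_lower_tail q (T ∩ F) x0 x3 hL0 (hql F hFH h24)
      have c := small _ hL
      simp only [cnt]
      linarith
    · have hL : y ^ 12 * w F ≤ y ^ 4 := by
        have := mul_le_mul_of_nonneg_left (not_lt.1 h8) (show 0 ≤ y ^ 12 by positivity)
        rwa [show y ^ 12 = y ^ 4 * y ^ 8 by ring, mul_inv_cancel_right₀ (by positivity),
          ← show y ^ 12 = y ^ 4 * y ^ 8 by ring] at this
      have a := randomSubset_real_upper_tail q (T ∩ F) x0 x3 (L := y ^ 4) (by positivity)
        ((hqu F hFH h24).trans (mul_le_mul_of_nonneg_left hL (by positivity)))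
      have c := small _ le_rfl
      have d := hy.exp_le
      simp only [cnt]
      linarith
    · refine randomSubset_real_card_ge_le_pow q (T ∩ F) (6 * C + 4) ?_
        (hmedium F hFH hF72 (not_lt.1 h24)).2
      have : y ≤ y ^ 12 := le_self_pow₀ (by linarith) (by norm_num)
      linarith
  have ycard : ∀ F ∈ I, ((T ∩ F).card : ℝ) ≤ 2 * y ^ 36 := by
    intro F hF
    obtain ⟨hFH, hF72⟩ := (memI F).1 hF
    by_cases h24 : (y ^ 24)⁻¹ < w F
    · refine (hupper F hFH h24).trans ?_
      have a : y⁻¹ ^ 3 ≤ 1 := pow_le_one₀ x0.le (by linarith)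
      have b : M * w F ≤ y ^ 36 * 1 :=
        mul_le_mul hM (w1 F hFH) (w0 F) (by positivity)
      calc (1 + y⁻¹ ^ 3) * (M * w F) ≤ (1 + y⁻¹ ^ 3) * (y ^ 36 * 1) :=
            mul_le_mul_of_nonneg_left b (by positivity)
        _ ≤ 2 * y ^ 36 := by
            rw [mul_one]; exact mul_le_mul_of_nonneg_right (by linarith) (by positivity)
    · have a := (hmedium F hFH hF72 (not_lt.1 h24)).1
      have b : y ^ 12 ≤ y ^ 36 := pow_le_pow_right₀ (by linarith) (by norm_num)
      linarith
  obtain ⟨ω, hω⟩ := exists_forall_notMem_of_local (randomSubset V q) A I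
    (fun F G => ((T ∩ F) ∩ G).Nonempty) (p := 3 * (2 / y ^ 12) ^ (6 * C + 4))
    (d := 2 * y ^ 36 * ((C + 1) * (y ^ 72) ^ C)) (by positivity)
    (by
      have a : 1 ≤ y ^ 36 := one_le_pow₀ (by linarith)
      have b : 1 ≤ (y ^ 72) ^ C := one_le_pow₀ (one_le_pow₀ (by linarith))
      have c : (1 : ℝ) ≤ C + 1 := by linarith [Nat.cast_nonneg (α := ℝ) C]
      nlinarith [one_le_mul_of_one_le_of_one_le c b])
    hprob
    (by
      intro F hF
      have := hH.card_filter_inter_nonempty_le (α := (y ^ 72)⁻¹) (by positivity)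
        (inv_le_one_of_one_le₀ (one_le_pow₀ (by linarith))) I
        (fun G hG => ⟨((memI G).1 hG).1, ((memI G).1 hG).2.le⟩) hHfin (T ∩ F)
      rw [inv_inv] at this
      refine this.trans (mul_le_mul (ycard F hF) ?_ (by positivity) (by positivity))
      exact mul_le_mul_of_nonneg_right (by linarith) (by positivity))
    (by
      intro F hF J hJ hJF
      refine randomSubset_real_inter q (T ∩ F) _ _ (fun ω ω' h => (hAdep F ω ω' h).1) ?_
      intro ω ω' h hω
      simp only [mem_iInter, mem_compl_iff] at hω ⊢
      intro G hG
      rw [← hAdep G ω ω' ?_]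
      · exact hω G hG
      · intro v hv
        refine h v fun hvF => hJF G hG ⟨v, Finset.mem_inter.2 ⟨hvF, ?_⟩⟩
        exact (Finset.mem_inter.1 hv).2)
    hy.local_le
  refine ⟨T.filter fun v => ω v = true, ?_⟩
  have hcnt : ∀ F, (((T.filter fun v => ω v = true) ∩ F).card : ℝ) = cnt F ω := by
    intro F
    simp only [cnt]
    rw [Finset.filter_inter]
  have y72 : (y ^ 72)⁻¹ ≤ (y ^ 24)⁻¹ :=
    inv_anti₀ (by positivity) (pow_le_pow_right₀ (by linarith) (by norm_num))
  have heavy : ∀ F ∈ H, (y ^ 8)⁻¹ < w F → (1 - y⁻¹) * (y ^ 12 * w F) < cnt F ω ∧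
      cnt F ω < (1 + y⁻¹) * (y ^ 12 * w F) := by
    intro F hF h
    have := hω F ((memI F).2 ⟨hF, (y72.trans y8).trans_lt h⟩)
    simp only [A, if_pos h, mem_union, mem_ofPred_eq, not_or, not_le] at this
    exact ⟨this.2, this.1⟩
  refine ⟨fun F hF h => ?_, fun F hF h => ?_, fun F hF h h8 => ?_, fun F hF h => ?_⟩
  · rw [hcnt]; exact (heavy F hF h).1.le
  · rw [hcnt]; exact (heavy F hF h).2.le
  · rw [hcnt]
    have := hω F ((memI F).2 ⟨hF, y72.trans_lt h⟩)
    simp only [A, if_neg (not_lt.2 h8 : ¬ (y ^ 8)⁻¹ < w F), if_pos (show (y ^ 24)⁻¹ < w F from h),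
      mem_ofPred_eq, not_le] at this
    exact this.le
  · by_cases h72 : (y ^ 72)⁻¹ < w F
    · have := hω F ((memI F).2 ⟨hF, h72⟩)
      simp only [A, if_neg (not_lt.2 (h.trans y8) : ¬ (y ^ 8)⁻¹ < w F),
        if_neg (not_lt.2 h : ¬ (y ^ 24)⁻¹ < w F), mem_ofPred_eq, not_le] at this
      rw [← hcnt, Nat.cast_lt] at this
      omega
    · refine le_trans (Finset.card_le_card ?_) (hlight F hF (not_lt.1 h72))
      exact Finset.inter_subset_inter_right (Finset.filter_subset _ _)

/-- If `N` is at most the cube of `y ^ 12`, sparsify the whole vertex set. -/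
theorem exists_isGoodAtPow_of_le {V : Type*} [Fintype V] [DecidableEq V] {H : Set (Finset V)}
    {N C : ℕ} {y : ℝ} (hH : HasPolyTails H N C) (hy : IsLargeScale C y)
    (hyN : y ^ 12 ≤ N) (hN : (N : ℝ) ≤ y ^ 36) : ∃ S : Finset V, IsGoodAtPow H N C y S := by
  have y3 := hy.three_le
  have y0 : 0 < y := by linarith
  have N0 : (0 : ℝ) < N := lt_of_lt_of_le (by positivity) hyN
  have x0 : 0 < y⁻¹ ^ 3 := by positivity
  have hNw : ∀ F : Finset V, (N : ℝ) * ((F.card : ℝ) / N) = F.card := fun F => by field_simp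
  refine exists_isGoodAtPow_of_spread (M := N) hH (by exact_mod_cast N0) hy
    ⟨y ^ 12 / N, by positivity, div_le_one_of_le₀ hyN N0.le⟩
    (by simp only []; field_simp) hN Finset.univ ?_ ?_ ?_ ?_
  · intro F _ _
    rw [hNw, Finset.univ_inter]
    nlinarith [Nat.cast_nonneg (α := ℝ) F.card]
  · intro F _ _
    rw [hNw, Finset.univ_inter]
    nlinarith [Nat.cast_nonneg (α := ℝ) F.card]
  · intro F _ _ h
    rw [Finset.univ_inter]
    have e : y ^ 36 * (y ^ 24)⁻¹ = y ^ 12 := by field_simp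
    have e' : y ^ 12 * (y ^ 24)⁻¹ = 1 / y ^ 12 := by field_simp
    have p : 0 < y ^ 12 := by positivity
    constructor
    · rw [← hNw F]
      have := mul_le_mul hN h (by positivity) (by positivity)
      linarith
    · have := mul_le_mul_of_nonneg_left h p.le
      calc y ^ 12 / N * (F.card : ℝ) = y ^ 12 * (F.card / N) := by ring
        _ ≤ 1 / y ^ 12 := by linarith
        _ ≤ 2 / y ^ 12 := by gcongr; norm_num
  · intro F _ h
    rw [Finset.univ_inter]
    have h1 : (F.card : ℝ) < 1 := by
      rw [← hNw F]
      calc (N : ℝ) * (F.card / N) ≤ y ^ 36 * (y ^ 72)⁻¹ :=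
            mul_le_mul hN h (by positivity) (by positivity)
        _ = (y ^ 36)⁻¹ := by field_simp
        _ < 1 := inv_lt_one_of_one_lt₀ (one_lt_pow₀ (by linarith) (by norm_num))
    have : F.card < 1 := by exact_mod_cast h1
    omega

/-- A good set at scale `y ^ 3` contains a good set at scale `y`. -/
theorem IsGoodAtPow.exists_of_cube {V : Type*} [Fintype V] [DecidableEq V] {H : Set (Finset V)}
    {N C : ℕ} {y : ℝ} (hH : HasPolyTails H N C) (hN : 0 < N) (hy : IsLargeScale C y)
    {T : Finset V} (hT : IsGoodAtPow H N C (y ^ 3) T) : ∃ S : Finset V, IsGoodAtPow H N C y S := by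
  have y3 := hy.three_le
  have y0 : 0 < y := by linarith
  obtain ⟨h1, h2, h3, h4⟩ := hT
  simp only [← pow_mul, Nat.reduceMul, ← inv_pow] at h1 h2 h3 h4
  simp only [inv_pow] at h1 h2 h3 h4
  refine exists_isGoodAtPow_of_spread (M := y ^ 36) hH hN hy
    ⟨(y ^ 24)⁻¹, by positivity, inv_le_one_of_one_le₀ (one_le_pow₀ (by linarith))⟩
    (by simp only []; field_simp) le_rfl T ?_ ?_ ?_ h4
  · simpa only [inv_pow] using h1
  · simpa only [inv_pow] using h2
  · intro F hF ha hb
    have x1 : (y ^ 3)⁻¹ ≤ 1 := inv_le_one_of_one_le₀ (one_le_pow₀ (by linarith))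
    have key : ((T ∩ F).card : ℝ) ≤ 2 * y ^ 12 := (h3 F hF ha hb).trans
      (mul_le_mul_of_nonneg_right (by linarith) (by positivity))
    refine ⟨key, ?_⟩
    calc (y ^ 24)⁻¹ * ((T ∩ F).card : ℝ) ≤ (y ^ 24)⁻¹ * (2 * y ^ 12) :=
          mul_le_mul_of_nonneg_left key (by positivity)
      _ = 2 / y ^ 12 := by field_simp

theorem exists_isGoodAtPow {V : Type*} [Fintype V] [DecidableEq V] {H : Set (Finset V)}
    {N C : ℕ} {Y : ℝ} (hH : HasPolyTails H N C) (hY : 3 ≤ Y)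
    (hlarge : ∀ y, Y ≤ y → IsLargeScale C y) (n : ℕ) :
    ∀ y, Y ≤ y → y ^ 12 ≤ N → (N : ℝ) ≤ (y ^ 12) ^ 3 ^ n →
      ∃ S : Finset V, IsGoodAtPow H N C y S := by
  induction n with
  | zero =>
    intro y hy hyN hN
    rw [pow_zero, pow_one] at hN
    exact exists_isGoodAtPow_of_le hH (hlarge y hy) hyN
      (hN.trans (pow_le_pow_right₀ (by linarith) (by norm_num)))
  | succ n ih =>
    intro y hy hyN hN
    have N0 : (0 : ℝ) < N := lt_of_lt_of_le (pow_pos (by linarith) _) hyN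
    rcases le_total (N : ℝ) (y ^ 36) with h | h
    · exact exists_isGoodAtPow_of_le hH (hlarge y hy) hyN h
    · have hy3 : y ≤ y ^ 3 := le_self_pow₀ (by linarith) (by norm_num)
      obtain ⟨T, hT⟩ := ih (y ^ 3) (hy.trans hy3) (by rwa [← pow_mul])
        (hN.trans_eq (by rw [← pow_mul, ← pow_mul, ← pow_mul, pow_succ]; congr 1; ring))
      exact hT.exists_of_cube hH (by exact_mod_cast N0) (hlarge y hy)

/-- For every `C ∈ ℕ` there is `K = K(C)` such that: whenever `H` is a
hypergraph on a finite vertex set `V` with polynomial tails (parameters `N`, `C`) and `m` is a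
real with `K ≤ m ≤ N`, there exists an `m`-good subset of `V`. -/
theorem good_sets_in_hypergraphs (C : ℕ) :
    ∃ K : ℝ, ∀ (V : Type) [Fintype V] (H : Set (Finset V)) (N : ℕ) (m : ℝ),
      HasPolyTails H N C → K ≤ m → m ≤ (N : ℝ) →
      ∃ S : Set V, IsGoodSet H N C m S := by
  classical
  obtain ⟨Y, hY3, hY⟩ := exists_isLargeScale C
  refine ⟨Y ^ 12, fun V _ H N m hH hm hmN => ?_⟩
  have hm0 : 0 ≤ m := le_trans (by positivity) hm
  obtain ⟨y, hy0, rfl⟩ : ∃ y : ℝ, 0 ≤ y ∧ y ^ 12 = m :=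
    ⟨m ^ ((12 : ℕ) : ℝ)⁻¹, by positivity, Real.rpow_inv_natCast_pow hm0 (by norm_num)⟩
  have hYy : Y ≤ y := le_of_pow_le_pow_left₀ (by norm_num) hy0 hm
  have y1 : 1 < y := by linarith
  obtain ⟨n, hn⟩ := pow_unbounded_of_one_lt (N : ℝ) (one_lt_pow₀ y1 (n := 12) (by norm_num))
  obtain ⟨S, hS⟩ := exists_isGoodAtPow hH hY3 hY n y hYy hmN
    (hn.le.trans (pow_le_pow_right₀ (one_le_pow₀ y1.le) (Nat.lt_pow_self (by norm_num)).le))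
  exact ⟨S, hS.isGoodSet (by linarith)⟩
end
end

section
/- For every C ∈ ℕ there exists K = K(C) such that the following holds. Let 𝓗 be a hypergraph on a finite vertex set V having polynomial tails with parameters N and C, let m be a real number with K ≤ m and m³ ≤ N, set m₀ = m³, and suppose S₀ ⊆ V is an m₀-good set. Then there exists an m-good set S ⊆ S₀. -/
open Set

noncomputable section

open MeasureTheory ProbabilityTheory unitInterval

/-- Symmetric **Lovász local lemma** for a dependency graph `r`. The hypothesis `hind` says that
`B i` is independent of the simultaneous failure of the events it is not related to. -/
theorem exists_notMem_of_symmetric_local_lemma {Ω ι : Type*} [MeasurableSpace Ω]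
    (μ : Measure Ω) [IsProbabilityMeasure μ] (B : ι → Set Ω) (hB : ∀ i, MeasurableSet (B i))
    (r : ι → ι → Prop) [DecidableRel r] (E : Finset ι) (q d : ℝ) (hq : 0 ≤ q) (hq2 : q < 1 / 2)
    (hqd : 4 * q * d ≤ 1) (hprob : ∀ i ∈ E, μ.real (B i) ≤ q)
    (hdeg : ∀ i ∈ E, ((E.filter (r i)).card : ℝ) ≤ d)
    (hind : ∀ i ∈ E, ∀ J ⊆ E, (∀ j ∈ J, ¬ r i j) →
      μ.real (B i ∩ ⋂ j ∈ J, (B j)ᶜ) = μ.real (B i) * μ.real (⋂ j ∈ J, (B j)ᶜ)) :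
    ∃ ω, ∀ i ∈ E, ω ∉ B i := by
  classical
  set G : Finset ι → Set Ω := fun J => ⋂ j ∈ J, (B j)ᶜ with hG
  have hGm : ∀ J, MeasurableSet (G J) := fun J =>
    Finset.measurableSet_biInter J fun j _ => (hB j).compl
  have hGanti : ∀ J K : Finset ι, J ⊆ K → G K ⊆ G J := fun J K h =>
    biInter_subset_biInter_left h
  have key : ∀ n : ℕ, ∀ J ⊆ E, J.card = n → ∀ i ∈ E,
      μ.real (B i ∩ G J) ≤ 2 * q * μ.real (G J) := by
    intro n
    induction n using Nat.strong_induction_on with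
    | _ n ih =>
    intro J hJ hn i hi
    set J₁ := J.filter (r i)
    set J₂ := J.filter (fun j => ¬ r i j)
    have hJ₂ : J₂ ⊆ J := Finset.filter_subset _ _
    have hJ₁ : J₁ ⊆ J := Finset.filter_subset _ _
    have h1 : μ.real (B i ∩ G J) ≤ q * μ.real (G J₂) := by
      calc μ.real (B i ∩ G J) ≤ μ.real (B i ∩ G J₂) :=
            measureReal_mono (inter_subset_inter_right _ (hGanti _ _ hJ₂))
        _ = μ.real (B i) * μ.real (G J₂) :=
            hind i hi J₂ (hJ₂.trans hJ) fun j hj => (Finset.mem_filter.1 hj).2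
        _ ≤ _ := mul_le_mul_of_nonneg_right (hprob i hi) measureReal_nonneg
    have hcover : G J₂ ⊆ G J ∪ ⋃ j ∈ J₁, (B j ∩ G J₂) := by
      intro ω hω
      by_cases h : ω ∈ G J
      · exact Or.inl h
      · right
        simp only [hG, mem_iInter, mem_compl_iff, not_forall, not_not] at h hω
        obtain ⟨j, hj, hjB⟩ := h
        have hr : r i j := by
          by_contra hr
          exact hω j (Finset.mem_filter.2 ⟨hj, hr⟩) hjB
        simp only [mem_iUnion]
        exact ⟨j, Finset.mem_filter.2 ⟨hj, hr⟩, hjB, by simpa [hG] using hω⟩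
    have h2 : μ.real (G J₂) ≤ μ.real (G J) + ∑ j ∈ J₁, μ.real (B j ∩ G J₂) :=
      (measureReal_mono hcover).trans <| (measureReal_union_le _ _).trans <| by
        gcongr
        exact measureReal_biUnion_finset_le _ _
    have h3 : ∑ j ∈ J₁, μ.real (B j ∩ G J₂) ≤ (1 / 2) * μ.real (G J₂) := by
      have hterm : ∀ j ∈ J₁, μ.real (B j ∩ G J₂) ≤ 2 * q * μ.real (G J₂) := by
        intro j hj
        have hlt : J₂.card < n := by
          rw [← hn]
          refine Finset.card_lt_card ⟨hJ₂, fun hsub => ?_⟩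
          exact (Finset.mem_filter.1 (hsub (hJ₁ hj))).2 (Finset.mem_filter.1 hj).2
        exact ih _ hlt J₂ (hJ₂.trans hJ) rfl j (hJ (hJ₁ hj))
      have hcard : (J₁.card : ℝ) ≤ d :=
        le_trans (by exact_mod_cast Finset.card_le_card (Finset.filter_subset_filter _ hJ))
          (hdeg i hi)
      calc ∑ j ∈ J₁, μ.real (B j ∩ G J₂) ≤ J₁.card • (2 * q * μ.real (G J₂)) :=
            Finset.sum_le_card_nsmul _ _ _ hterm
        _ = (2 * q * J₁.card) * μ.real (G J₂) := by rw [nsmul_eq_mul]; ring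
        _ ≤ (1 / 2) * μ.real (G J₂) := by
            apply mul_le_mul_of_nonneg_right _ measureReal_nonneg
            nlinarith [mul_le_mul_of_nonneg_left hcard hq]
    nlinarith [mul_le_mul_of_nonneg_left (h2.trans (add_le_add_right h3 _)) hq]
  have hpos : ∀ J ⊆ E, 0 < μ.real (G J) := by
    intro J
    induction J using Finset.induction_on with
    | empty => intro _; simp [hG]
    | insert i J hi ih =>
      intro hJ
      have hJE : J ⊆ E := (Finset.subset_insert i J).trans hJ
      have hk := key _ J hJE rfl i (hJ (Finset.mem_insert_self i J))
      have hsplit : μ.real (G J) ≤ μ.real (G (insert i J)) + μ.real (B i ∩ G J) := by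
        refine (measureReal_mono ?_).trans (measureReal_union_le _ _)
        intro ω hω
        by_cases h : ω ∈ B i
        · exact Or.inr ⟨h, hω⟩
        · left
          simp only [hG, Finset.mem_insert, iInter_iInter_eq_or_left]
          exact ⟨h, hω⟩
      have := ih hJE
      nlinarith
  have hne : (G E).Nonempty := by
    by_contra h
    rw [not_nonempty_iff_eq_empty] at h
    have := hpos E subset_rfl
    simp [h] at this
  obtain ⟨ω, hω⟩ := hne
  exact ⟨ω, fun i hi => by simpa using mem_iInter₂.1 hω i hi⟩

/-- The law of a random subset of `V`, coded by its indicator function, to which every vertex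
belongs independently with probability `p`. -/
def bernoulliProduct (V : Type*) [Fintype V] (p : I) : Measure (V → Bool) :=
  Measure.pi fun _ => bernoulliMeasure true false p

instance {V : Type*} [Fintype V] (p : I) : IsProbabilityMeasure (bernoulliProduct V p) := by
  unfold bernoulliProduct; infer_instance

/-- Two events determined by disjoint sets of coordinates are independent. -/
theorem bernoulliProduct_inter_of_dependsOn {V : Type*} [Fintype V] (p : I)
    {X Y : Finset V} (hXY : Disjoint X Y) {A B : Set (V → Bool)}
    (hA : DependsOn (· ∈ A) (X : Set V)) (hB : DependsOn (· ∈ B) (Y : Set V)) :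
    (bernoulliProduct V p).real (A ∩ B) =
      (bernoulliProduct V p).real A * (bernoulliProduct V p).real B := by
  have hrep : ∀ (Z : Finset V) (D : Set (V → Bool)), DependsOn (· ∈ D) (Z : Set V) →
      (fun (ω : V → Bool) (i : Z) => ω i) ⁻¹' ((fun ω (i : Z) => ω i) '' D) = D := by
    intro Z D hD
    refine subset_antisymm ?_ (subset_preimage_image _ _)
    rintro ω ⟨ω', hω', h⟩
    have : (ω' ∈ D) = (ω ∈ D) := hD fun v hv => congrFun h ⟨v, hv⟩
    exact this ▸ hω'
  have hind : iIndepFun (fun (v : V) (ω : V → Bool) => ω v) (bernoulliProduct V p) :=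
    iIndepFun_pi (X := fun _ b => b) fun _ => aemeasurable_id
  have h := (hind.indepFun_finset X Y hXY fun v => measurable_pi_apply v).measure_inter_preimage_eq_mul
    _ _ (toFinite ((fun ω (i : X) => ω i) '' A)).measurableSet
    (toFinite ((fun ω (i : Y) => ω i) '' B)).measurableSet
  rw [hrep X A hA, hrep Y B hB] at h
  simp [measureReal_def, h]

/-- The local lemma for events determined by few independent coordinates. -/
theorem exists_notMem_of_dependsOn {V ι : Type*} [Fintype V] [DecidableEq V] (p : I)
    (B : ι → Set (V → Bool)) (X : ι → Finset V)
    (hdep : ∀ i, DependsOn (· ∈ B i) (X i : Set V)) (E : Finset ι) (q d : ℝ)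
    (hq : 0 ≤ q) (hq2 : q < 1 / 2) (hqd : 4 * q * d ≤ 1)
    (hprob : ∀ i ∈ E, (bernoulliProduct V p).real (B i) ≤ q)
    (hdeg : ∀ i ∈ E, ((E.filter fun j => ¬ Disjoint (X i) (X j)).card : ℝ) ≤ d) :
    ∃ ω, ∀ i ∈ E, ω ∉ B i := by
  refine exists_notMem_of_symmetric_local_lemma (bernoulliProduct V p) B
    (fun i => (toFinite _).measurableSet) (fun i j => ¬ Disjoint (X i) (X j)) E q d hq hq2 hqd
    hprob hdeg fun i _ J _ hJ => ?_
  refine bernoulliProduct_inter_of_dependsOn p (Y := J.biUnion X) ?_ (hdep i) ?_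
  · rw [Finset.disjoint_biUnion_right]
    exact fun j hj => not_not.1 (hJ j hj)
  · intro ω ω' h
    simp only [mem_iInter, mem_compl_iff]
    refine propext (forall₂_congr fun j hj => not_congr (iff_of_eq (hdep j fun v hv => h v ?_)))
    exact Finset.mem_coe.2 (Finset.mem_biUnion.2 ⟨j, hj, hv⟩)

/-- Moment generating function of the number of selected elements of `X`. -/
theorem integral_exp_mul_card_bernoulliProduct {V : Type*} [Fintype V] (p : I)
    (X : Finset V) (l : ℝ) :
    ∫ ω, Real.exp (l * ((X.filter fun v => ω v = true).card : ℝ)) ∂(bernoulliProduct V p) =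
      (1 + p * (Real.exp l - 1)) ^ X.card := by
  classical
  have hfun : ∀ ω : V → Bool, Real.exp (l * ((X.filter fun v => ω v = true).card : ℝ)) =
      ∏ v, (fun b => if v ∈ X ∧ b = true then Real.exp l else 1) (ω v) := by
    intro ω
    rw [mul_comm, Real.exp_nat_mul, ← Finset.prod_const, Finset.prod_filter]
    simp only [ite_and]
    rw [Finset.prod_ite_mem, Finset.univ_inter]
  simp_rw [hfun]
  rw [bernoulliProduct, integral_fintype_prod_eq_prod (𝕜 := ℝ)
    (fun v b => if v ∈ X ∧ b = true then Real.exp l else 1)]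
  have hone : ∀ v, ∫ b, (if v ∈ X ∧ b = true then Real.exp l else 1) ∂(bernoulliMeasure true false p)
      = if v ∈ X then 1 + p * (Real.exp l - 1) else 1 := by
    intro v
    rw [integral_bernoulliMeasure]
    by_cases hv : v ∈ X
    · simp [hv]
      ring
    · simp [hv]
  simp_rw [hone]
  rw [Finset.prod_ite_mem, Finset.univ_inter, Finset.prod_const]

/-- Chernoff's bound, for both tails at once: `l` may have either sign. -/
theorem bernoulliProduct_real_le_exp {V : Type*} [Fintype V] (p : I) (X : Finset V)
    (l t : ℝ) :
    (bernoulliProduct V p).real {ω | t ≤ l * ((X.filter fun v => ω v = true).card : ℝ)} ≤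
      Real.exp (X.card * p * (Real.exp l - 1) - t) := by
  have h := measure_ge_le_exp_mul_mgf (μ := bernoulliProduct V p)
    (X := fun ω => l * ((X.filter fun v => ω v = true).card : ℝ)) t zero_le_one .of_finite
  refine h.trans ?_
  simp only [mgf, one_mul, neg_mul]
  rw [integral_exp_mul_card_bernoulliProduct, sub_eq_neg_add _ t, Real.exp_add]
  gcongr
  rw [mul_assoc, Real.exp_nat_mul]
  have h0 : (0 : ℝ) ≤ 1 + p * (Real.exp l - 1) := by
    nlinarith [p.2.1, p.2.2, Real.exp_pos l, mul_nonneg p.2.1 (Real.exp_pos l).le]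
  exact pow_le_pow_left₀ h0 (by linarith [Real.add_one_le_exp ((p : ℝ) * (Real.exp l - 1))]) _

/-- Multiplicative Chernoff bound for the upper tail. -/
theorem bernoulliProduct_real_upper_tail {V : Type*} [Fintype V] (p : I) (X : Finset V)
    {M δ : ℝ} (hM : 0 ≤ M) (hδ : 0 ≤ δ) (hδ2 : δ ≤ 1 / 2) (hX : X.card * (p : ℝ) ≤ (1 + δ ^ 3) * M) :
    (bernoulliProduct V p).real
      {ω | (1 + δ) * M < ((X.filter fun v => ω v = true).card : ℝ)} ≤
      Real.exp (-(M * δ ^ 2 / 16)) := by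
  refine (measureReal_mono ?_).trans ((bernoulliProduct_real_le_exp p X (δ / 4)
    (δ / 4 * ((1 + δ) * M))).trans (Real.exp_le_exp.2 ?_))
  · intro ω hω
    change (1 + δ) * M < _ at hω
    exact mul_le_mul_of_nonneg_left hω.le (by positivity)
  · have he : Real.exp (δ / 4) - 1 ≤ δ / 4 + (δ / 4) ^ 2 := by
      have h := Real.abs_exp_sub_one_sub_id_le (x := δ / 4) (by rw [abs_le]; constructor <;> linarith)
      linarith [(abs_le.1 h).2]
    have h0 : 0 ≤ X.card * (p : ℝ) := mul_nonneg (Nat.cast_nonneg _) p.2.1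
    calc (X.card : ℝ) * p * (Real.exp (δ / 4) - 1) - δ / 4 * ((1 + δ) * M)
        ≤ (1 + δ ^ 3) * M * (δ / 4 + (δ / 4) ^ 2) - δ / 4 * ((1 + δ) * M) := by
          have h1 := mul_le_mul_of_nonneg_left he h0
          have h2 := mul_le_mul_of_nonneg_right hX (by positivity : 0 ≤ δ / 4 + (δ / 4) ^ 2)
          linarith
      _ = -(M * δ ^ 2 / 16) + M * δ ^ 2 * (δ ^ 2 / 4 + δ ^ 3 / 16 - 1 / 8) := by ring
      _ ≤ -(M * δ ^ 2 / 16) := by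
          have : δ ^ 2 / 4 + δ ^ 3 / 16 - 1 / 8 ≤ 0 := by nlinarith [pow_nonneg hδ 2]
          nlinarith [mul_nonneg hM (pow_nonneg hδ 2)]

/-- Multiplicative Chernoff bound for the lower tail. -/
theorem bernoulliProduct_real_lower_tail {V : Type*} [Fintype V] (p : I) (X : Finset V)
    {M δ : ℝ} (hM : 0 ≤ M) (hδ : 0 ≤ δ) (hδ2 : δ ≤ 1 / 2) (hX : (1 - δ ^ 3) * M ≤ X.card * (p : ℝ)) :
    (bernoulliProduct V p).real
      {ω | ((X.filter fun v => ω v = true).card : ℝ) < (1 - δ) * M} ≤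
      Real.exp (-(M * δ ^ 2 / 16)) := by
  refine (measureReal_mono ?_).trans ((bernoulliProduct_real_le_exp p X (-(δ / 4))
    (-(δ / 4) * ((1 - δ) * M))).trans (Real.exp_le_exp.2 ?_))
  · intro ω hω
    change _ < (1 - δ) * M at hω
    exact mul_le_mul_of_nonpos_left hω.le (by linarith)
  · have he : Real.exp (-(δ / 4)) - 1 ≤ -(δ / 4) + (δ / 4) ^ 2 := by
      have h := Real.abs_exp_sub_one_sub_id_le (x := -(δ / 4))
        (by rw [abs_le]; constructor <;> linarith)
      linarith [(abs_le.1 h).2]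
    have h0 : 0 ≤ X.card * (p : ℝ) := mul_nonneg (Nat.cast_nonneg _) p.2.1
    have hneg : -(δ / 4) + (δ / 4) ^ 2 ≤ 0 := by nlinarith
    calc (X.card : ℝ) * p * (Real.exp (-(δ / 4)) - 1) - -(δ / 4) * ((1 - δ) * M)
        ≤ (1 - δ ^ 3) * M * (-(δ / 4) + (δ / 4) ^ 2) - -(δ / 4) * ((1 - δ) * M) := by
          have h1 := mul_le_mul_of_nonneg_left he h0
          have h2 := mul_le_mul_of_nonpos_right hX hneg
          linarith
      _ = -(M * δ ^ 2 / 16) + M * δ ^ 2 * (δ ^ 2 / 4 - δ ^ 3 / 16 - 1 / 8) := by ring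
      _ ≤ -(M * δ ^ 2 / 16) := by
          have : δ ^ 2 / 4 - δ ^ 3 / 16 - 1 / 8 ≤ 0 := by nlinarith [pow_nonneg hδ 3]
          nlinarith [mul_nonneg hM (pow_nonneg hδ 2)]

/-- Poisson-type bound for the probability of selecting at least `k` elements when far fewer than
one is expected. -/
theorem bernoulliProduct_real_le_card {V : Type*} [Fintype V] (p : I) (X : Finset V)
    {y : ℝ} (hy : 2 ≤ y) (hX : X.card * (p : ℝ) ≤ 2 / y) (k : ℕ) :
    (bernoulliProduct V p).real {ω | k ≤ (X.filter fun v => ω v = true).card} ≤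
      Real.exp 1 * (2 / y) ^ k := by
  have hy0 : 0 < y / 2 := by linarith
  have hlog : 0 ≤ Real.log (y / 2) := Real.log_nonneg (by linarith)
  refine (measureReal_mono ?_).trans ((bernoulliProduct_real_le_exp p X (Real.log (y / 2))
    (Real.log (y / 2) * k)).trans ?_)
  · intro ω hω
    exact mul_le_mul_of_nonneg_left (Nat.cast_le.2 hω) hlog
  · have hpow : (2 / y) ^ k = Real.exp (-(Real.log (y / 2) * k)) := by
      rw [Real.exp_neg, mul_comm, Real.exp_nat_mul, Real.exp_log hy0, ← inv_pow, inv_div]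
    rw [hpow, ← Real.exp_add, Real.exp_log hy0, sub_eq_add_neg _ (Real.log _ * _)]
    gcongr
    calc (X.card : ℝ) * p * (y / 2 - 1) ≤ 2 / y * (y / 2 - 1) := by
          gcongr
          linarith
      _ = 1 - 2 / y := by field_simp
      _ ≤ 1 := by
          have : 0 ≤ 2 / y := by positivity
          linarith

/-- The requirement that goodness at scale `m = x ^ 12` imposes on the number `k` of selected
vertices in an edge of weight `w`. -/
def IsGoodCount (C : ℕ) (x w : ℝ) (k : ℕ) : Prop :=
  (x⁻¹ ^ 8 < w → (1 - x⁻¹) * x ^ 12 * w ≤ k ∧ k ≤ (1 + x⁻¹) * x ^ 12 * w) ∧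
  (x⁻¹ ^ 24 < w → w ≤ x⁻¹ ^ 8 → k ≤ (1 + x⁻¹) * x ^ 4) ∧
  (w ≤ x⁻¹ ^ 24 → k ≤ 6 * C + 3)

theorem isGoodSet_pow_twelve_iff {V : Type*} {H : Set (Finset V)} {N C : ℕ} {x : ℝ} (hx : 0 < x)
    (hH : ∀ F ∈ H, (F.card : ℝ) / N ≤ 1) (S : Set V) :
    IsGoodSet H N C (x ^ 12) S ↔
      ∀ F ∈ H, IsGoodCount C x ((F.card : ℝ) / N) (S ∩ ↑F).ncard := by
  have hpow : ∀ r : ℝ, (x ^ 12) ^ r = x ^ (12 * r) := fun r => by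
    rw [← Real.rpow_natCast x 12, ← Real.rpow_mul hx.le]; norm_num
  have hneg : ∀ n : ℕ, x ^ (-(n : ℝ)) = x⁻¹ ^ n := fun n => by
    rw [Real.rpow_neg hx.le, Real.rpow_natCast, inv_pow]
  have e1 : (x ^ 12) ^ (-(2 : ℝ) / 3) = x⁻¹ ^ 8 := by rw [hpow, ← hneg]; norm_num
  have e2 : (x ^ 12) ^ (-(1 : ℝ) / 12) = x⁻¹ := by rw [hpow, ← pow_one x⁻¹, ← hneg]; norm_num
  have e3 : (x ^ 12) ^ (-(2 : ℝ)) = x⁻¹ ^ 24 := by rw [hpow, ← hneg]; norm_num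
  have e4 : (x ^ 12) ^ ((1 : ℝ) / 3) = x ^ 4 := by rw [hpow, ← Real.rpow_natCast]; norm_num
  unfold IsGoodSet IsGoodCount
  rw [e1, e2, e3, e4]
  constructor
  · rintro ⟨h1, h2, h3⟩ F hF
    exact ⟨fun h => h1 F hF h (hH F hF), h2 F hF, h3 F hF⟩
  · intro h
    exact ⟨fun F hF hw _ => (h F hF).1 hw, fun F hF => (h F hF).2.1, fun F hF => (h F hF).2.2⟩

/-- A count that is good at scale `x ^ 36` becomes bad at scale `x ^ 12` with tiny probability
after selecting each element with probability `x ^ (-24)`. -/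
theorem bernoulliProduct_real_not_isGoodCount_le {V : Type*} [Fintype V] (p : I) (X : Finset V)
    {C : ℕ} {x w : ℝ} (hp : (p : ℝ) = x⁻¹ ^ 24) (hx : 2 ≤ x)
    (hexp : 2 * Real.exp (-(x ^ 2 / 16)) ≤ x⁻¹ ^ (72 * C + 37))
    (hlight : Real.exp 1 * 2 ^ (6 * C + 4) ≤ x ^ 11)
    (hw : x⁻¹ ^ 72 < w) (hX : IsGoodCount C (x ^ 3) w X.card) :
    (bernoulliProduct V p).real
      {ω | ¬ IsGoodCount C x w (X.filter fun v => ω v = true).card} ≤ x⁻¹ ^ (72 * C + 37) := by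
  have hx0 : 0 < x := by linarith
  set δ := x⁻¹ with hδdef
  have hxδ : x * δ = 1 := mul_inv_cancel₀ hx0.ne'
  have hδ : 0 < δ := inv_pos.2 hx0
  have hδ2 : δ ≤ 1 / 2 := by rw [one_div]; exact inv_anti₀ two_pos hx
  have hδ1 : δ ≤ 1 := by linarith
  have hδ3 : δ ^ 3 ≤ 1 := pow_le_one₀ hδ.le hδ1
  have hcancel : ∀ a b : ℕ, x ^ (a + b) * δ ^ b = x ^ a := fun a b => by
    rw [pow_add, mul_assoc, ← mul_pow, hxδ, one_pow, mul_one]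
  have hinv : (x ^ 3)⁻¹ = δ ^ 3 := (inv_pow x 3).symm
  obtain ⟨hX1, hX2, -⟩ := hX
  rw [hinv, ← pow_mul, ← pow_mul] at hX1 hX2
  rw [← pow_mul] at hX2
  norm_num only at hX1 hX2
  have hexp' : ∀ M : ℝ, x ^ 4 ≤ M →
      Real.exp (-(M * δ ^ 2 / 16)) ≤ Real.exp (-(x ^ 2 / 16)) := fun M hM => by
    have h := mul_le_mul_of_nonneg_right hM (pow_nonneg hδ.le 2)
    rw [hcancel 2 2] at h
    exact Real.exp_le_exp.2 (by linarith)
  have hpos := Real.exp_pos (-(x ^ 2 / 16))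
  rcases le_or_gt w (δ ^ 24) with hw24 | hw24
  · have hw8 : w ≤ δ ^ 8 := hw24.trans (pow_le_pow_of_le_one hδ.le hδ1 (by norm_num))
    have hmean : (X.card : ℝ) * p ≤ 2 / x ^ 12 := by
      rw [hp, div_eq_mul_inv, ← inv_pow, ← hδdef]
      calc (X.card : ℝ) * δ ^ 24 ≤ ((1 + δ ^ 3) * x ^ 12) * δ ^ 24 := by
            gcongr
            exact hX2 hw hw24
        _ = (1 + δ ^ 3) * (x ^ (0 + 12) * δ ^ 12) * δ ^ 12 := by ring
        _ = (1 + δ ^ 3) * δ ^ 12 := by rw [hcancel 0 12]; ring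
        _ ≤ 2 * δ ^ 12 := by gcongr; linarith
    refine (measureReal_mono ?_).trans ((bernoulliProduct_real_le_card p X
      (hx.trans (le_self_pow₀ (by linarith) (by norm_num))) hmean (6 * C + 4)).trans ?_)
    · intro ω hω
      by_contra hlt
      exact hω ⟨fun h => absurd hw8 (not_le.2 h), fun h => absurd hw24 (not_le.2 h),
        fun _ => Nat.lt_succ_iff.1 (not_le.1 hlt)⟩
    · calc Real.exp 1 * (2 / x ^ 12) ^ (6 * C + 4)
          = Real.exp 1 * 2 ^ (6 * C + 4) * δ ^ (11 + (72 * C + 37)) := by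
            rw [div_eq_mul_inv, ← inv_pow, ← hδdef, mul_pow, ← pow_mul]
            ring
        _ ≤ x ^ 11 * δ ^ (11 + (72 * C + 37)) := by gcongr
        _ = (x ^ (0 + 11) * δ ^ 11) * δ ^ (72 * C + 37) := by ring
        _ = δ ^ (72 * C + 37) := by rw [hcancel 0 11]; ring
  obtain ⟨hlow, hup⟩ := hX1 hw24
  rcases le_or_gt w (δ ^ 8) with hw8 | hw8
  · have hmean : (X.card : ℝ) * p ≤ (1 + δ ^ 3) * x ^ 4 := by
      rw [hp]
      calc (X.card : ℝ) * δ ^ 24 ≤ ((1 + δ ^ 3) * x ^ 36 * δ ^ 8) * δ ^ 24 := by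
            gcongr
            exact hup.trans (by gcongr)
        _ = (1 + δ ^ 3) * (x ^ (4 + 32) * δ ^ 32) := by ring
        _ = (1 + δ ^ 3) * x ^ 4 := by rw [hcancel 4 32]
    refine (measureReal_mono ?_).trans ((bernoulliProduct_real_upper_tail p X
      (by positivity) hδ.le hδ2 hmean).trans ?_)
    · intro ω hω
      by_contra hlt
      exact hω ⟨fun h => absurd hw8 (not_le.2 h), fun _ _ => not_lt.1 hlt,
        fun h => absurd h (not_le.2 hw24)⟩
    · linarith [hexp' _ le_rfl]
  · have hM : x ^ 4 ≤ x ^ 12 * w := by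
      rw [← hcancel 4 8]
      gcongr
    have hM0 : 0 ≤ x ^ 12 * w := (by positivity : (0 : ℝ) ≤ x ^ 4).trans hM
    have hscale : ∀ c : ℝ, c * x ^ 36 * w * δ ^ 24 = c * (x ^ 12 * w) := fun c => by
      rw [← hcancel 12 24]
      ring
    have hmean_up : (X.card : ℝ) * p ≤ (1 + δ ^ 3) * (x ^ 12 * w) := by
      rw [hp, ← hscale]
      gcongr
    have hmean_low : (1 - δ ^ 3) * (x ^ 12 * w) ≤ (X.card : ℝ) * p := by
      rw [hp, ← hscale]
      gcongr
    have hsub : {ω : V → Bool | ¬ IsGoodCount C x w (X.filter fun v => ω v = true).card} ⊆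
        {ω | (1 + δ) * (x ^ 12 * w) < ((X.filter fun v => ω v = true).card : ℝ)} ∪
        {ω | ((X.filter fun v => ω v = true).card : ℝ) < (1 - δ) * (x ^ 12 * w)} := by
      intro ω hω
      by_contra hlt
      rw [mem_union, not_or] at hlt
      obtain ⟨h1, h2⟩ := hlt
      refine hω ⟨fun _ => ?_, fun _ h => absurd h (not_le.2 hw8),
        fun h => absurd h (not_le.2 hw24)⟩
      rw [mul_assoc, mul_assoc]
      exact ⟨not_lt.1 h2, not_lt.1 h1⟩
    have h1 := bernoulliProduct_real_upper_tail p X hM0 hδ.le hδ2 hmean_up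
    have h2 := bernoulliProduct_real_lower_tail p X hM0 hδ.le hδ2 hmean_low
    have h3 := (measureReal_mono (μ := bernoulliProduct V p) hsub).trans
      (measureReal_union_le _ _)
    linarith [hexp' _ hM]

theorem IsGoodCount.le_two_mul_pow {C : ℕ} {x w : ℝ} {k : ℕ} (hx : 1 ≤ x) (hw : x⁻¹ ^ 24 < w)
    (hw1 : w ≤ 1) (h : IsGoodCount C x w k) : (k : ℝ) ≤ 2 * x ^ 12 := by
  have hx0 : 0 < x := by linarith
  have hδ : x⁻¹ ≤ 1 := inv_le_one_of_one_le₀ hx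
  have hδ0 : 0 < x⁻¹ := inv_pos.2 hx0
  rcases le_or_gt w (x⁻¹ ^ 8) with hw8 | hw8
  · calc (k : ℝ) ≤ (1 + x⁻¹) * x ^ 4 := h.2.1 hw hw8
      _ ≤ 2 * x ^ 12 := by
        gcongr
        · linarith
        · norm_num
  · calc (k : ℝ) ≤ (1 + x⁻¹) * x ^ 12 * w := (h.1 hw8).2
      _ ≤ 2 * x ^ 12 * 1 := by
        have hw0 : 0 ≤ w := (pow_nonneg hδ0.le 8).trans hw8.le
        gcongr
        linarith
      _ = 2 * x ^ 12 := mul_one _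

/-- The inequalities that the scale `x` has to satisfy hold for all large `x`. -/
theorem eventually_scale_bounds (C : ℕ) :
    ∀ᶠ x : ℝ in Filter.atTop, 2 ≤ x ∧ 16 * C ≤ x ∧
      2 * Real.exp (-(x ^ 2 / 16)) ≤ x⁻¹ ^ (72 * C + 37) ∧
      Real.exp 1 * 2 ^ (6 * C + 4) ≤ x ^ 11 := by
  have h1 := Real.tendsto_pow_mul_exp_neg_atTop_nhds_zero (72 * C + 37)
  have h2 := Filter.tendsto_pow_atTop (α := ℝ) (n := 11) (by norm_num)
  filter_upwards [Filter.eventually_ge_atTop (16 : ℝ), Filter.eventually_ge_atTop (16 * C : ℝ),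
    h1.eventually (gt_mem_nhds (by norm_num : (0 : ℝ) < 1 / 2)),
    h2.eventually_ge_atTop (Real.exp 1 * 2 ^ (6 * C + 4))] with x hx hxC hexp hpow
  refine ⟨by linarith, hxC, ?_, hpow⟩
  have hx0 : 0 < x := by linarith
  have hle : Real.exp (-(x ^ 2 / 16)) ≤ Real.exp (-x) := Real.exp_le_exp.2 (by nlinarith)
  rw [inv_pow, le_inv_comm₀ (by positivity) (by positivity), ← one_div,
    le_div_iff₀ (by positivity)]
  have := mul_le_mul_of_nonneg_left hle (pow_nonneg hx0.le (72 * C + 37))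
  linarith

/-- induction step. For every `C ∈ ℕ` there is `K = K(C)` such that: whenever
`H` is a hypergraph on a finite vertex set `V` with polynomial tails (parameters `N`, `C`), `m`
is a real with `K ≤ m` and `m³ ≤ N`, and `S₀ ⊆ V` is `m³`-good, there exists an `m`-good set
`S ⊆ S₀`. -/
theorem good_set_induction_step (C : ℕ) :
    ∃ K : ℝ, ∀ (V : Type) [Fintype V] (H : Set (Finset V)) (N : ℕ) (m : ℝ) (S₀ : Set V),
      HasPolyTails H N C → K ≤ m → m ^ 3 ≤ (N : ℝ) →
      IsGoodSet H N C (m ^ 3) S₀ →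
      ∃ S : Set V, S ⊆ S₀ ∧ IsGoodSet H N C m S := by
  classical
  obtain ⟨x₀, hx₀⟩ := Filter.eventually_atTop.1 (eventually_scale_bounds C)
  refine ⟨(max x₀ 0) ^ 12, fun V _ H N m S₀ hH hm hN hS₀ => ?_⟩
  have hm0 : 0 ≤ m := le_trans (by positivity) hm
  obtain ⟨x, hx_nonneg, rfl⟩ : ∃ x : ℝ, 0 ≤ x ∧ x ^ 12 = m :=
    ⟨m ^ ((12 : ℕ) : ℝ)⁻¹, by positivity, Real.rpow_inv_natCast_pow hm0 (by norm_num)⟩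
  obtain ⟨hx2, hxC, hexp, hlight⟩ := hx₀ x <| (le_max_left x₀ 0).trans <|
    le_of_pow_le_pow_left₀ (by norm_num) hx_nonneg hm
  have hx0 : 0 < x := by linarith
  have hN0 : (0 : ℝ) < N := lt_of_lt_of_le (by positivity) hN
  have hw1 : ∀ F ∈ H, (F.card : ℝ) / N ≤ 1 := fun F hF =>
    (div_le_one hN0).2 (Nat.cast_le.2 (hH.1 F hF))
  rw [show (x ^ 12) ^ 3 = (x ^ 3) ^ 12 by ring,
    isGoodSet_pow_twelve_iff (by positivity) hw1] at hS₀
  set X : Finset V → Finset V := fun F => F.filter (· ∈ S₀) with hX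
  have hncard : ∀ (F : Finset V) (ω : V → Bool),
      ((S₀ ∩ {v | ω v = true}) ∩ ↑F).ncard = ((X F).filter fun v => ω v = true).card := by
    intro F ω
    rw [← ncard_coe_finset]
    congr 1
    ext v
    simp [hX, and_comm, and_left_comm]
  have hXcard : ∀ F : Finset V, (S₀ ∩ ↑F).ncard = (X F).card := by
    intro F
    rw [← ncard_coe_finset]
    congr 1
    ext v
    simp [hX, and_comm]
  simp_rw [hXcard] at hS₀
  set δ := x⁻¹ with hδdef
  have hδ : 0 < δ := inv_pos.2 hx0
  have hxδ : x * δ = 1 := mul_inv_cancel₀ hx0.ne'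
  have hδ1 : δ ≤ 1 := inv_le_one_of_one_le₀ (by linarith)
  have hδ72 : (x ^ 3)⁻¹ ^ 24 = δ ^ 72 := by rw [hδdef, ← inv_pow, ← pow_mul]
  set E : Finset (Finset V) :=
    Finset.univ.filter fun F => F ∈ H ∧ δ ^ 72 < (F.card : ℝ) / N with hE
  have hp : δ ^ 24 ∈ Icc (0 : ℝ) 1 := ⟨by positivity, pow_le_one₀ hδ.le hδ1⟩
  obtain ⟨ω, hω⟩ := exists_notMem_of_dependsOn ⟨δ ^ 24, hp⟩
    (fun F => {ω | ¬ IsGoodCount C x ((F.card : ℝ) / N)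
      ((X F).filter fun v => ω v = true).card}) X
    (fun F ω ω' h => by
      have : ((X F).filter fun v => ω v = true) = (X F).filter fun v => ω' v = true :=
        Finset.filter_congr fun v hv => by rw [h v hv]
      simp only [mem_ofPred_eq, this])
    E (δ ^ (72 * C + 37)) (2 * x ^ 36 * (C * x ^ (72 * C))) (by positivity)
    (by
      calc δ ^ (72 * C + 37) ≤ δ ^ 2 := pow_le_pow_of_le_one hδ.le hδ1 (by omega)
        _ < 1 / 2 := by
          have : δ ≤ 1 / 2 := by rw [one_div]; exact inv_anti₀ two_pos hx2
          nlinarith)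
    (by
      calc 4 * δ ^ (72 * C + 37) * (2 * x ^ 36 * (C * x ^ (72 * C)))
          = 8 * C * δ * (x * δ) ^ (72 * C + 36) := by rw [mul_pow]; ring
        _ ≤ x * δ := by
          rw [hxδ, one_pow, mul_one, ← hxδ]
          gcongr
          nlinarith [(Nat.cast_nonneg C : (0 : ℝ) ≤ C)]
        _ = 1 := hxδ)
    (fun F hF => by
      obtain ⟨hFH, hFw⟩ := (Finset.mem_filter.1 hF).2
      exact bernoulliProduct_real_not_isGoodCount_le _ _ rfl hx2 hexp hlight hFw (hS₀ F hFH))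
    (fun F hF => by
      obtain ⟨hFH, hFw⟩ := (Finset.mem_filter.1 hF).2
      have hcard : ((X F).card : ℝ) ≤ 2 * x ^ 36 := by
        have h := (hS₀ F hFH).le_two_mul_pow (one_le_pow₀ (by linarith)) (by rwa [hδ72])
          (hw1 F hFH)
        rwa [← pow_mul] at h
      have hsub : (E.filter fun F' => ¬ Disjoint (X F) (X F')) ⊆
          (X F).biUnion fun v => E.filter fun F' => v ∈ F' := by
        intro F' hF'
        obtain ⟨hF'E, hdis⟩ := Finset.mem_filter.1 hF'
        obtain ⟨v, hv, hv'⟩ := Finset.not_disjoint_iff.1 hdis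
        exact Finset.mem_biUnion.2
          ⟨v, hv, Finset.mem_filter.2 ⟨hF'E, (Finset.mem_filter.1 hv').1⟩⟩
      have hdeg : ∀ v, ((E.filter fun F' => v ∈ F').card : ℝ) ≤ C * x ^ (72 * C) := by
        intro v
        have h := hH.2 v (δ ^ 72) (by positivity) (pow_le_one₀ hδ.le hδ1)
        rw [← inv_pow, hδdef, inv_inv, ← pow_mul] at h
        refine le_trans (Nat.cast_le.2 ?_) h
        rw [← ncard_coe_finset]
        refine ncard_le_ncard (fun F' hF' => ?_) (toFinite _)
        obtain ⟨hF'E, hv⟩ := Finset.mem_filter.1 (Finset.mem_coe.1 hF')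
        obtain ⟨hF'H, hF'w⟩ := (Finset.mem_filter.1 hF'E).2
        exact ⟨hF'H, hv, hF'w.le⟩
      calc ((E.filter fun F' => ¬ Disjoint (X F) (X F')).card : ℝ)
          ≤ ∑ v ∈ X F, ((E.filter fun F' => v ∈ F').card : ℝ) := by
            exact_mod_cast (Finset.card_le_card hsub).trans Finset.card_biUnion_le
        _ ≤ (X F).card • (C * x ^ (72 * C)) := Finset.sum_le_card_nsmul _ _ _ fun v _ => hdeg v
        _ ≤ 2 * x ^ 36 * (C * x ^ (72 * C)) := by
            rw [nsmul_eq_mul]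
            gcongr)
  refine ⟨S₀ ∩ {v | ω v = true}, inter_subset_left, ?_⟩
  rw [isGoodSet_pow_twelve_iff hx0 hw1]
  intro F hF
  rw [hncard]
  rcases le_or_gt ((F.card : ℝ) / N) (δ ^ 72) with hw | hw
  · have hw24 : (F.card : ℝ) / N ≤ δ ^ 24 :=
      hw.trans (pow_le_pow_of_le_one hδ.le hδ1 (by norm_num))
    have hw8 : (F.card : ℝ) / N ≤ δ ^ 8 :=
      hw24.trans (pow_le_pow_of_le_one hδ.le hδ1 (by norm_num))
    exact ⟨fun h => absurd hw8 (not_le.2 h), fun h => absurd hw24 (not_le.2 h),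
      fun _ => (Finset.card_filter_le _ _).trans ((hS₀ F hF).2.2 (by rwa [hδ72]))⟩
  · exact not_not.1 (hω F (Finset.mem_filter.2 ⟨Finset.mem_univ _, hF, hw⟩))
end
end
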